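/- Let n ≥ 2 and 1 ≤ k ≤ n−1. Let u : ℝⁿ → ℝ be a smooth entire k-convex function which has quadratic growth, solves σ_k(λ(D²u(x))) = 1 for all x ∈ ℝⁿ, and is moreover (k+1)-convex. Then u is a quadratic polynomial, i.e. there exist a symmetric matrix A, a vector b ∈ ℝⁿ and c ∈ ℝ with u(x) = ½ xᵀAx + b·x + c for all x. -/

import Mathlib

open scoped BigOperators

noncomputable section

/-- The positive orthant `Γₙ = (0,∞)ⁿ` in `ℝⁿ`. -/
def PosOrthant (n : ℕ) : Set (Fin n → ℝ) := {lam | ∀ i, 0 < lam i}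

/-- A convex invariant cone: an open cone `Γ ⊆ ℝⁿ` with vertex at the origin, `Γ ≠ ℝⁿ`,
which is convex, satisfies `Γ + Γₙ ⊆ Γ`, and is invariant under permutations of coordinates. -/
def IsConvexInvariantCone {n : ℕ} (Γ : Set (Fin n → ℝ)) : Prop :=
  IsOpen Γ ∧ Γ ≠ Set.univ ∧ Convex ℝ Γ ∧
    (∀ lam ∈ Γ, ∀ t : ℝ, 0 < t → t • lam ∈ Γ) ∧
    (∀ lam ∈ Γ, ∀ tau ∈ PosOrthant n, lam + tau ∈ Γ) ∧
    (∀ lam ∈ Γ, ∀ σ : Equiv.Perm (Fin n), lam ∘ σ ∈ Γ)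

/-- The partial derivative `∂f/∂λᵢ(λ)`. -/
def fpd {n : ℕ} (f : (Fin n → ℝ) → ℝ) (i : Fin n) (lam : Fin n → ℝ) : ℝ :=
  fderiv ℝ f lam (Pi.single i 1)

/-- A concave elliptic Hessian operator on a convex invariant cone `Γ`:
a `C²`, permutation-invariant, concave function `f` on `Γ` which is elliptic
(`∂f/∂λᵢ > 0`), positive, and positively homogeneous of degree one. -/
def IsConcaveEllipticHessianOp {n : ℕ} (Γ : Set (Fin n → ℝ)) (f : (Fin n → ℝ) → ℝ) : Prop :=
  ContDiffOn ℝ 2 f Γ ∧ ConcaveOn ℝ Γ f ∧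
    (∀ lam ∈ Γ, ∀ σ : Equiv.Perm (Fin n), f (lam ∘ σ) = f lam) ∧
    (∀ lam ∈ Γ, ∀ i, 0 < fpd f i lam) ∧
    (∀ lam ∈ Γ, 0 < f lam) ∧
    (∀ lam ∈ Γ, ∀ t : ℝ, 0 < t → f (t • lam) = t * f lam)

/-- Condition N: whenever `λ ∈ Γ` satisfies `f(λ) = 1` and `Σᵢ ∂f/∂λᵢ(λ) ≤ C` for some `C > 0`,
then `∂f/∂λᵢ(λ) ≥ 1/(N₁ C^{N₂})` for every `i`. -/
def ConditionN {n : ℕ} (Γ : Set (Fin n → ℝ)) (f : (Fin n → ℝ) → ℝ) (N₁ N₂ : ℝ) : Prop :=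
  ∀ lam ∈ Γ, f lam = 1 → ∀ C : ℝ, 0 < C → (∑ i, fpd f i lam) ≤ C →
    ∀ i, 1 / (N₁ * C ^ N₂) ≤ fpd f i lam

/-- The Hessian matrix `D²u(x)`. -/
def hessianMatrix {n : ℕ} (u : EuclideanSpace ℝ (Fin n) → ℝ) (x : EuclideanSpace ℝ (Fin n)) :
    Matrix (Fin n) (Fin n) ℝ :=
  fun i j => iteratedFDeriv ℝ 2 u x ![EuclideanSpace.single i 1, EuclideanSpace.single j 1]

/-- The vector of eigenvalues `λ(D²u(x))` of the Hessian of `u` at `x`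
(junk value `0` if the Hessian matrix fails to be symmetric). -/
def hessEigen {n : ℕ} (u : EuclideanSpace ℝ (Fin n) → ℝ) (x : EuclideanSpace ℝ (Fin n)) :
    Fin n → ℝ :=
  if h : (hessianMatrix u x).IsHermitian then h.eigenvalues else 0

/-- Condition D for a solution `u` of `F(D²u) = 1` on a set `Ω`: at every point, if an
eigenvalue `λᵢ` of `D²u` exceeds `D₁` then `∂f/∂λᵢ(λ) ⬝ λᵢ ≤ D₂`. -/
def ConditionD {n : ℕ} (f : (Fin n → ℝ) → ℝ) (u : EuclideanSpace ℝ (Fin n) → ℝ)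
    (Ω : Set (EuclideanSpace ℝ (Fin n))) (D₁ D₂ : ℝ) : Prop :=
  ∀ x ∈ Ω, ∀ i, D₁ < hessEigen u x i →
    fpd f i (hessEigen u x) * hessEigen u x i ≤ D₂

/-- The `k`-th elementary symmetric polynomial `σ_k` on `ℝⁿ`. -/
def esymmF (n k : ℕ) (lam : Fin n → ℝ) : ℝ :=
  ∑ s ∈ (Finset.univ : Finset (Fin n)).powersetCard k, ∏ i ∈ s, lam i

/-- The Gårding cone `Γ_k = {λ : σ_j(λ) > 0, j = 1,…,k}`. -/
def GammaK (n k : ℕ) : Set (Fin n → ℝ) :=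
  {lam | ∀ j : ℕ, 1 ≤ j → j ≤ k → 0 < esymmF n j lam}

/-- The cone `Γ̂_p` of vectors all of whose sums of `p` distinct coordinates are positive. -/
def GammaHat (n p : ℕ) : Set (Fin n → ℝ) :=
  {lam | ∀ s : Finset (Fin n), s.card = p → 0 < ∑ i ∈ s, lam i}

/-- The `p`-Monge–Ampère operator `M_p(λ) = ∏_{i₁<⋯<i_p} (λ_{i₁} + ⋯ + λ_{i_p})`. -/
def pMA (n p : ℕ) (lam : Fin n → ℝ) : ℝ :=
  ∏ s ∈ (Finset.univ : Finset (Fin n)).powersetCard p, ∑ i ∈ s, lam i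

/-- Quadratic growth: `u(x) ≥ C⁻¹|x|² − C` for some `C > 0`. -/
def QuadraticGrowth {n : ℕ} (u : EuclideanSpace ℝ (Fin n) → ℝ) : Prop :=
  ∃ C : ℝ, 0 < C ∧ ∀ x, C⁻¹ * ‖x‖ ^ 2 - C ≤ u x

/-- `u` is a quadratic polynomial: `u(x) = ½ xᵀAx + b·x + c` with `A` symmetric. -/
def IsQuadraticPolynomial {n : ℕ} (u : EuclideanSpace ℝ (Fin n) → ℝ) : Prop :=
  ∃ (A : Matrix (Fin n) (Fin n) ℝ) (b : Fin n → ℝ) (c : ℝ), A.IsSymm ∧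
    ∀ x, u x = (1 / 2) * (∑ i, ∑ j, A i j * x i * x j) + (∑ i, b i * x i) + c

set_option linter.all false

theorem ms_top (s : Multiset ℝ) :
    ∀ M, s.card = M + 1 → s.esymm M ^ 2 + 2 * (M+1) * s.esymm (M+1) * (if M = 0 then 0 else s.esymm (M-1)) ≤ (M+1) * s.esymm M ^ 2 := by
  induction s using Multiset.induction with
  | empty => intro M h; simp at h
  | cons a s ih =>
    intro M h
    have hs : s.card = M := by simpa using h
    rcases M with _ | M
    · simp [Multiset.esymm]
    have h1 := ih M hs
    have e1 : (a ::ₘ s).esymm (M+2) = s.esymm (M+2) + a * s.esymm (M+1) := by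
      simp [Multiset.esymm, Multiset.powersetCard_cons, Multiset.map_map, Multiset.sum_map_mul_left]
    have e2 : (a ::ₘ s).esymm (M+1) = s.esymm (M+1) + a * s.esymm (M) := by
      simp [Multiset.esymm, Multiset.powersetCard_cons, Multiset.map_map, Multiset.sum_map_mul_left]
    have e0 : s.esymm (M+2) = 0 := by
      simp [Multiset.esymm, Multiset.powersetCard_eq_empty (M+2) (by omega : s.card < M+2)]
    have e3 : (a ::ₘ s).esymm (M) = s.esymm (M) + a * (if M = 0 then 0 else s.esymm (M-1)) := by
      rcases M with _ | M
      · simp [Multiset.esymm]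
      · simp [Multiset.esymm, Multiset.powersetCard_cons, Multiset.map_map, Multiset.sum_map_mul_left]
    simp only [Nat.add_eq_zero_iff, one_ne_zero, and_false, if_false, Nat.add_sub_cancel]
    rw [e1, e2, e3, e0]
    set P := s.esymm (M+1)
    set Q := s.esymm M
    set R := (if M = 0 then 0 else s.esymm (M-1))
    push_cast
    have hM : (0:ℝ) < (M:ℝ) + 1 := by positivity
    have key : (Q*a)^2 + 2*(M+1)*P*R*a^2 ≤ (M+1)*Q^2*a^2 := by nlinarith [mul_le_mul_of_nonneg_right h1 (sq_nonneg a)]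
    have key2 : 0 ≤ ((M:ℝ)+1) * (((M:ℝ)+1+1) * (P + a*Q)^2 - ((P + a * Q) ^ 2 + 2 * (M + 1 + 1) * (0 + a * P) * (Q + a * R))) := by
      nlinarith [sq_nonneg (((M:ℝ)+1)*P - a*Q), mul_le_mul_of_nonneg_left key (by positivity : (0:ℝ) ≤ (M:ℝ)+1+1)]
    nlinarith [nonneg_of_mul_nonneg_right key2 hM]

theorem ms_rolle (s : Multiset ℝ) (M : ℕ) (h : s.card = M + 1) :
    ∃ t : Multiset ℝ, t.card = M ∧ ∀ i, i ≤ M → (M+1 : ℝ) * t.esymm i = (M + 1 - i) * s.esymm i := by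
  classical
  set p : Polynomial ℝ := (s.map (fun r => Polynomial.X + Polynomial.C r)).prod with hp
  have hmon : p.Monic := Polynomial.monic_multiset_prod_of_monic _ _ (fun r _ => Polynomial.monic_X_add_C r)
  have hdeg : p.natDegree = M + 1 := by
    rw [hp, Polynomial.natDegree_multiset_prod_of_monic]
    · simp [h]; omega
    · intro f hf
      obtain ⟨r, -, rfl⟩ := Multiset.mem_map.1 hf
      exact Polynomial.monic_X_add_C r
  have hp2 : p = ((s.map (fun r => -r)).map (fun r => Polynomial.X - Polynomial.C r)).prod := by
    rw [hp, Multiset.map_map]; simp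
  have hroots : p.roots.card = M + 1 := by
    rw [hp2, Polynomial.roots_multiset_prod_X_sub_C]; simp [h]
  have hd := Polynomial.card_roots_le_derivative p
  have hd2 : p.derivative.natDegree ≤ M := by
    have := Polynomial.natDegree_derivative_le p; omega
  have hd3 := Polynomial.card_roots' p.derivative
  have hc : p.derivative.roots.card = p.derivative.natDegree := by omega
  have hN : p.derivative.natDegree = M := by omega
  have hlead : p.derivative.leadingCoeff = M + 1 := by
    rw [Polynomial.leadingCoeff, hN, Polynomial.coeff_derivative, ← hdeg]
    have := hmon.coeff_natDegree
    rw [this]; ring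
  have hprod := Polynomial.C_leadingCoeff_mul_prod_multiset_X_sub_C hc
  refine ⟨p.derivative.roots.map (fun r => -r), by simp; omega, fun i hi => ?_⟩
  set t := p.derivative.roots.map (fun r => -r) with ht
  have htc : t.card = M := by simp [ht]; omega
  have h1 : p.derivative = Polynomial.C ((M:ℝ)+1) * (t.map (fun r => Polynomial.X + Polynomial.C r)).prod := by
    rw [← hlead, ht, Multiset.map_map]
    refine hprod.symm.trans ?_
    congr 3
    funext r
    simp [sub_eq_add_neg]
  have h2 := congrArg (fun q => Polynomial.coeff q (M - i)) h1
  simp only [Polynomial.coeff_C_mul, Polynomial.coeff_derivative] at h2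
  rw [Multiset.prod_X_add_C_coeff t (by omega), hp, Multiset.prod_X_add_C_coeff s (by omega)] at h2
  rw [show s.card - (M - i + 1) = i by omega, show t.card - (M - i) = i by omega] at h2
  rw [← h2, Nat.cast_sub hi]; ring

theorem ms_newton (M : ℕ) : ∀ s : Multiset ℝ, s.card = M → ∀ j, j + 2 ≤ M →
    ((j:ℝ) + 2) * (M - j) * (s.esymm j * s.esymm (j+2)) ≤ (j + 1) * (M - j - 1) * s.esymm (j+1) ^ 2 := by
  induction M with
  | zero => intro s _ j hj; omega
  | succ M ih =>
    intro s hs j hj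
    by_cases hjM : j + 2 = M + 1
    · obtain rfl : M = j + 1 := by omega
      have := ms_top s (j+1) hs
      simp at this
      push_cast
      have e : s.esymm (j+1+1) = s.esymm (j+2) := rfl
      rw [e] at this
      nlinarith [this]
    · have hj2 : j + 2 ≤ M := by omega
      obtain ⟨t, ht, hte⟩ := ms_rolle s M hs
      have h0 := hte j (by omega)
      have h1 := hte (j+1) (by omega)
      have h2 := hte (j+2) (by omega)
      have h3 := ih t ht j hj2
      push_cast at *
      have hM : (0:ℝ) < M + 1 := by positivity
      have hj3 : (j:ℝ) + 2 ≤ M := by exact_mod_cast hj2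
      have h4 : ((j:ℝ) + 2) * (M - j) * (((M+1) * t.esymm j) * ((M+1)*t.esymm (j+2))) ≤ (j + 1) * (M - j - 1) * ((M+1)*t.esymm (j+1)) ^ 2 := by
        have := mul_le_mul_of_nonneg_left h3 (by positivity : (0:ℝ) ≤ (M+1)*(M+1))
        nlinarith [this]
      rw [h0, h1, h2] at h4
      have hpos : (0:ℝ) < (M - j) * (M - j - 1) := by
        apply mul_pos <;> linarith
      have h5 : ((M:ℝ) - j) * (M - j - 1) * (((j:ℝ) + 2) * (M + 1 - j) * (s.esymm j * s.esymm (j+2))) ≤ (M - j) * (M - j - 1) * ((j + 1) * (M + 1 - j - 1) * s.esymm (j+1) ^ 2) := by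
        nlinarith [h4]
      exact le_of_mul_le_mul_left h5 hpos

/-! elementary symmetric functions of subsets -/

def es {ι : Type*} (I : Finset ι) (j : ℕ) (l : ι → ℝ) : ℝ := ∑ s ∈ I.powersetCard j, ∏ i ∈ s, l i

def Gam {ι : Type*} (I : Finset ι) (k : ℕ) (l : ι → ℝ) : Prop := ∀ j, 1 ≤ j → j ≤ k → 0 < es I j l

section lam
variable {ι : Type*} [DecidableEq ι]

theorem es_zero (I : Finset ι) (l : ι → ℝ) : es I 0 l = 1 := by simp [es]

theorem es_empty_succ (j : ℕ) (l : ι → ℝ) : es (∅ : Finset ι) (j+1) l = 0 := by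
  simp [es, Finset.powersetCard_eq_empty.2 (show (∅ : Finset ι).card < j+1 by simp)]

theorem es_big (I : Finset ι) (j : ℕ) (h : I.card < j) (l : ι → ℝ) : es I j l = 0 := by
  simp [es, Finset.powersetCard_eq_empty.2 h]

theorem es_insert (I : Finset ι) (i : ι) (hi : i ∉ I) (j : ℕ) (l : ι → ℝ) :
    es (insert i I) (j+1) l = es I (j+1) l + l i * es I j l := by
  unfold es
  rw [Finset.powersetCard_succ_insert hi, Finset.sum_union, Finset.sum_image, Finset.mul_sum]
  · congr 1
    apply Finset.sum_congr rfl
    intro s hs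
    rw [Finset.prod_insert]
    exact fun h => hi ((Finset.mem_powersetCard.1 hs).1 h)
  · intro s hs t ht hst
    have h1 : i ∉ s := fun h => hi ((Finset.mem_powersetCard.1 hs).1 h)
    have h2 : i ∉ t := fun h => hi ((Finset.mem_powersetCard.1 ht).1 h)
    rw [← Finset.erase_insert h1, ← Finset.erase_insert h2, hst]
  · rw [Finset.disjoint_left]
    intro s hs hs2
    obtain ⟨t, ht, rfl⟩ := Finset.mem_image.1 hs2
    exact hi ((Finset.mem_powersetCard.1 hs).1 (Finset.mem_insert_self i t))

theorem es_erase (I : Finset ι) (i : ι) (hi : i ∈ I) (j : ℕ) (l : ι → ℝ) :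
    es I (j+1) l = es (I.erase i) (j+1) l + l i * es (I.erase i) j l := by
  conv_lhs => rw [← Finset.insert_erase hi]
  exact es_insert _ _ (Finset.notMem_erase i I) _ _

theorem es_sum_erase_mul (I : Finset ι) (j : ℕ) (l : ι → ℝ) :
    ∑ i ∈ I, l i * es (I.erase i) j l = (j+1) * es I (j+1) l := by
  induction I using Finset.induction_on generalizing j with
  | empty => simp [es_empty_succ]
  | insert a I ha ih =>
    rw [Finset.sum_insert ha, Finset.erase_insert ha, es_insert I a ha]
    have hne : ∀ i ∈ I, (insert a I).erase i = insert a (I.erase i) := by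
      intro i hi
      rw [Finset.erase_insert_of_ne]
      rintro rfl; exact ha hi
    have hna : ∀ i, a ∉ I.erase i := fun i h => ha (Finset.mem_of_mem_erase h)
    rcases j with _ | j
    · have := ih 0
      simp only [es_zero] at *
      rw [this]; push_cast; ring
    · have e : ∑ i ∈ I, l i * es ((insert a I).erase i) (j+1) l = ∑ i ∈ I, (l i * es (I.erase i) (j+1) l + l a * (l i * es (I.erase i) j l)) := by
        apply Finset.sum_congr rfl
        intro i hi
        rw [hne i hi, es_insert _ _ (hna i)]; ring
      rw [e, Finset.sum_add_distrib, ← Finset.mul_sum, ih, ih]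
      push_cast; ring

theorem es_sum_erase (I : Finset ι) (j : ℕ) (l : ι → ℝ) :
    ∑ i ∈ I, es (I.erase i) j l = ((I.card:ℝ) - j) * es I j l := by
  rcases j with _ | j
  · simp [es_zero]
  · have h1 : ∑ i ∈ I, es I (j+1) l = ∑ i ∈ I, es (I.erase i) (j+1) l + ∑ i ∈ I, l i * es (I.erase i) j l := by
      rw [← Finset.sum_add_distrib]
      exact Finset.sum_congr rfl (fun i hi => es_erase I i hi j l)
    rw [es_sum_erase_mul, Finset.sum_const, nsmul_eq_mul] at h1
    push_cast; linarith

theorem es_newton (I : Finset ι) (j : ℕ) (l : ι → ℝ) (h : j + 2 ≤ I.card) :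
    ((j:ℝ) + 2) * (I.card - j) * (es I j l * es I (j+2) l) ≤ (j + 1) * (I.card - j - 1) * es I (j+1) l ^ 2 := by
  have := ms_newton I.card (I.val.map l) (by simp) j h
  simp only [Finset.esymm_map_val] at this
  exact this

theorem es_newton2 (I : Finset ι) (j : ℕ) (l : ι → ℝ) (h : j + 1 ≤ I.card) :
    ((I.card:ℝ) - j) * (es I j l * es I (j+2) l) ≤ (I.card - j - 1) * es I (j+1) l ^ 2 := by
  by_cases h2 : j + 2 ≤ I.card
  · have h1 := es_newton I j l h2
    have h3 : (j:ℝ) + 2 ≤ I.card := by exact_mod_cast h2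
    have h4 : (0:ℝ) ≤ (I.card - j - 1) * es I (j+1) l ^ 2 := mul_nonneg (by linarith) (sq_nonneg _)
    have hj : (0:ℝ) < j + 2 := by positivity
    apply le_of_mul_le_mul_left _ hj
    nlinarith
  · have h3 : I.card = j + 1 := by omega
    rw [es_big I (j+2) (by omega), h3]; push_cast; simp

theorem es_newton_weak (I : Finset ι) (j : ℕ) (l : ι → ℝ) :
    es I j l * es I (j+2) l ≤ es I (j+1) l ^ 2 := by
  by_cases h2 : j + 1 ≤ I.card
  · have h1 := es_newton2 I j l h2
    have h3 : (j:ℝ) + 1 ≤ I.card := by exact_mod_cast h2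
    have hj : (0:ℝ) < I.card - j := by linarith
    apply le_of_mul_le_mul_left _ hj
    nlinarith [sq_nonneg (es I (j+1) l)]
  · rw [es_big I (j+2) (by omega)]; simpa using sq_nonneg _

theorem Gam.mono {I : Finset ι} {k k' : ℕ} {l : ι → ℝ} (h : Gam I k l) (hk : k' ≤ k) : Gam I k' l :=
  fun j h1 h2 => h j h1 (h2.trans hk)

theorem Gam.pos {I : Finset ι} {k : ℕ} {l : ι → ℝ} (h : Gam I k l) (j : ℕ) (hj : j ≤ k) : 0 < es I j l := by
  rcases Nat.eq_zero_or_pos j with rfl | h0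
  · rw [es_zero]; exact one_pos
  · exact h j h0 hj

theorem Gam.erase {I : Finset ι} {k : ℕ} {l : ι → ℝ} (h : Gam I (k+1) l) {i : ι} (hi : i ∈ I) :
    Gam (I.erase i) k l := by
  have key : ∀ j, j ≤ k → 0 < es (I.erase i) j l := by
    intro j
    induction j with
    | zero => intro _; rw [es_zero]; exact one_pos
    | succ j ih =>
      intro hj
      have hp := ih (by omega)
      by_contra hq
      push Not at hq
      have h1 := h.pos (j+1) (by omega)
      have h2 := h.pos (j+2) (by omega)
      rw [es_erase I i hi] at h1 h2
      have h3 := es_newton_weak (I.erase i) j l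
      set p := es (I.erase i) j l
      set q := es (I.erase i) (j+1) l
      set r := es (I.erase i) (j+2) l
      have hr : 0 < r + l i * q := h2
      have hx : 0 < l i * p := by linarith
      have hx' : 0 < l i := (pos_iff_pos_of_mul_pos hx).2 hp
      nlinarith
  exact fun j _ hj => key j hj

section lam
variable {ι : Type*} [DecidableEq ι]

theorem es_one (I : Finset ι) (l : ι → ℝ) : es I 1 l = ∑ i ∈ I, l i := by
  have := es_sum_erase_mul I 0 l
  simp only [es_zero] at this
  simp at this
  linarith

theorem es_smul (I : Finset ι) (j : ℕ) (c : ℝ) (l : ι → ℝ) : es I j (fun i => c * l i) = c ^ j * es I j l := by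
  unfold es
  rw [Finset.mul_sum]
  apply Finset.sum_congr rfl
  intro s hs
  rw [Finset.prod_mul_distrib, Finset.prod_const, (Finset.mem_powersetCard.1 hs).2]

theorem titu {x y a b d : ℝ} (ha : 0 < a) (hb : 0 < b) (hd : a + b ≤ d) :
    (x + y) ^ 2 / d ≤ x ^ 2 / a + y ^ 2 / b := by
  have hab : 0 < a + b := by positivity
  calc (x+y)^2 / d ≤ (x+y)^2/(a+b) := by
        apply div_le_div_of_nonneg_left (sq_nonneg _) hab hd
    _ ≤ _ := by
        rw [div_add_div _ _ ha.ne' hb.ne', div_le_div_iff₀ hab (by positivity)]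
        nlinarith [mul_nonneg (mul_nonneg ha.le hb.le) (sq_nonneg (x*b-y*a)), sq_nonneg (x*b-y*a)]

theorem q_formula {I : Finset ι} {k : ℕ} {l : ι → ℝ} (h : Gam I (k+1) l)
    (h' : ∀ i ∈ I, 0 < es (I.erase i) k l) :
    (k + 2 : ℝ) * (es I (k+2) l / es I (k+1) l) = ∑ i ∈ I, (l i - l i ^ 2 / (l i + es (I.erase i) (k+1) l / es (I.erase i) k l)) := by
  have h1 := h.pos (k+1) le_rfl
  have h2 := es_sum_erase_mul I (k+1) l
  rw [← mul_div_assoc, show (k+2:ℝ) * es I (k+2) l = ∑ i ∈ I, l i * es (I.erase i) (k+1) l by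
    rw [h2]; push_cast; ring, Finset.sum_div]
  apply Finset.sum_congr rfl
  intro i hi
  have h3 := h' i hi
  have h4 := es_erase I i hi k l
  have h5 : l i + es (I.erase i) (k+1) l / es (I.erase i) k l = es I (k+1) l / es (I.erase i) k l := by
    rw [h4]; field_simp; ring
  rw [h5]
  have h6 : es (I.erase i) (k+1) l = es I (k+1) l - l i * es (I.erase i) k l := by linarith
  rw [h6]; field_simp

theorem es_superadd (k : ℕ) : ∀ (I : Finset ι) (l m : ι → ℝ), Gam I (k+1) l → Gam I (k+1) m →
    Gam I (k+1) (fun i => l i + m i) ∧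
    es I (k+1) l / es I k l + es I (k+1) m / es I k m ≤ es I (k+1) (fun i => l i + m i) / es I k (fun i => l i + m i) := by
  induction k with
  | zero =>
    intro I l m hl hm
    have e : es I 1 (fun i => l i + m i) = es I 1 l + es I 1 m := by
      simp [es_one, Finset.sum_add_distrib]
    constructor
    · intro j h1 h2
      obtain rfl : j = 1 := by omega
      rw [e]
      exact add_pos (hl 1 le_rfl le_rfl) (hm 1 le_rfl le_rfl)
    · simp only [zero_add, es_zero, e, div_one]; exact le_rfl
  | succ k ih =>
    intro I l m hl hm
    obtain ⟨g1, g2⟩ := ih I l m (hl.mono (by omega)) (hm.mono (by omega))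
    have ihe : ∀ i ∈ I, _ := fun i hi => ih (I.erase i) l m (hl.erase hi) (hm.erase hi)
    have F1 := q_formula (hl.mono (by omega : k + 1 ≤ k+1+1)) (fun i hi => (hl.erase hi).pos k (by omega))
    have F2 := q_formula (hm.mono (by omega : k + 1 ≤ k+1+1)) (fun i hi => (hm.erase hi).pos k (by omega))
    have F3 := q_formula g1 (fun i hi => (ihe i hi).1.pos k (by omega))
    have dpos : ∀ p : ι → ℝ, Gam I (k+1+1) p → ∀ i ∈ I, 0 < p i + es (I.erase i) (k+1) p / es (I.erase i) k p := by
      intro p hp i hi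
      have h3 := (hp.erase hi).pos k (by omega)
      have h4 := es_erase I i hi k p
      have h5 : p i + es (I.erase i) (k+1) p / es (I.erase i) k p = es I (k+1) p / es (I.erase i) k p := by
        rw [h4]; field_simp; ring
      rw [h5]; exact div_pos (hp.pos _ (by omega)) h3
    have hle : (k + 2 : ℝ) * (es I (k+2) l / es I (k+1) l) + (k + 2 : ℝ) * (es I (k+2) m / es I (k+1) m) ≤ (k + 2 : ℝ) * (es I (k+2) (fun i => l i + m i) / es I (k+1) (fun i => l i + m i)) := by
      rw [F1, F2, F3, ← Finset.sum_add_distrib]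
      apply Finset.sum_le_sum
      intro i hi
      have := titu (x := l i) (y := m i) (dpos l hl i hi) (dpos m hm i hi) (d := (l i + m i) + es (I.erase i) (k+1) (fun i => l i + m i) / es (I.erase i) k (fun i => l i + m i)) (by
        linarith [(ihe i hi).2])
      linarith
    have hk : (0:ℝ) < k + 2 := by positivity
    have hq : es I (k+2) l / es I (k+1) l + es I (k+2) m / es I (k+1) m ≤ es I (k+2) (fun i => l i + m i) / es I (k+1) (fun i => l i + m i) := by
      apply le_of_mul_le_mul_left _ hk; linarith
    have hpl : 0 < es I (k+2) l / es I (k+1) l := div_pos (hl.pos _ (by omega)) (hl.pos _ (by omega))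
    have hpm : 0 < es I (k+2) m / es I (k+1) m := div_pos (hm.pos _ (by omega)) (hm.pos _ (by omega))
    refine ⟨?_, hq⟩
    intro j h1 h2
    by_cases hj : j = k + 2
    · subst hj
      have h3 := g1.pos (k+1) le_rfl
      have h4 : 0 < es I (k+2) (fun i => l i + m i) / es I (k+1) (fun i => l i + m i) := by linarith
      have := mul_pos h4 h3
      rwa [div_mul_cancel₀ _ h3.ne'] at this
    · exact g1 j h1 (by omega)

theorem es_logconc (k : ℕ) (I : Finset ι) (l B : ι → ℝ) : Gam I k (fun i => l i + B i) → Gam I k (fun i => l i - B i) →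
    es I k (fun i => l i + B i) * es I k (fun i => l i - B i) ≤ es I k l ^ 2 := by
  induction k with
  | zero => intro _ _; simp [es_zero]
  | succ k ih =>
    intro h1 h2
    have h3 := ih (h1.mono (by omega)) (h2.mono (by omega))
    obtain ⟨g1, g2⟩ := es_superadd k I _ _ h1 h2
    have e : (fun i => (l i + B i) + (l i - B i)) = (fun i => 2 * l i) := by funext i; ring
    rw [e] at g1 g2
    rw [es_smul, es_smul] at g2
    have p1 := h1.pos k (by omega)
    have p2 := h2.pos k (by omega)
    have p1' := h1.pos (k+1) (by omega)
    have p2' := h2.pos (k+1) (by omega)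
    have p3 := g1.pos k (by omega)
    have p3' := g1.pos (k+1) (by omega)
    rw [es_smul] at p3 p3'
    have p4 : 0 < es I k l := (pos_iff_pos_of_mul_pos p3).1 (by positivity)
    have p4' : 0 < es I (k+1) l := (pos_iff_pos_of_mul_pos p3').1 (by positivity)
    generalize es I k l = c at *
    generalize es I (k+1) l = c' at *
    generalize es I k (fun i => l i + B i) = a at *
    generalize es I (k+1) (fun i => l i + B i) = a' at *
    generalize es I k (fun i => l i - B i) = b at *
    generalize es I (k+1) (fun i => l i - B i) = b' at *
    have g3 : a'/a + b'/b ≤ 2 * (c'/c) := by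
      refine g2.trans (le_of_eq ?_)
      rw [pow_succ]; field_simp
    have q1 : 0 < a'/a := by positivity
    have q2 : 0 < b'/b := by positivity
    have q3 : 0 < c'/c := by positivity
    have h4 : (a'/a) * (b'/b) ≤ (c'/c)^2 := by nlinarith [sq_nonneg (a'/a - b'/b)]
    have h5 := mul_le_mul h4 h3 (by positivity) (by positivity)
    calc a' * b' = (a'/a)*(b'/b)*(a*b) := by field_simp
      _ ≤ _ := h5
      _ = c'^2 := by field_simp

theorem es_qmono {I : Finset ι} {k : ℕ} {l : ι → ℝ} (j : ℕ) (hj : j ≤ k) (h : Gam I (k+1) l)  :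
    es I (k+1) l * es I j l ≤ es I k l * es I (j+1) l := by
  induction k, hj using Nat.le_induction with
  | base => exact (mul_comm _ _).le
  | succ k hk ih =>
    have h1 := ih (h.mono (by omega))
    have h2 := es_newton_weak I k l
    have pk := h.pos k (by omega)
    have pk1 := h.pos (k+1) (by omega)
    have pj := h.pos j (by omega)
    apply le_of_mul_le_mul_left _ pk
    nlinarith [mul_le_mul_of_nonneg_right h2 pj.le, mul_le_mul_of_nonneg_left h1 pk1.le]

theorem es_le_pow {I : Finset ι} {k : ℕ} {l : ι → ℝ} (h : Gam I k l) : es I k l ≤ es I 1 l ^ k := by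
  induction k with
  | zero => simp [es_zero]
  | succ k ih =>
    have h1 := es_qmono 0 (by omega) h
    rw [es_zero, zero_add, mul_one] at h1
    have := ih (h.mono (by omega))
    have p := h.pos 1 (by omega)
    rw [pow_succ]
    exact h1.trans (mul_le_mul_of_nonneg_right this p.le)

section A
variable {I : Finset ι} {m : ℕ} {l : ι → ℝ} (h : Gam I (m+2) l) (h1 : es I (m+1) l = 1)
include h h1

theorem A_card : m + 2 ≤ I.card := by
  by_contra hc
  have := h.pos (m+2) le_rfl
  rw [es_big I (m+2) (by omega)] at this
  exact lt_irrefl _ this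

theorem A_step (j : ℕ) (hj : j ≤ m) : es I j l ≤ es I (j+1) l * es I m l := by
  have := es_qmono j hj (h.mono (by omega : m+1 ≤ m+2))
  rw [h1] at this; linarith

theorem A_E : 1 ≤ es I m l := by
  have p := h.pos m (by omega)
  have key : ∀ j, j ≤ m + 1 → 1 ≤ es I j l * es I m l ^ j := by
    intro j
    induction j with
    | zero => intro _; simp [es_zero]
    | succ j ih =>
      intro hj
      have h2 := A_step h h1 j (by omega)
      have h3 := ih (by omega)
      calc (1:ℝ) ≤ es I j l * es I m l ^ j := h3
        _ ≤ (es I (j+1) l * es I m l) * es I m l ^ j := mul_le_mul_of_nonneg_right h2 (by positivity)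
        _ = _ := by ring
  have := key (m+1) le_rfl
  rw [h1, one_mul] at this
  by_contra hc
  push Not at hc
  have := pow_lt_one₀ p.le hc (by omega : m+1 ≠ 0)
  linarith

theorem A_e1 : es I 1 l ≤ es I m l ^ m := by
  have p := h.pos m (by omega)
  have key : ∀ j, j ≤ m → es I 1 l ≤ es I (j+1) l * es I m l ^ j := by
    intro j
    induction j with
    | zero => intro _; simp
    | succ j ih =>
      intro hj
      have h2 := A_step h h1 (j+1) (by omega)
      have h3 := ih (by omega)
      calc es I 1 l ≤ es I (j+1) l * es I m l ^ j := h3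
        _ ≤ (es I (j+1+1) l * es I m l) * es I m l ^ j := mul_le_mul_of_nonneg_right h2 (by positivity)
        _ = _ := by ring
  have := key m le_rfl
  rwa [h1, one_mul] at this

theorem A_fpos {i : ι} (hi : i ∈ I) : 0 < es (I.erase i) m l := (h.erase hi).pos m (by omega)

theorem A_lf_lt {i : ι} (hi : i ∈ I) : l i * es (I.erase i) m l < 1 := by
  have h2 := es_erase I i hi m l
  have h3 := (h.erase hi).pos (m+1) le_rfl
  linarith

theorem A_lf_gt {i : ι} (hi : i ∈ I) : -(I.card:ℝ) ≤ l i * es (I.erase i) m l := by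
  have f := A_fpos h h1 hi
  by_cases hl : 0 ≤ l i
  · have := mul_nonneg hl f.le
    have : (0:ℝ) ≤ I.card := by positivity
    linarith
  push Not at hl
  have h2 := es_erase I i hi m l
  have h3 := (h.erase hi).pos (m+1) le_rfl
  have h4 := h.pos (m+2) le_rfl
  rw [es_erase I i hi (m+1)] at h4
  have hc := A_card h h1
  have hce : (I.erase i).card = I.card - 1 := Finset.card_erase_of_mem hi
  have hce' : ((I.erase i).card : ℝ) = I.card - 1 := by rw [hce, Nat.cast_sub (by omega)]; simp
  have h5 := es_newton2 (I.erase i) m l (by omega)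
  rw [hce'] at h5
  have hN : (m:ℝ) + 2 ≤ I.card := by exact_mod_cast hc
  rw [h1] at h2
  generalize es (I.erase i) m l = s0 at *
  generalize es (I.erase i) (m+1) l = s1 at *
  have h4' : 0 < es (I.erase i) (m+2) l + l i * s1 := h4
  generalize es (I.erase i) (m+2) l = s2 at *
  have h6 : ((I.card:ℝ) - 1 - m) * (s0 * (- l i * s1)) ≤ (I.card - 1 - m - 1) * s1 ^ 2 := by
    refine le_trans ?_ h5
    apply mul_le_mul_of_nonneg_left _ (by linarith)
    apply mul_le_mul_of_nonneg_left _ f.le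
    linarith
  have h7 : ((I.card:ℝ) - 1 - m) * (s0 * (- l i)) ≤ (I.card - 1 - m - 1) * s1 := by
    apply le_of_mul_le_mul_right _ h3
    nlinarith
  have : s1 = 1 - l i * s0 := by linarith
  rw [this] at h7
  have hm : (0:ℝ) ≤ m := by positivity
  nlinarith

theorem A_lf_abs {i : ι} (hi : i ∈ I) : |l i * es (I.erase i) m l| ≤ I.card := by
  rw [abs_le]
  refine ⟨A_lf_gt h h1 hi, (A_lf_lt h h1 hi).le.trans ?_⟩
  have := A_card h h1
  exact_mod_cast (by omega : 1 ≤ I.card)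

theorem A_l_gt {i : ι} (hi : i ∈ I) : -(I.card:ℝ) ≤ l i := by
  by_cases hl : 0 ≤ l i
  · have : (0:ℝ) ≤ I.card := by positivity
    linarith
  push Not at hl
  have hE := A_E h h1
  have hf : 1 ≤ es (I.erase i) m l := by
    rcases m with _ | m
    · rw [es_zero]
    · have := es_erase I i hi m l
      have p := (h.erase hi).pos m (by omega)
      nlinarith
  have := A_lf_gt h h1 hi
  nlinarith

theorem A_l_lt {i : ι} (hi : i ∈ I) : l i < es I 1 l := by
  have h2 := es_erase I i hi 0 l
  have h3 := (h.erase hi).pos 1 (by omega)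
  rw [es_zero, zero_add] at h2
  linarith

theorem A_l_E {i : ι} (hi : i ∈ I) : l i < es I m l ^ m := (A_l_lt h h1 hi).trans_le (A_e1 h h1)

theorem A_f_low {i : ι} (hi : i ∈ I) {K : ℝ} (hK : 0 ≤ K) (hl : ∀ j ∈ I, l j ≤ K) :
    1 ≤ K * (1 + I.card) * es (I.erase i) m l := by
  have h2 := es_erase I i hi m l
  have h3 := es_qmono 0 (Nat.zero_le m) (h.erase hi)
  rw [es_zero, zero_add, mul_one, es_one] at h3
  have f := A_fpos h h1 hi
  have h4 : ∑ j ∈ I.erase i, l j ≤ I.card * K := by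
    calc _ ≤ ∑ j ∈ I.erase i, K := Finset.sum_le_sum (fun j hj => hl j (Finset.mem_of_mem_erase hj))
      _ = ((I.erase i).card:ℝ) * K := by simp
      _ ≤ _ := by
        apply mul_le_mul_of_nonneg_right _ hK
        exact_mod_cast Finset.card_le_card (Finset.erase_subset _ _)
  have h5 := hl i hi
  rw [h1] at h2
  nlinarith

theorem A_f_up {i : ι} (hi : i ∈ I) {K : ℝ} (hK : 0 ≤ K) (hl : ∀ j ∈ I, l j ≤ K) :
    es (I.erase i) m l ≤ (I.card * K) ^ m := by
  have h3 := es_le_pow ((h.erase hi).mono (by omega : m ≤ m+1))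
  have h4 : ∑ j ∈ I.erase i, l j ≤ I.card * K := by
    calc _ ≤ ∑ j ∈ I.erase i, K := Finset.sum_le_sum (fun j hj => hl j (Finset.mem_of_mem_erase hj))
      _ = ((I.erase i).card:ℝ) * K := by simp
      _ ≤ _ := by
        apply mul_le_mul_of_nonneg_right _ hK
        exact_mod_cast Finset.card_le_card (Finset.erase_subset _ _)
  have p := (h.erase hi).pos 1 (by omega)
  rw [es_one] at h3 p
  exact h3.trans (pow_le_pow_left₀ p.le h4 m)

end A
end lam

section mat
open Matrix
variable {ι : Type*} [DecidableEq ι] [Fintype ι]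

def NT : ℕ → Matrix ι ι ℝ → Matrix ι ι ℝ
  | 0, _ => 1
  | k+1, V => (trace (NT k V * V) / ((k:ℝ)+1)) • (1 : Matrix ι ι ℝ) - NT k V * V

def NS : ℕ → Matrix ι ι ℝ → ℝ
  | 0, _ => 1
  | k+1, V => trace (NT k V * V) / ((k:ℝ)+1)

def dNT : ℕ → Matrix ι ι ℝ → Matrix ι ι ℝ → Matrix ι ι ℝ
  | 0, _, _ => 0
  | k+1, V, B => ((trace (dNT k V B * V) + trace (NT k V * B)) / ((k:ℝ)+1)) • (1 : Matrix ι ι ℝ)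
      - (dNT k V B * V + NT k V * B)

def dNS : ℕ → Matrix ι ι ℝ → Matrix ι ι ℝ → ℝ
  | 0, _, _ => 0
  | k+1, V, B => (trace (dNT k V B * V) + trace (NT k V * B)) / ((k:ℝ)+1)

theorem NT_succ (k : ℕ) (V : Matrix ι ι ℝ) : NT (k+1) V = NS (k+1) V • (1 : Matrix ι ι ℝ) - NT k V * V := rfl
theorem NS_succ (k : ℕ) (V : Matrix ι ι ℝ) : NS (k+1) V = trace (NT k V * V) / ((k:ℝ)+1) := rfl

theorem hasDerivAt_mul_entry {X Y : ℝ → Matrix ι ι ℝ} {X' Y' : Matrix ι ι ℝ} {s : ℝ}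
    (hX : ∀ i j, HasDerivAt (fun s => X s i j) (X' i j) s) (hY : ∀ i j, HasDerivAt (fun s => Y s i j) (Y' i j) s) (i j : ι) :
    HasDerivAt (fun s => (X s * Y s) i j) ((X' * Y s + X s * Y') i j) s := by
  simp only [Matrix.mul_apply, Matrix.add_apply, ← Finset.sum_add_distrib]
  apply HasDerivAt.fun_sum
  intro p _
  exact (hX i p).mul (hY p j)

theorem hasDerivAt_trace {X : ℝ → Matrix ι ι ℝ} {X' : Matrix ι ι ℝ} {s : ℝ}
    (hX : ∀ i j, HasDerivAt (fun s => X s i j) (X' i j) s) :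
    HasDerivAt (fun s => trace (X s)) (trace X') s := by
  simp only [Matrix.trace, Matrix.diag]
  apply HasDerivAt.fun_sum
  intro p _
  exact hX p p

theorem hasDerivAt_NT {V : ℝ → Matrix ι ι ℝ} {B : Matrix ι ι ℝ} {s : ℝ}
    (hV : ∀ i j, HasDerivAt (fun s => V s i j) (B i j) s) (k : ℕ) :
    ∀ i j, HasDerivAt (fun s => NT k (V s) i j) (dNT k (V s) B i j) s := by
  induction k with
  | zero => intro i j; simp only [NT, dNT]; exact hasDerivAt_const _ _
  | succ k ih =>
    intro i j
    have h1 := hasDerivAt_mul_entry ih hV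
    have h2 := (hasDerivAt_trace h1).div_const ((k:ℝ)+1)
    have h3 := (h2.mul_const ((1 : Matrix ι ι ℝ) i j)).sub (h1 i j)
    rw [Matrix.trace_add] at h3
    exact h3

theorem hasDerivAt_NS {V : ℝ → Matrix ι ι ℝ} {B : Matrix ι ι ℝ} {s : ℝ}
    (hV : ∀ i j, HasDerivAt (fun s => V s i j) (B i j) s) (k : ℕ) :
    HasDerivAt (fun s => NS k (V s)) (dNS k (V s) B) s := by
  cases k with
  | zero => exact hasDerivAt_const _ _
  | succ k =>
    have h1 := hasDerivAt_mul_entry (hasDerivAt_NT hV k) hV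
    have h2 := (hasDerivAt_trace h1).div_const ((k:ℝ)+1)
    rw [Matrix.trace_add] at h2
    exact h2

/-! conjugation -/
theorem qconj_mul {Q : Matrix ι ι ℝ} (hQ : Qᵀ * Q = 1) (X Y : Matrix ι ι ℝ) :
    (Q * X * Qᵀ) * (Q * Y * Qᵀ) = Q * (X * Y) * Qᵀ := by
  calc (Q * X * Qᵀ) * (Q * Y * Qᵀ) = Q * X * (Qᵀ * Q) * Y * Qᵀ := by simp only [Matrix.mul_assoc]
    _ = _ := by rw [hQ, Matrix.mul_one]; simp only [Matrix.mul_assoc]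

theorem qconj_trace {Q : Matrix ι ι ℝ} (hQ : Qᵀ * Q = 1) (X : Matrix ι ι ℝ) : trace (Q * X * Qᵀ) = trace X := by
  rw [Matrix.trace_mul_comm, ← Matrix.mul_assoc, hQ, Matrix.one_mul]

theorem NT_conj {Q : Matrix ι ι ℝ} (hQ : Qᵀ * Q = 1) (hQ' : Q * Qᵀ = 1) (V : Matrix ι ι ℝ) (k : ℕ) :
    NT k (Q * V * Qᵀ) = Q * NT k V * Qᵀ := by
  induction k with
  | zero => simp [NT, hQ']
  | succ k ih =>
    simp only [NT]
    rw [ih, qconj_mul hQ, qconj_trace hQ, Matrix.mul_sub, Matrix.sub_mul, Matrix.mul_smul, Matrix.smul_mul, Matrix.mul_one, hQ']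

theorem NS_conj {Q : Matrix ι ι ℝ} (hQ : Qᵀ * Q = 1) (hQ' : Q * Qᵀ = 1) (V : Matrix ι ι ℝ) (k : ℕ) :
    NS k (Q * V * Qᵀ) = NS k V := by
  cases k with
  | zero => rfl
  | succ k => rw [NS_succ, NS_succ, NT_conj hQ hQ', qconj_mul hQ, qconj_trace hQ]

theorem dNT_conj {Q : Matrix ι ι ℝ} (hQ : Qᵀ * Q = 1) (hQ' : Q * Qᵀ = 1) (V B : Matrix ι ι ℝ) (k : ℕ) :
    dNT k (Q * V * Qᵀ) (Q * B * Qᵀ) = Q * dNT k V B * Qᵀ := by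
  induction k with
  | zero => simp [dNT]
  | succ k ih =>
    simp only [dNT]
    rw [ih, NT_conj hQ hQ', qconj_mul hQ, qconj_mul hQ, qconj_trace hQ, qconj_trace hQ, Matrix.mul_sub, Matrix.sub_mul,
      Matrix.mul_smul, Matrix.smul_mul, Matrix.mul_one, hQ', Matrix.mul_add, Matrix.add_mul]

/-! diagonal -/
theorem NT_diag (l : ι → ℝ) (k : ℕ) : NT k (diagonal l) = diagonal (fun i => es (Finset.univ.erase i) k l) := by
  induction k with
  | zero => simp [NT, es_zero]
  | succ k ih =>
    simp only [NT]
    rw [ih, diagonal_mul_diagonal, trace_diagonal]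
    have h1 := es_sum_erase_mul Finset.univ k l
    have h2 : ∑ i, es (Finset.univ.erase i) k l * l i = (k+1) * es Finset.univ (k+1) l := by
      rw [← h1]; exact Finset.sum_congr rfl (fun i _ => mul_comm _ _)
    rw [h2, mul_div_cancel_left₀ _ (by positivity : (k:ℝ)+1 ≠ 0)]
    ext i j
    by_cases hij : i = j
    · subst hij
      simp
      have := es_erase Finset.univ i (Finset.mem_univ i) k l
      linarith
    · simp [hij]

theorem NS_diag (l : ι → ℝ) (k : ℕ) : NS k (diagonal l) = es Finset.univ k l := by
  cases k with
  | zero => simp [NS, es_zero]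
  | succ k =>
    rw [NS_succ, NT_diag, diagonal_mul_diagonal, trace_diagonal]
    have h1 := es_sum_erase_mul Finset.univ k l
    have h2 : ∑ i, es (Finset.univ.erase i) k l * l i = (k+1) * es Finset.univ (k+1) l := by
      rw [← h1]; exact Finset.sum_congr rfl (fun i _ => mul_comm _ _)
    rw [h2, mul_div_cancel_left₀ _ (by positivity : (k:ℝ)+1 ≠ 0)]

def cc : ℕ → (ι → ℝ) → ι → ι → ℝ
  | 0, _, _, _ => 0
  | k+1, l, i, j => es ((Finset.univ.erase i).erase j) k l

theorem cc_symm (k : ℕ) (l : ι → ℝ) (i j : ι) : cc k l i j = cc k l j i := by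
  cases k with
  | zero => rfl
  | succ k => simp only [cc]; rw [Finset.erase_right_comm]

theorem cc_succ (k : ℕ) (l : ι → ℝ) (i j : ι) (hij : i ≠ j) :
    cc (k+1) l i j + l j * cc k l i j = es (Finset.univ.erase i) k l := by
  cases k with
  | zero => simp [cc, es_zero]
  | succ k =>
    simp only [cc]
    rw [← es_erase _ j (by simp [hij.symm])]

theorem cc_sum (k : ℕ) (l : ι → ℝ) (i : ι) :
    ∑ p ∈ Finset.univ.erase i, l p * cc k l p i = k * es (Finset.univ.erase i) k l := by
  cases k with
  | zero => simp [cc]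
  | succ k =>
    have := es_sum_erase_mul (Finset.univ.erase i) k l
    push_cast
    rw [← this]
    exact Finset.sum_congr rfl (fun p _ => by rw [cc_symm]; rfl)

theorem dNT_diag (l : ι → ℝ) (B : Matrix ι ι ℝ) (k : ℕ) :
    (∀ i, dNT k (diagonal l) B i i = ∑ p ∈ Finset.univ.erase i, cc k l i p * B p p) ∧
    (∀ i j, i ≠ j → dNT k (diagonal l) B i j = - cc k l i j * B i j) ∧
    trace (dNT k (diagonal l) B * diagonal l) = k * trace (NT k (diagonal l) * B) := by
  have tr : ∀ k, (∀ i, dNT k (diagonal l) B i i = ∑ p ∈ Finset.univ.erase i, cc k l i p * B p p) →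
      trace (dNT k (diagonal l) B * diagonal l) = k * trace (NT k (diagonal l) * B) := by
    intro k hk
    simp only [Matrix.trace, Matrix.diag, Matrix.mul_diagonal, hk, NT_diag, Matrix.diagonal_mul]
    have e : ∀ i, (∑ p ∈ Finset.univ.erase i, cc k l i p * B p p) * l i = ∑ p, if p = i then 0 else l i * cc k l i p * B p p := by
      intro i
      rw [Finset.sum_mul, ← Finset.sum_erase (s := Finset.univ) (a := i) (by simp)]
      exact Finset.sum_congr rfl (fun p hp => by rw [if_neg (Finset.ne_of_mem_erase hp)]; ring)
    simp only [e]
    rw [Finset.sum_comm, Finset.mul_sum]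
    apply Finset.sum_congr rfl
    intro p _
    rw [← mul_assoc, ← cc_sum, Finset.sum_mul, ← Finset.sum_erase (s := Finset.univ) (a := p) (by simp)]
    exact Finset.sum_congr rfl (fun i hi => by rw [if_neg (Finset.ne_of_mem_erase hi).symm])
  induction k with
  | zero => simp [dNT, cc]
  | succ k ih =>
    obtain ⟨h1, h2, h3⟩ := ih
    have hs : (trace (dNT k (diagonal l) B * diagonal l) + trace (NT k (diagonal l) * B)) / ((k:ℝ)+1) = trace (NT k (diagonal l) * B) := by
      rw [h3]; field_simp
    have g1 : ∀ i, dNT (k+1) (diagonal l) B i i = ∑ p ∈ Finset.univ.erase i, cc (k+1) l i p * B p p := by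
      intro i
      simp only [dNT]
      rw [hs]
      simp only [Matrix.sub_apply, Matrix.smul_apply, Matrix.add_apply, Matrix.one_apply_eq, smul_eq_mul, mul_one, Matrix.mul_diagonal, h1, NT_diag, Matrix.diagonal_mul, Matrix.trace, Matrix.diag]
      rw [← Finset.add_sum_erase Finset.univ _ (Finset.mem_univ i), Finset.sum_mul]
      rw [show ∀ a b c : ℝ, a + b - (c + a) = b - c by intros; ring, ← Finset.sum_sub_distrib]
      apply Finset.sum_congr rfl
      intro p hp
      have := cc_succ k l p i (Finset.ne_of_mem_erase hp)
      rw [← this, cc_symm k l p i, cc_symm (k+1) l p i]; ring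
    refine ⟨g1, ?_, tr _ g1⟩
    intro i j hij
    simp only [dNT]
    simp only [Matrix.sub_apply, Matrix.smul_apply, Matrix.add_apply, Matrix.one_apply_ne hij, smul_eq_mul, mul_zero, Matrix.mul_diagonal, h2 i j hij, NT_diag, Matrix.diagonal_mul]
    rw [← cc_succ k l i j hij]; ring

theorem tr_dNT_diag (l : ι → ℝ) (B : Matrix ι ι ℝ) (k : ℕ) :
    trace (dNT k (diagonal l) B * B) = ∑ i, ∑ p ∈ Finset.univ.erase i, cc k l i p * (B i i * B p p - B i p * B p i) := by
  obtain ⟨h1, h2, -⟩ := dNT_diag l B k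
  simp only [Matrix.trace, Matrix.diag, Matrix.mul_apply]
  apply Finset.sum_congr rfl
  intro i _
  rw [← Finset.add_sum_erase Finset.univ _ (Finset.mem_univ i), h1, Finset.sum_mul, ← Finset.sum_add_distrib]
  apply Finset.sum_congr rfl
  intro p hp
  rw [h2 i p (Finset.ne_of_mem_erase hp).symm]; ring

/-! diagonalization data -/
structure Dg (V Q : Matrix ι ι ℝ) (l : ι → ℝ) : Prop where
  q1 : Qᵀ * Q = 1
  q2 : Q * Qᵀ = 1
  v : V = Q * diagonal l * Qᵀ

theorem exists_Dg {V : Matrix ι ι ℝ} (hV : V.IsHermitian) : ∃ Q, Dg V Q hV.eigenvalues := by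
  refine ⟨hV.eigenvectorUnitary, ?_, ?_, ?_⟩
  · have := Unitary.coe_star_mul_self hV.eigenvectorUnitary
    rw [Matrix.star_eq_conjTranspose, Matrix.conjTranspose_eq_transpose_of_trivial] at this
    exact this
  · have := Unitary.coe_mul_star_self hV.eigenvectorUnitary
    rw [Unitary.coe_star, Matrix.star_eq_conjTranspose, Matrix.conjTranspose_eq_transpose_of_trivial] at this
    exact this
  · have := hV.spectral_theorem
    conv_lhs => rw [this]
    rw [Unitary.conjStarAlgAut_apply, Matrix.star_eq_conjTranspose, Matrix.conjTranspose_eq_transpose_of_trivial]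
    rfl

namespace Dg
variable {V Q : Matrix ι ι ℝ} {l : ι → ℝ} (d : Dg V Q l)
include d

theorem nt (k : ℕ) : NT k V = Q * diagonal (fun i => es (Finset.univ.erase i) k l) * Qᵀ := by
  rw [d.v, NT_conj d.q1 d.q2, NT_diag]

theorem ns (k : ℕ) : NS k V = es Finset.univ k l := by
  rw [d.v, NS_conj d.q1 d.q2, NS_diag]

theorem quad (D : ι → ℝ) (x y : ι → ℝ) : x ⬝ᵥ ((Q * diagonal D * Qᵀ) *ᵥ y) = ∑ i, D i * (Qᵀ *ᵥ x) i * (Qᵀ *ᵥ y) i := by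
  rw [← Matrix.mulVec_mulVec, ← Matrix.mulVec_mulVec, Matrix.dotProduct_mulVec, ← Matrix.mulVec_transpose]
  simp only [dotProduct, Matrix.mulVec_diagonal]
  exact Finset.sum_congr rfl (fun i _ => by ring)

theorem norm_sq (x y : ι → ℝ) : ∑ i, (Qᵀ *ᵥ x) i * (Qᵀ *ᵥ y) i = x ⬝ᵥ y := by
  have := d.quad (fun _ => 1) x y
  simp only [one_mul] at this
  rw [← this, show diagonal (fun _ : ι => (1:ℝ)) = 1 from Matrix.diagonal_one, Matrix.mul_one, d.q2, Matrix.one_mulVec]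

theorem conjB (B : Matrix ι ι ℝ) : B = Q * (Qᵀ * B * Q) * Qᵀ := by
  calc B = (Q * Qᵀ) * B * (Q * Qᵀ) := by rw [d.q2, Matrix.one_mul, Matrix.mul_one]
    _ = _ := by simp only [Matrix.mul_assoc]

theorem tr_nt (k : ℕ) (B : Matrix ι ι ℝ) : trace (NT k V * B) = ∑ i, es (Finset.univ.erase i) k l * (Qᵀ * B * Q) i i := by
  conv_lhs => rw [d.nt, d.conjB B, qconj_mul d.q1, qconj_trace d.q1]
  simp [Matrix.trace, Matrix.diagonal_mul]

theorem tr_dnt (k : ℕ) (B : Matrix ι ι ℝ) : trace (dNT k V B * B) = trace (dNT k (diagonal l) (Qᵀ * B * Q) * (Qᵀ * B * Q)) := by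
  conv_lhs => rw [d.v, d.conjB B, dNT_conj d.q1 d.q2, qconj_mul d.q1, qconj_trace d.q1]

theorem dns (k : ℕ) (B : Matrix ι ι ℝ) : dNS (k+1) V B = trace (NT k V * B) := by
  have h : trace (dNT k V B * V) = k * trace (NT k V * B) := by
    have e1 : dNT k V B * V = Q * (dNT k (diagonal l) (Qᵀ * B * Q) * diagonal l) * Qᵀ := by
      conv_lhs => rw [d.conjB B, d.v, dNT_conj d.q1 d.q2, qconj_mul d.q1]
    have e2 : NT k V * B = Q * (NT k (diagonal l) * (Qᵀ * B * Q)) * Qᵀ := by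
      conv_lhs => rw [d.conjB B, d.v, NT_conj d.q1 d.q2, qconj_mul d.q1]
    rw [e1, e2, qconj_trace d.q1, qconj_trace d.q1, (dNT_diag l _ k).2.2]
  simp only [dNS]
  rw [h]; field_simp

end Dg

theorem dNS_sym {V : Matrix ι ι ℝ} (hV : V.IsHermitian) (k : ℕ) (B : Matrix ι ι ℝ) : dNS (k+1) V B = trace (NT k V * B) := by
  obtain ⟨Q, d⟩ := exists_Dg hV
  exact d.dns k B

end mat

theorem locmax_second {f f' : ℝ → ℝ} {c : ℝ} (hf : ∀ s, HasDerivAt f (f' s) s) (hf' : HasDerivAt f' c 0)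
    (hm : IsLocalMax f 0) : c ≤ 0 := by
  by_contra hc
  push Not at hc
  have h0 : f' 0 = 0 := hm.hasDerivAt_eq_zero (hf 0)
  set g : ℝ → ℝ := fun s => f s - c/4 * s^2 with hg
  have hgd : ∀ s, HasDerivAt g (f' s - c/4*(2*s)) s := by
    intro s
    have := ((hasDerivAt_pow 2 s).const_mul (c/4))
    have h3 := (hf s).sub this
    have e : f' s - c/4*(2*s) = f' s - c / 4 * (((2:ℕ):ℝ) * s ^ (2 - 1)) := by norm_num
    rw [e]; exact h3
  have hd : deriv g = fun s => f' s - c/4*(2*s) := funext fun s => (hgd s).deriv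
  have hdd : deriv (deriv g) 0 = c - c/4*2 := by
    rw [hd]
    have : HasDerivAt (fun s : ℝ => c/4*(2*s)) (c/4*2) 0 := by
      simpa using ((hasDerivAt_id (0:ℝ)).const_mul 2).const_mul (c/4)
    exact (hf'.sub this).deriv
  have hmin : IsLocalMin g 0 := by
    apply isLocalMin_of_deriv_deriv_pos
    · rw [hdd]; linarith
    · rw [hd]; simp [h0]
    · exact (hgd 0).continuousAt
  have hev : ∀ᶠ s in nhds (0:ℝ), s = 0 := by
    filter_upwards [hm, hmin] with s h1 h2
    simp only [hg] at h2
    have : c/4 * s^2 ≤ 0 := by nlinarith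
    have h3 : s^2 ≤ 0 := by nlinarith
    exact pow_eq_zero_iff (two_ne_zero) |>.1 (le_antisymm h3 (sq_nonneg s))
  obtain ⟨ε, hε, hb⟩ := Metric.eventually_nhds_iff.1 hev
  have := hb (y := ε/2) (by simp [abs_of_pos hε]; linarith)
  linarith

section mat
open Matrix
variable {ι : Type*} [DecidableEq ι] [Fintype ι]

def GM (k : ℕ) (V : Matrix ι ι ℝ) : Prop := ∀ j, 1 ≤ j → j ≤ k → 0 < NS j V

theorem GM.mono {k k' : ℕ} {V : Matrix ι ι ℝ} (h : GM k V) (hk : k' ≤ k) : GM k' V := fun j h1 h2 => h j h1 (h2.trans hk)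

theorem Dg.gam {V Q : Matrix ι ι ℝ} {l : ι → ℝ} (d : Dg V Q l) {k : ℕ} (h : GM k V) : Gam Finset.univ k l :=
  fun j h1 h2 => by rw [← d.ns]; exact h j h1 h2

theorem es_cont (I : Finset ι) (j : ℕ) (l b : ι → ℝ) : Continuous (fun s : ℝ => es I j (fun i => l i + s * b i)) := by
  unfold es
  fun_prop

theorem diag_conc (m : ℕ) (l b : ι → ℝ) (h : Gam Finset.univ (m+1) l)
    (h0 : ∑ i, es (Finset.univ.erase i) m l * b i = 0) :
    ∑ i, ∑ p ∈ Finset.univ.erase i, cc m l i p * (b i * b p) ≤ 0 := by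
  set W : ℝ → Matrix ι ι ℝ := fun s => diagonal (fun i => l i + s * b i) with hW
  have hWd : ∀ s i j, HasDerivAt (fun s => W s i j) ((diagonal b) i j) s := by
    intro s i j
    by_cases hij : i = j
    · subst hij
      simp only [hW, Matrix.diagonal_apply_eq]
      have := ((hasDerivAt_id s).mul_const (b i)).const_add (l i)
      simpa using this
    · simp only [hW, Matrix.diagonal_apply_ne _ hij]
      exact hasDerivAt_const _ _
  set hh : ℝ → ℝ := fun s => NS (m+1) (W s) with hhh
  set h' : ℝ → ℝ := fun s => trace (NT m (W s) * diagonal b) with hh'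
  set G := trace (dNT m (diagonal l) (diagonal b) * diagonal b) with hG
  have W0 : W 0 = diagonal l := by simp [hW]
  have d1 : ∀ s, HasDerivAt hh (h' s) s := by
    intro s
    have := hasDerivAt_NS (hWd s) (m+1)
    rw [dNS_sym (by simp [hW, Matrix.IsHermitian, Matrix.diagonal_transpose])] at this
    exact this
  have d2 : HasDerivAt h' G 0 := by
    have h1 := hasDerivAt_NT (hWd 0) m
    have h2 := hasDerivAt_trace (hasDerivAt_mul_entry h1 (Y := fun _ => diagonal b) (Y' := 0) (fun i j => hasDerivAt_const _ _))
    rw [Matrix.mul_zero, add_zero, W0] at h2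
    exact h2
  have h'0 : h' 0 = 0 := by
    simp only [hh', W0, NT_diag, Matrix.diagonal_mul_diagonal, Matrix.trace_diagonal, h0]
  have hes : ∀ s, hh s = es Finset.univ (m+1) (fun i => l i + s * b i) := by
    intro s; simp only [hhh, hW, NS_diag]
  have hpos : 0 < hh 0 := by rw [hes]; simpa using h.pos (m+1) le_rfl
  have hev1 : ∀ᶠ s in nhds (0:ℝ), Gam Finset.univ (m+1) (fun i => l i + s * b i) := by
    have : ∀ᶠ s in nhds (0:ℝ), ∀ j ∈ Finset.Icc 1 (m+1), 0 < es Finset.univ j (fun i => l i + s * b i) := by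
      rw [Filter.eventually_all_finset]
      intro j hj
      have := h j (Finset.mem_Icc.1 hj).1 (Finset.mem_Icc.1 hj).2
      exact (es_cont Finset.univ j l b).continuousAt.eventually (lt_mem_nhds (by simpa using this))
    filter_upwards [this] with s hs j h1 h2
    exact hs j (Finset.mem_Icc.2 ⟨h1, h2⟩)
  have hev2 : ∀ᶠ s in nhds (0:ℝ), Gam Finset.univ (m+1) (fun i => l i + (-s) * b i) := by
    have : Filter.Tendsto (fun s : ℝ => -s) (nhds 0) (nhds 0) := by simpa using (continuous_neg.tendsto (0:ℝ))
    exact this.eventually hev1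
  have hmax : IsLocalMax (fun s => hh s * hh (-s)) 0 := by
    filter_upwards [hev1, hev2] with s h1 h2
    have := es_logconc (m+1) Finset.univ l (fun i => s * b i) h1 (by
      convert h2 using 2; ring)
    simp only [hes]
    simp only [neg_zero, zero_mul, add_zero]
    calc _ = es Finset.univ (m+1) (fun i => l i + s * b i) * es Finset.univ (m+1) (fun i => l i - s * b i) := by
          congr 2; funext i; ring
      _ ≤ _ := this
      _ = _ := by ring
  have hneg : ∀ s : ℝ, HasDerivAt (fun s : ℝ => hh (-s)) (- h' (-s)) s := by
    intro s
    have := (d1 (-s)).comp s (hasDerivAt_neg s)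
    rw [mul_neg_one] at this
    exact this
  have hneg' : HasDerivAt (fun s : ℝ => h' (-s)) (- G) 0 := by
    have := HasDerivAt.comp (0:ℝ) (h₂ := h') (h := fun s => -s) (by simpa using d2) (hasDerivAt_neg (0:ℝ))
    rw [mul_neg_one] at this
    exact this
  have hm2 := locmax_second (f := fun s => hh s * hh (-s)) (f' := fun s => h' s * hh (-s) + hh s * (- h' (-s)))
    (fun s => (d1 s).mul (hneg s)) ((d2.mul (hneg 0)).add ((d1 0).mul hneg'.neg)) hmax
  simp only [neg_zero, h'0] at hm2
  have hG0 : G ≤ 0 := by nlinarith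
  rw [hG, tr_dNT_diag] at hG0
  refine le_trans (le_of_eq ?_) hG0
  refine Finset.sum_congr rfl (fun i _ => Finset.sum_congr rfl (fun p hp => ?_))
  simp [Matrix.diagonal_apply_ne _ (Finset.ne_of_mem_erase hp), Matrix.diagonal_apply_ne _ (Finset.ne_of_mem_erase hp).symm]

theorem cc_nonneg {m : ℕ} {l : ι → ℝ} (h : Gam Finset.univ (m+1) l) {i p : ι} (hip : i ≠ p) : 0 ≤ cc m l i p := by
  cases m with
  | zero => exact le_rfl
  | succ m => exact (((h.erase (Finset.mem_univ i)).erase (i := p) (by simp [hip.symm])).pos m (by omega)).le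

theorem dg_conc (m : ℕ) (l : ι → ℝ) (C : Matrix ι ι ℝ) (hC : Cᵀ = C) (h : Gam Finset.univ (m+1) l)
    (h0 : ∑ i, es (Finset.univ.erase i) m l * C i i = 0) :
    trace (dNT m (diagonal l) C * C) ≤ - ∑ i, ∑ p ∈ Finset.univ.erase i, cc m l i p * (C i p)^2 := by
  rw [tr_dNT_diag]
  have := diag_conc m l (fun i => C i i) h h0
  have e : ∑ i, ∑ p ∈ Finset.univ.erase i, cc m l i p * (C i i * C p p - C i p * C p i) =
     ∑ i, ∑ p ∈ Finset.univ.erase i, cc m l i p * (C i i * C p p) - ∑ i, ∑ p ∈ Finset.univ.erase i, cc m l i p * (C i p)^2 := by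
    rw [← Finset.sum_sub_distrib]
    refine Finset.sum_congr rfl (fun i _ => ?_)
    rw [← Finset.sum_sub_distrib]
    refine Finset.sum_congr rfl (fun p _ => ?_)
    have : C p i = C i p := by conv_lhs => rw [← hC, Matrix.transpose_apply]
    rw [this]; ring
  rw [e]; linarith

theorem Dg.symB {Q B : Matrix ι ι ℝ} (hB : Bᵀ = B) : (Qᵀ * B * Q)ᵀ = Qᵀ * B * Q := by
  rw [Matrix.transpose_mul, Matrix.transpose_mul, Matrix.transpose_transpose, hB, Matrix.mul_assoc]

theorem M4 {m : ℕ} {V : Matrix ι ι ℝ} (hV : V.IsHermitian) (h : GM (m+1) V) {B : Matrix ι ι ℝ} (hB : Bᵀ = B)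
    (h0 : trace (NT m V * B) = 0) : trace (dNT m V B * B) ≤ 0 := by
  obtain ⟨Q, d⟩ := exists_Dg hV
  rw [d.tr_dnt]
  rw [d.tr_nt] at h0
  refine (dg_conc m _ _ (Dg.symB hB) (d.gam h) h0).trans ?_
  rw [neg_nonpos]
  refine Finset.sum_nonneg (fun i _ => Finset.sum_nonneg (fun p hp => ?_))
  exact mul_nonneg (cc_nonneg (d.gam h) (Finset.ne_of_mem_erase hp).symm) (sq_nonneg _)

end mat

section mat
open Matrix
variable {ι : Type*} [DecidableEq ι] [Fintype ι]

theorem NT_symm {V : Matrix ι ι ℝ} (hV : V.IsHermitian) (m : ℕ) : (NT m V)ᵀ = NT m V := by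
  obtain ⟨Q, d⟩ := exists_Dg hV
  rw [d.nt, Matrix.transpose_mul, Matrix.transpose_mul, Matrix.transpose_transpose, Matrix.diagonal_transpose, Matrix.mul_assoc]

theorem NT_pos {V : Matrix ι ι ℝ} (hV : V.IsHermitian) {m : ℕ} (h : GM (m+1) V) {x : ι → ℝ} (hx : x ≠ 0) :
    0 < x ⬝ᵥ (NT m V *ᵥ x) := by
  obtain ⟨Q, d⟩ := exists_Dg hV
  rw [d.nt, d.quad]
  have hf : ∀ i, 0 < es (Finset.univ.erase i) m hV.eigenvalues := fun i => ((d.gam h).erase (Finset.mem_univ i)).pos m le_rfl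
  have hy : Qᵀ *ᵥ x ≠ 0 := by
    intro h0
    have : x = Q *ᵥ (Qᵀ *ᵥ x) := by rw [Matrix.mulVec_mulVec, d.q2, Matrix.one_mulVec]
    rw [h0, Matrix.mulVec_zero] at this
    exact hx this
  obtain ⟨i, hi⟩ := Function.ne_iff.1 hy
  apply Finset.sum_pos'
  · intro j _; rw [mul_assoc]; exact mul_nonneg (hf j).le (mul_self_nonneg _)
  · exact ⟨i, Finset.mem_univ i, by rw [mul_assoc]; exact mul_pos (hf i) (mul_self_pos.2 hi)⟩

theorem NT_nonneg {V : Matrix ι ι ℝ} (hV : V.IsHermitian) {m : ℕ} (h : GM (m+1) V) (x : ι → ℝ) :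
    0 ≤ x ⬝ᵥ (NT m V *ᵥ x) := by
  by_cases hx : x = 0
  · simp [hx]
  · exact (NT_pos hV h hx).le

theorem NT_trace {V : Matrix ι ι ℝ} (hV : V.IsHermitian) (m : ℕ) : trace (NT m V) = ((Fintype.card ι : ℝ) - m) * NS m V := by
  obtain ⟨Q, d⟩ := exists_Dg hV
  rw [d.nt, qconj_trace d.q1, d.ns, trace_diagonal, es_sum_erase, Finset.card_univ]

theorem NT_le_trace {V : Matrix ι ι ℝ} (hV : V.IsHermitian) {m : ℕ} (h : GM (m+1) V) (x : ι → ℝ) :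
    x ⬝ᵥ (NT m V *ᵥ x) ≤ trace (NT m V) * (x ⬝ᵥ x) := by
  obtain ⟨Q, d⟩ := exists_Dg hV
  have hf : ∀ i, 0 < es (Finset.univ.erase i) m hV.eigenvalues := fun i => ((d.gam h).erase (Finset.mem_univ i)).pos m le_rfl
  rw [d.nt, d.quad, qconj_trace d.q1, ← d.norm_sq x x, trace_diagonal, Finset.mul_sum]
  apply Finset.sum_le_sum
  intro i _
  rw [mul_assoc]
  apply mul_le_mul_of_nonneg_right _ (mul_self_nonneg _)
  exact Finset.single_le_sum (f := fun i => es (Finset.univ.erase i) m hV.eigenvalues) (fun j _ => (hf j).le) (Finset.mem_univ i)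

section B
variable {V : Matrix ι ι ℝ} (hV : V.IsHermitian) {m : ℕ} (h : GM (m+2) V) (h1 : NS (m+1) V = 1)
include hV h h1

theorem B_card : m + 2 ≤ Fintype.card ι := by
  obtain ⟨Q, d⟩ := exists_Dg hV
  rw [d.ns] at h1
  exact A_card (d.gam h) h1

theorem B_E : 1 ≤ NS m V := by
  obtain ⟨Q, d⟩ := exists_Dg hV
  rw [d.ns] at h1
  rw [d.ns]
  exact A_E (d.gam h) h1

theorem B_E_tr : NS m V ≤ trace (NT m V) := by
  have h2 := B_card hV h h1
  have h3 := B_E hV h h1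
  have h4 : (m:ℝ) + 2 ≤ Fintype.card ι := by exact_mod_cast h2
  rw [NT_trace hV]
  nlinarith

theorem B_tr : 1 ≤ trace (NT m V) := (B_E hV h h1).trans (B_E_tr hV h h1)

theorem B_TV (x y : ι → ℝ) : (x ⬝ᵥ ((NT m V * V) *ᵥ y))^2 ≤ (Fintype.card ι : ℝ)^2 * ((x ⬝ᵥ x) * (y ⬝ᵥ y)) := by
  obtain ⟨l, Q, d⟩ : ∃ l Q, Dg V Q l := ⟨_, exists_Dg hV⟩
  rw [d.ns] at h1
  have e : NT m V * V = Q * diagonal (fun i => es (Finset.univ.erase i) m l * l i) * Qᵀ := by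
    rw [d.nt]
    conv_lhs => rw [d.v]
    rw [qconj_mul d.q1, diagonal_mul_diagonal]
  rw [e, d.quad, ← d.norm_sq x x, ← d.norm_sq y y]
  have hb : ∀ i, (es (Finset.univ.erase i) m l * l i)^2 ≤ (Fintype.card ι : ℝ)^2 := by
    intro i
    have := A_lf_abs (d.gam h) h1 (Finset.mem_univ i)
    rw [mul_comm, Finset.card_univ] at this
    rw [← sq_abs]
    exact pow_le_pow_left₀ (abs_nonneg _) this 2
  set X := Qᵀ *ᵥ x
  set Y := Qᵀ *ᵥ y
  have cs := Finset.sum_mul_sq_le_sq_mul_sq Finset.univ (fun i => (es (Finset.univ.erase i) m l * l i) * X i) Y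
  refine cs.trans ?_
  have : ∑ i, ((es (Finset.univ.erase i) m l * l i) * X i)^2 ≤ (Fintype.card ι : ℝ)^2 * ∑ i, X i * X i := by
    rw [Finset.mul_sum]
    apply Finset.sum_le_sum
    intro i _
    rw [mul_pow, sq (X i)]
    exact mul_le_mul_of_nonneg_right (hb i) (mul_self_nonneg _)
  have h2 : ∑ i, Y i ^ 2 = ∑ i, Y i * Y i := Finset.sum_congr rfl (fun i _ => sq _)
  rw [h2, ← mul_assoc]
  exact mul_le_mul_of_nonneg_right this (Finset.sum_nonneg (fun i _ => mul_self_nonneg _))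

theorem B_V_up (x : ι → ℝ) : x ⬝ᵥ (V *ᵥ x) ≤ NS m V ^ m * (x ⬝ᵥ x) := by
  obtain ⟨Q, d⟩ := exists_Dg hV
  rw [d.ns] at h1
  rw [d.ns]
  conv_lhs => rw [d.v]
  rw [d.quad, ← d.norm_sq x x, Finset.mul_sum]
  apply Finset.sum_le_sum
  intro i _
  rw [mul_assoc]
  exact mul_le_mul_of_nonneg_right (A_l_E (d.gam h) h1 (Finset.mem_univ i)).le (mul_self_nonneg _)

theorem B_V_low (x : ι → ℝ) : -(Fintype.card ι : ℝ) * (x ⬝ᵥ x) ≤ x ⬝ᵥ (V *ᵥ x) := by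
  obtain ⟨Q, d⟩ := exists_Dg hV
  rw [d.ns] at h1
  conv_rhs => rw [d.v]
  rw [d.quad, ← d.norm_sq x x, Finset.mul_sum]
  apply Finset.sum_le_sum
  intro i _
  rw [mul_assoc]
  exact mul_le_mul_of_nonneg_right (A_l_gt (d.gam h) h1 (Finset.mem_univ i)) (mul_self_nonneg _)

omit h h1 in
theorem Dg.eig_le {Q : Matrix ι ι ℝ} {l : ι → ℝ} (d : Dg V Q l) {K : ℝ} (hK : ∀ x, x ⬝ᵥ (V *ᵥ x) ≤ K * (x ⬝ᵥ x)) (i : ι) : l i ≤ K := by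
  have h2 := hK (Q *ᵥ Pi.single i 1)
  conv_lhs at h2 => rw [d.v]
  rw [d.quad, ← d.norm_sq] at h2
  simp only [Matrix.mulVec_mulVec, d.q1, Matrix.one_mulVec] at h2
  simpa [Pi.single_apply] using h2

theorem B_ell_low {K : ℝ} (hK0 : 0 ≤ K) (hK : ∀ x, x ⬝ᵥ (V *ᵥ x) ≤ K * (x ⬝ᵥ x)) (x : ι → ℝ) :
    x ⬝ᵥ x ≤ K * (1 + Fintype.card ι) * (x ⬝ᵥ (NT m V *ᵥ x)) := by
  obtain ⟨Q, d⟩ := exists_Dg hV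
  rw [d.ns] at h1
  rw [d.nt, d.quad, ← d.norm_sq x x, Finset.mul_sum]
  apply Finset.sum_le_sum
  intro i _
  have := A_f_low (d.gam h) h1 (Finset.mem_univ i) hK0 (fun j _ => Dg.eig_le hV d hK j)
  rw [Finset.card_univ] at this
  calc _ = 1 * ((Qᵀ *ᵥ x) i * (Qᵀ *ᵥ x) i) := by ring
    _ ≤ _ := mul_le_mul_of_nonneg_right this (mul_self_nonneg _)
    _ = _ := by ring

theorem B_ell_up {K : ℝ} (hK0 : 0 ≤ K) (hK : ∀ x, x ⬝ᵥ (V *ᵥ x) ≤ K * (x ⬝ᵥ x)) (x : ι → ℝ) :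
    x ⬝ᵥ (NT m V *ᵥ x) ≤ (Fintype.card ι * K)^m * (x ⬝ᵥ x) := by
  obtain ⟨Q, d⟩ := exists_Dg hV
  rw [d.ns] at h1
  rw [d.nt, d.quad, ← d.norm_sq x x, Finset.mul_sum]
  apply Finset.sum_le_sum
  intro i _
  have := A_f_up (d.gam h) h1 (Finset.mem_univ i) hK0 (fun j _ => Dg.eig_le hV d hK j)
  rw [Finset.card_univ] at this
  rw [mul_assoc]
  exact mul_le_mul_of_nonneg_right this (mul_self_nonneg _)

end B

theorem cc_diff (m : ℕ) (l : ι → ℝ) (i p : ι) (hip : i ≠ p) :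
    es (Finset.univ.erase i) (m+1) l - es (Finset.univ.erase p) (m+1) l = (l p - l i) * cc (m+1) l i p := by
  have h1 := cc_succ (m+1) l i p hip
  have h2 := cc_succ (m+1) l p i hip.symm
  rw [cc_symm _ _ p i, cc_symm _ _ p i] at h2
  rw [← h1, ← h2]; ring

theorem M5 {V : Matrix ι ι ℝ} (hV : V.IsHermitian) {m : ℕ} (h : GM (m+3) V) (h1 : NS (m+2) V = 1) :
    ∃ (e : ι → ℝ) (K : ℝ), e ⬝ᵥ e = 1 ∧ V *ᵥ e = K • e ∧ (∀ x, x ⬝ᵥ (V *ᵥ x) ≤ K * (x ⬝ᵥ x)) ∧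
      (3 * (Fintype.card ι : ℝ) ≤ K → ∀ B : Matrix ι ι ℝ, Bᵀ = B → trace (NT (m+1) V * B) = 0 →
        (3/2) * ((B *ᵥ e) ⬝ᵥ (NT (m+1) V *ᵥ (B *ᵥ e))) - 3/(2*K) * ((B *ᵥ e) ⬝ᵥ (B *ᵥ e)) ≤ - K * trace (dNT (m+1) V B * B)) := by
  have hcard := B_card (m := m+1) hV h h1
  obtain ⟨Q, d⟩ := exists_Dg hV
  set l := hV.eigenvalues with hl
  rw [d.ns] at h1
  have hne : Nonempty ι := Fintype.card_pos_iff.1 (by omega)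
  obtain ⟨p, hp⟩ := Finite.exists_max l
  have hG := d.gam h
  have colQ : Qᵀ *ᵥ (Q *ᵥ Pi.single p 1) = Pi.single p 1 := by rw [Matrix.mulVec_mulVec, d.q1, Matrix.one_mulVec]
  refine ⟨Q *ᵥ Pi.single p 1, l p, ?_, ?_, ?_, ?_⟩
  · rw [← d.norm_sq, colQ]; simp [Pi.single_apply]
  · conv_lhs => rw [d.v]
    rw [← Matrix.mulVec_mulVec, colQ, ← Matrix.mulVec_mulVec, ← Matrix.mulVec_smul]
    congr 1
    ext i
    rw [Matrix.mulVec_diagonal]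
    by_cases hi : i = p
    · subst hi; simp
    · simp [hi]
  · intro x
    conv_lhs => rw [d.v]
    rw [d.quad, ← d.norm_sq x x, Finset.mul_sum]
    apply Finset.sum_le_sum
    intro i _
    rw [mul_assoc]
    exact mul_le_mul_of_nonneg_right (hp i) (mul_self_nonneg _)
  · intro hK B hB hB0
    rw [d.tr_nt] at hB0
    rw [d.tr_dnt]
    have hc := dg_conc (m+1) l _ (Dg.symB hB) (hG.mono (by omega)) hB0
    set C := Qᵀ * B * Q with hC
    have hCs : ∀ i j, C i j = C j i := by
      intro i j
      have := Dg.symB (Q := Q) hB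
      conv_lhs => rw [hC, ← this, Matrix.transpose_apply]
    have hcol : ∀ i, (Qᵀ *ᵥ (B *ᵥ (Q *ᵥ Pi.single p 1))) i = C i p := by
      intro i
      rw [Matrix.mulVec_mulVec, Matrix.mulVec_mulVec, ← hC]
      simp
    rw [d.nt, d.quad, ← d.norm_sq]
    simp only [hcol]
    have hn : (1:ℝ) ≤ Fintype.card ι := by exact_mod_cast (by omega : 1 ≤ Fintype.card ι)
    have hK0 : 0 < l p := by linarith
    have ccn : ∀ i q, q ∈ Finset.univ.erase i → 0 ≤ cc (m+1) l i q := fun i q hq =>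
      cc_nonneg (hG.mono (by omega)) (Finset.ne_of_mem_erase hq).symm
    have hfp := A_lf_lt (m := m+1) hG h1 (Finset.mem_univ p)
    -- lower bound for the double sum
    have hds : 2 * ∑ i ∈ Finset.univ.erase p, cc (m+1) l i p * (C i p)^2 ≤ ∑ i, ∑ q ∈ Finset.univ.erase i, cc (m+1) l i q * (C i q)^2 := by
      rw [← Finset.add_sum_erase Finset.univ _ (Finset.mem_univ p), two_mul]
      apply add_le_add
      · apply le_of_eq
        refine Finset.sum_congr rfl (fun i _ => ?_)
        rw [cc_symm, hCs i p]
      · apply Finset.sum_le_sum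
        intro i hi
        apply Finset.single_le_sum (f := fun q => cc (m+1) l i q * (C i q)^2) (fun q hq => mul_nonneg (ccn i q hq) (sq_nonneg _))
        simp [(Finset.ne_of_mem_erase hi).symm]
    have hterm : ∀ i ∈ Finset.univ.erase p, (3/2) * (es (Finset.univ.erase i) (m+1) l * C i p * C i p) - 3/(2*l p) * (C i p * C i p) ≤ l p * (2 * (cc (m+1) l i p * (C i p)^2)) := by
      intro i hi
      have hip := Finset.ne_of_mem_erase hi
      have h2 := cc_diff m l i p hip
      have h3 : 0 ≤ cc (m+1) l i p := ccn i p (by simp [hip.symm])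
      have h4 := A_l_gt (m := m+1) hG h1 (Finset.mem_univ i)
      rw [Finset.card_univ] at h4
      have h5 : es (Finset.univ.erase p) (m+1) l ≤ 1 / l p := by
        rw [le_div_iff₀ hK0]; linarith
      have h6 : es (Finset.univ.erase i) (m+1) l ≤ 1 / l p + (l p + Fintype.card ι) * cc (m+1) l i p := by nlinarith
      have h7 : (3/2) * es (Finset.univ.erase i) (m+1) l - 3/(2*l p) ≤ l p * (2 * cc (m+1) l i p) := by
        have : 3/(2*l p) = (3/2) * (1/l p) := by field_simp
        rw [this]
        nlinarith
      have := mul_le_mul_of_nonneg_right h7 (sq_nonneg (C i p))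
      linarith [this]
    have hpt : (3/2) * (es (Finset.univ.erase p) (m+1) l * C p p * C p p) - 3/(2*l p) * (C p p * C p p) ≤ 0 := by
      have h5 : es (Finset.univ.erase p) (m+1) l ≤ 1 / l p := by
        rw [le_div_iff₀ hK0]; linarith
      have : 3/(2*l p) = (3/2) * (1/l p) := by field_simp
      rw [this]
      nlinarith [mul_self_nonneg (C p p)]
    have hsum : (3/2) * (∑ i, es (Finset.univ.erase i) (m+1) l * C i p * C i p) - 3/(2*l p) * (∑ i, C i p * C i p) ≤
        l p * (2 * ∑ i ∈ Finset.univ.erase p, cc (m+1) l i p * (C i p)^2) := by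
      rw [Finset.mul_sum, Finset.mul_sum, ← Finset.sum_sub_distrib, ← Finset.add_sum_erase Finset.univ _ (Finset.mem_univ p)]
      rw [Finset.mul_sum, Finset.mul_sum]
      have := Finset.sum_le_sum hterm
      linarith
    have h8 := mul_le_mul_of_nonneg_left hds hK0.le
    have h9 := mul_le_mul_of_nonneg_left hc hK0.le
    linarith

theorem NS_rank1 {V : Matrix ι ι ℝ} (hV : V.IsHermitian) (k : ℕ) (q : ι → ℝ) (c : ℝ) :
    NS (k+1) (V + c • Matrix.vecMulVec q q) = NS (k+1) V + c * (q ⬝ᵥ (NT k V *ᵥ q)) := by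
  set B := Matrix.vecMulVec q q with hB
  have hBs : Bᵀ = B := by rw [hB, Matrix.transpose_vecMulVec]
  set W : ℝ → Matrix ι ι ℝ := fun s => V + s • B with hW
  have hWs : ∀ s, (W s).IsHermitian := by
    intro s
    have hV' : Vᵀ = V := by simpa [Matrix.IsHermitian] using hV
    simp [hW, Matrix.IsHermitian, Matrix.conjTranspose_eq_transpose_of_trivial, Matrix.transpose_add, Matrix.transpose_smul, hBs, hV']
  have hWd : ∀ s i j, HasDerivAt (fun s => W s i j) (B i j) s := by
    intro s i j
    have := ((hasDerivAt_id s).mul_const (B i j)).const_add (V i j)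
    simpa [hW] using this
  have tB : ∀ M : Matrix ι ι ℝ, trace (M * B) = q ⬝ᵥ (M *ᵥ q) := by
    intro M
    rw [hB, Matrix.trace_mul_comm, Matrix.vecMulVec_mul, Matrix.trace_vecMulVec, dotProduct_comm, ← Matrix.dotProduct_mulVec]
  have d1 : ∀ s, HasDerivAt (fun s => NS (k+1) (W s)) (trace (NT k (W s) * B)) s := by
    intro s
    have := hasDerivAt_NS (hWd s) (k+1)
    rwa [dNS_sym (hWs s)] at this
  have d2 : ∀ s, HasDerivAt (fun s => trace (NT k (W s) * B)) 0 s := by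
    intro s
    have h1 := hasDerivAt_NT (hWd s) k
    have h2 := hasDerivAt_trace (hasDerivAt_mul_entry h1 (Y := fun _ => B) (Y' := 0) (fun i j => hasDerivAt_const _ _))
    rw [Matrix.mul_zero, add_zero] at h2
    have : trace (dNT k (W s) B * B) = 0 := by
      obtain ⟨Q, d⟩ := exists_Dg (hWs s)
      rw [d.tr_dnt, tr_dNT_diag]
      refine Finset.sum_eq_zero (fun i _ => Finset.sum_eq_zero (fun p _ => ?_))
      have : Qᵀ * B * Q = Matrix.vecMulVec (Qᵀ *ᵥ q) (Qᵀ *ᵥ q) := by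
        rw [hB, Matrix.mul_vecMulVec, Matrix.vecMulVec_mul, Matrix.mulVec_transpose]
      rw [this]; simp only [Matrix.vecMulVec_apply]; ring
    rwa [this] at h2
  have c1 : ∀ s, trace (NT k (W s) * B) = trace (NT k V * B) := by
    intro s
    have := is_const_of_deriv_eq_zero (fun s => (d2 s).differentiableAt) (fun s => (d2 s).deriv) s 0
    simpa [hW] using this
  have d3 : ∀ s, HasDerivAt (fun s => NS (k+1) (W s) - s * trace (NT k V * B)) 0 s := by
    intro s
    have := (d1 s).sub ((hasDerivAt_id s).mul_const (trace (NT k V * B)))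
    rw [c1 s, one_mul, sub_self] at this
    exact this
  have c2 := is_const_of_deriv_eq_zero (fun s => (d3 s).differentiableAt) (fun s => (d3 s).deriv) c 0
  simp only [hW, zero_smul, add_zero, zero_mul, sub_zero] at c2
  rw [← tB]; linarith

theorem NS_mono {V A : Matrix ι ι ℝ} (hV : V.IsHermitian) (hA : A.IsHermitian) {k : ℕ} (h : GM (k+1) V)
    (hle : ∀ x, 0 ≤ x ⬝ᵥ ((A - V) *ᵥ x)) (heq : NS (k+1) A = NS (k+1) V) : A = V := by
  have hN : (A - V).IsHermitian := hA.sub hV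
  obtain ⟨Q, d⟩ := exists_Dg hN
  set l := hN.eigenvalues
  have hl : ∀ i, 0 ≤ l i := by
    intro i
    have h2 := hle (Q *ᵥ Pi.single i 1)
    conv_rhs at h2 => rw [d.v]
    rw [d.quad] at h2
    simp only [Matrix.mulVec_mulVec, d.q1, Matrix.one_mulVec] at h2
    simpa [Pi.single_apply] using h2
  set q : ι → ι → ℝ := fun i => Q *ᵥ Pi.single i 1 with hq
  have hq0 : ∀ i, q i ≠ 0 := by
    intro i h0
    have : Qᵀ *ᵥ (Q *ᵥ Pi.single i 1) = Pi.single i 1 := by rw [Matrix.mulVec_mulVec, d.q1, Matrix.one_mulVec]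
    simp only [hq] at h0
    rw [h0, Matrix.mulVec_zero] at this
    have := congrFun this i
    simp at this
  have hdec : A - V = ∑ i, l i • Matrix.vecMulVec (q i) (q i) := by
    conv_lhs => rw [d.v]
    ext a b
    simp [Matrix.sum_apply, Matrix.mul_apply, Matrix.vecMulVec_apply, hq, Matrix.diagonal_apply]
    refine Finset.sum_congr rfl (fun i _ => by ring)
  have hVs : ∀ s : Finset ι, (V + ∑ i ∈ s, l i • Matrix.vecMulVec (q i) (q i)).IsHermitian := by
    intro s
    have hV' : Vᵀ = V := by simpa [Matrix.IsHermitian] using hV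
    simp [Matrix.IsHermitian, Matrix.conjTranspose_eq_transpose_of_trivial, Matrix.transpose_add, Matrix.transpose_sum, Matrix.transpose_smul, Matrix.transpose_vecMulVec, hV']
  have key : ∀ s : Finset ι, GM (k+1) (V + ∑ i ∈ s, l i • Matrix.vecMulVec (q i) (q i)) ∧
      NS (k+1) V ≤ NS (k+1) (V + ∑ i ∈ s, l i • Matrix.vecMulVec (q i) (q i)) ∧
      (NS (k+1) V = NS (k+1) (V + ∑ i ∈ s, l i • Matrix.vecMulVec (q i) (q i)) → ∀ i ∈ s, l i = 0) := by
    intro s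
    induction s using Finset.induction_on with
    | empty => simpa using h
    | insert a s ha ih =>
      obtain ⟨g1, g2, g3⟩ := ih
      have e : V + ∑ i ∈ insert a s, l i • Matrix.vecMulVec (q i) (q i) = (V + ∑ i ∈ s, l i • Matrix.vecMulVec (q i) (q i)) + l a • Matrix.vecMulVec (q a) (q a) := by
        rw [Finset.sum_insert ha]; abel
      rw [e]
      set W := V + ∑ i ∈ s, l i • Matrix.vecMulVec (q i) (q i) with hW
      have hpos : ∀ j, j ≤ k → 0 < q a ⬝ᵥ (NT j W *ᵥ q a) := fun j hj => NT_pos (hVs s) (g1.mono (by omega)) (hq0 a)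
      refine ⟨?_, ?_, ?_⟩
      · intro j h1 h2
        obtain ⟨j, rfl⟩ : ∃ j', j = j' + 1 := ⟨j - 1, by omega⟩
        rw [NS_rank1 (hVs s)]
        have := mul_nonneg (hl a) (hpos j (by omega)).le
        have := g1 (j+1) h1 h2
        linarith
      · rw [NS_rank1 (hVs s)]
        have := mul_nonneg (hl a) (hpos k (by omega)).le
        linarith
      · rw [NS_rank1 (hVs s)]
        intro h3
        have h4 := mul_nonneg (hl a) (hpos k (by omega)).le
        have h5 : l a * (q a ⬝ᵥ (NT k W *ᵥ q a)) = 0 := by linarith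
        have h6 : l a = 0 := (mul_eq_zero.1 h5).resolve_right (hpos k le_rfl).ne'
        intro i hi
        rcases Finset.mem_insert.1 hi with rfl | hi
        · exact h6
        · exact g3 (by linarith) i hi
  have hfin := (key Finset.univ).2.2
  rw [← hdec, add_sub_cancel] at hfin
  have hz := hfin heq.symm
  have : A - V = 0 := by
    rw [hdec]; exact Finset.sum_eq_zero (fun i hi => by rw [hz i hi, zero_smul])
  exact sub_eq_zero.1 this

end mat

section calc3
open Matrix
variable {n : ℕ}

abbrev Es (n : ℕ) := EuclideanSpace ℝ (Fin n)
def Sm (f : Es n → ℝ) : Prop := ContDiff ℝ (⊤ : ℕ∞) f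
abbrev tv (v : Fin n → ℝ) : Es n := WithLp.toLp 2 v
def dv (v : Fin n → ℝ) (f : Es n → ℝ) (x : Es n) : ℝ := fderiv ℝ f x (tv v)
abbrev dd (i : Fin n) (f : Es n → ℝ) (x : Es n) : ℝ := dv (Pi.single i 1) f x
def gr (f : Es n → ℝ) (x : Es n) : Fin n → ℝ := fun i => dd i f x
def Hs (f : Es n → ℝ) (x : Es n) : Matrix (Fin n) (Fin n) ℝ := fun i j => dd i (dd j f) x

theorem Sm.diff {f : Es n → ℝ} (h : Sm f) : Differentiable ℝ f := ContDiff.differentiable h (by simp)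
theorem Sm.diffAt {f : Es n → ℝ} (h : Sm f) (x) : DifferentiableAt ℝ f x := h.diff x
theorem Sm.cont {f : Es n → ℝ} (h : Sm f) : Continuous f := ContDiff.continuous h

theorem Sm.dv {f : Es n → ℝ} (h : Sm f) (v) : Sm (dv v f) := by
  have : ContDiff ℝ (⊤ : ℕ∞) (fderiv ℝ f) := ContDiff.fderiv_right h (by exact_mod_cast le_top)
  exact this.clm_apply contDiff_const

theorem dv_add {f g : Es n → ℝ} (hf : Sm f) (hg : Sm g) (v) : dv v (fun x => f x + g x) = fun x => dv v f x + dv v g x := by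
  funext x
  simp only [dv]
  rw [fderiv_fun_add (hf.diffAt x) (hg.diffAt x)]; rfl

theorem dv_sub {f g : Es n → ℝ} (hf : Sm f) (hg : Sm g) (v) : dv v (fun x => f x - g x) = fun x => dv v f x - dv v g x := by
  funext x
  simp only [dv]
  rw [fderiv_fun_sub (hf.diffAt x) (hg.diffAt x)]; rfl

theorem dv_mul {f g : Es n → ℝ} (hf : Sm f) (hg : Sm g) (v) : dv v (fun x => f x * g x) = fun x => f x * dv v g x + g x * dv v f x := by
  funext x
  simp only [dv]
  rw [fderiv_fun_mul (hf.diffAt x) (hg.diffAt x)]; rfl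

theorem dv_const (c : ℝ) (v) : dv v (fun _ : Es n => c) = fun _ => 0 := by
  funext x; simp [dv]

theorem dv_cmul {f : Es n → ℝ} (c : ℝ) (hf : Sm f) (v) : dv v (fun x => c * f x) = fun x => c * dv v f x := by
  funext x
  simp only [dv]
  rw [fderiv_const_mul (hf.diffAt x)]; rfl

theorem dv_sum {ι : Type*} (s : Finset ι) {f : ι → Es n → ℝ} (hf : ∀ i ∈ s, Sm (f i)) (v) : dv v (fun x => ∑ i ∈ s, f i x) = fun x => ∑ i ∈ s, dv v (f i) x := by
  funext x
  simp only [dv]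
  rw [fderiv_fun_sum (fun i hi => (hf i hi).diffAt x)]; simp

theorem dv_comp {f : Es n → ℝ} (hf : Sm f) {φ φ' : ℝ → ℝ} (v) {x : Es n} (hφ : HasDerivAt φ (φ' (f x)) (f x)) : dv v (fun x => φ (f x)) x = φ' (f x) * dv v f x := by
  simp only [dv]
  have := (hφ.comp_hasFDerivAt x (hf.diffAt x).hasFDerivAt).fderiv
  simp only [Function.comp_def] at this
  rw [this]; simp

theorem Sm.add {f g : Es n → ℝ} (hf : Sm f) (hg : Sm g) : Sm (fun x => f x + g x) := ContDiff.add hf hg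
theorem Sm.sub {f g : Es n → ℝ} (hf : Sm f) (hg : Sm g) : Sm (fun x => f x - g x) := ContDiff.sub hf hg
theorem Sm.mul {f g : Es n → ℝ} (hf : Sm f) (hg : Sm g) : Sm (fun x => f x * g x) := ContDiff.mul hf hg
theorem Sm.const (c : ℝ) : Sm (fun _ : Es n => c) := contDiff_const
theorem Sm.sum {ι : Type*} {s : Finset ι} {f : ι → Es n → ℝ} (hf : ∀ i ∈ s, Sm (f i)) : Sm (fun x => ∑ i ∈ s, f i x) := ContDiff.sum hf
theorem Sm.pow {f : Es n → ℝ} (hf : Sm f) (k : ℕ) : Sm (fun x => f x ^ k) := ContDiff.pow hf k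

theorem dv_lin (v : Fin n → ℝ) (f : Es n → ℝ) (x) : dv v f x = ∑ i, v i * dd i f x := by
  have : tv v = ∑ i, v i • tv (Pi.single i 1) := by
    ext j
    simp [Pi.single_apply]
  simp only [dv, dd]
  rw [this, map_sum]
  exact Finset.sum_congr rfl (fun i _ => by rw [map_smul]; rfl)

theorem dv_gr (v : Fin n → ℝ) (f : Es n → ℝ) (x) : dv v f x = v ⬝ᵥ gr f x := dv_lin v f x

theorem dv_dv {f : Es n → ℝ} (h : Sm f) (v w) (x) : dv v (dv w f) x = fderiv ℝ (fderiv ℝ f) x (tv v) (tv w) := by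
  have h1 : ContDiff ℝ (⊤ : ℕ∞) (fderiv ℝ f) := ContDiff.fderiv_right h (by exact_mod_cast le_top)
  have h2 : DifferentiableAt ℝ (fderiv ℝ f) x := (h1.differentiable (by simp)) x
  show fderiv ℝ (fun y => fderiv ℝ f y (tv w)) x (tv v) = _
  rw [fderiv_clm_apply h2 (differentiableAt_const _)]
  simp

theorem dv_comm {f : Es n → ℝ} (h : Sm f) (v w) (x) : dv v (dv w f) x = dv w (dv v f) x := by
  rw [dv_dv h, dv_dv h]
  have : ContDiffAt ℝ (⊤ : ℕ∞) f x := ContDiff.contDiffAt h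
  exact (this.isSymmSndFDerivAt (by simp; exact WithTop.coe_le_coe.2 (le_top : (2:ℕ∞) ≤ ⊤))) _ _

theorem dv_comm' {f : Es n → ℝ} (h : Sm f) (v w) : dv v (dv w f) = dv w (dv v f) := funext fun x => dv_comm h v w x

theorem Hs_symm {f : Es n → ℝ} (h : Sm f) (x) : (Hs f x).IsHermitian := by
  ext i j
  simp only [Matrix.conjTranspose_apply, star_trivial, Hs]
  exact dv_comm h _ _ x

theorem dv_dv_Hs {f : Es n → ℝ} (h : Sm f) (v w) (x) : dv v (dv w f) x = v ⬝ᵥ (Hs f x *ᵥ w) := by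
  rw [dv_lin]
  simp only [dotProduct, mulVec]
  refine Finset.sum_congr rfl (fun i _ => ?_)
  congr 1
  have : dv w f = fun x => ∑ j, w j * dd j f x := funext fun x => dv_lin w f x
  rw [this, dd, dv_sum _ (fun j _ => (Sm.const _).mul (h.dv _))]
  refine Finset.sum_congr rfl (fun j _ => ?_)
  rw [dv_cmul _ (h.dv _)]
  simp only [Hs]; ring

theorem Hs_eq {u : Es n → ℝ} (h : Sm u) (x) : hessianMatrix u x = Hs u x := by
  ext i j
  simp only [hessianMatrix, Hs, iteratedFDeriv_two_apply]
  rw [dd, dv_dv h]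
  rfl

theorem line_deriv {f : Es n → ℝ} (h : Sm f) (x) (q : Fin n → ℝ) (s : ℝ) :
    HasDerivAt (fun s : ℝ => f (x + s • tv q)) (dv q f (x + s • tv q)) s := by
  have h1 : HasDerivAt (fun s : ℝ => x + s • tv q) (tv q) s := by
    simpa using ((hasDerivAt_id s).smul_const (tv q)).const_add x
  exact (h.diffAt _).hasFDerivAt.comp_hasDerivAt s h1

theorem dv_of_line {f : Es n → ℝ} (h : Sm f) {x} {q : Fin n → ℝ} {c : ℝ} (hc : HasDerivAt (fun s : ℝ => f (x + s • tv q)) c 0) : dv q f x = c := by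
  have := line_deriv h x q 0
  have h2 := this.unique hc
  simpa using h2

theorem Sm.Hs {f : Es n → ℝ} (h : Sm f) (i j) : Sm (fun x => Hs f x i j) := (h.dv _).dv _

theorem Sm.NT {V : Es n → Matrix (Fin n) (Fin n) ℝ} (h : ∀ i j, Sm (fun x => V x i j)) (k : ℕ) :
    ∀ i j, Sm (fun x => NT k (V x) i j) := by
  induction k with
  | zero => intro i j; exact Sm.const _
  | succ k ih =>
    intro i j
    simp only [_root_.NT, Matrix.sub_apply, Matrix.smul_apply, smul_eq_mul, Matrix.mul_apply, Matrix.trace, Matrix.diag, div_eq_mul_inv]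
    exact Sm.sub (((Sm.sum (fun p _ => Sm.sum (fun q _ => (ih p q).mul (h q p)))).mul (Sm.const _)).mul (Sm.const _))
      (Sm.sum (fun p _ => (ih i p).mul (h p j)))

theorem Sm.NS {V : Es n → Matrix (Fin n) (Fin n) ℝ} (h : ∀ i j, Sm (fun x => V x i j)) (k : ℕ) :
    Sm (fun x => NS k (V x)) := by
  cases k with
  | zero => exact Sm.const _
  | succ k =>
    simp only [_root_.NS, Matrix.mul_apply, Matrix.trace, Matrix.diag, div_eq_mul_inv]
    exact ((Sm.sum (fun p _ => Sm.sum (fun q _ => (Sm.NT h k p q).mul (h q p)))).mul (Sm.const _))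

def dM (q : Fin n → ℝ) (V : Es n → Matrix (Fin n) (Fin n) ℝ) (x : Es n) : Matrix (Fin n) (Fin n) ℝ := fun i j => dv q (fun x => V x i j) x

theorem line_deriv_M {V : Es n → Matrix (Fin n) (Fin n) ℝ} (h : ∀ i j, Sm (fun x => V x i j)) (x) (q : Fin n → ℝ) (s : ℝ) (i j) :
    HasDerivAt (fun s : ℝ => V (x + s • tv q) i j) (dM q V (x + s • tv q) i j) s := line_deriv (h i j) x q s

theorem dv_NT {V : Es n → Matrix (Fin n) (Fin n) ℝ} (h : ∀ i j, Sm (fun x => V x i j)) (k : ℕ) (q) (x) (i j) :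
    dv q (fun x => NT k (V x) i j) x = dNT k (V x) (dM q V x) i j := by
  apply dv_of_line (Sm.NT h k i j)
  have := hasDerivAt_NT (line_deriv_M h x q 0) k i j
  simpa using this

theorem dv_NS {V : Es n → Matrix (Fin n) (Fin n) ℝ} (h : ∀ i j, Sm (fun x => V x i j)) (k : ℕ) (q) (x) :
    dv q (fun x => NS k (V x)) x = dNS k (V x) (dM q V x) := by
  apply dv_of_line (Sm.NS h k)
  have := hasDerivAt_NS (line_deriv_M h x q 0) k
  simpa using this

theorem dM_Hs {u : Es n → ℝ} (h : Sm u) (q) (x) : dM q (Hs u) x = Hs (dv q u) x := by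
  ext i j
  simp only [dM, Hs]
  rw [show (fun x => dd i (dd j u) x) = dv (Pi.single i 1) (dv (Pi.single j 1) u) from rfl]
  rw [dv_comm (h.dv _), dd, dv_comm' h]

theorem dv_NS_Hs {u : Es n → ℝ} (h : Sm u) (k : ℕ) (q) (x) :
    dv q (fun x => NS (k+1) (Hs u x)) x = trace (NT k (Hs u x) * Hs (dv q u) x) := by
  rw [dv_NS (fun i j => h.Hs i j), dNS_sym (Hs_symm h x), dM_Hs h]

theorem div_free {u : Es n → ℝ} (h : Sm u) (k : ℕ) (j : Fin n) (x) :
    ∑ i, dd i (fun x => NT k (Hs u x) i j) x = 0 := by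
  induction k generalizing j with
  | zero => 
    apply Finset.sum_eq_zero; intro i _
    simp only [NT]
    rw [dd, dv_const]
  | succ k ih =>
    have e : ∀ i, dd i (fun x => NT (k+1) (Hs u x) i j) x = dd i (fun x => NS (k+1) (Hs u x)) x * (1 : Matrix (Fin n) (Fin n) ℝ) i j
       - ∑ p, (NT k (Hs u x) i p * dd i (fun x => Hs u x p j) x + Hs u x p j * dd i (fun x => NT k (Hs u x) i p) x) := by
      intro i
      have s1 : ∀ i j, Sm (fun x => Hs u x i j) := fun i j => h.Hs i j
      have s2 := Sm.NT s1 k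
      have s3 := Sm.NS s1 (k+1)
      have : (fun x => NT (k+1) (Hs u x) i j) = fun x => (1 : Matrix (Fin n) (Fin n) ℝ) i j * NS (k+1) (Hs u x) - ∑ p, NT k (Hs u x) i p * Hs u x p j := by
        funext x; rw [NT_succ]; simp [Matrix.mul_apply, mul_comm]
      rw [this, dd, dv_sub ((Sm.const _).mul s3) (Sm.sum (fun p _ => (s2 i p).mul (s1 p j))), dv_cmul _ s3, dv_sum _ (fun p _ => (s2 i p).mul (s1 p j))]
      simp only []
      rw [mul_comm]
      congr 1
      refine Finset.sum_congr rfl (fun p _ => ?_)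
      rw [dv_mul (s2 i p) (s1 p j)]
    simp only [e]
    rw [Finset.sum_sub_distrib, sub_eq_zero]
    rw [Finset.sum_eq_single j (by intro b _ hb; rw [Matrix.one_apply_ne hb, mul_zero]) (by simp), Matrix.one_apply_eq, mul_one]
    simp only [Finset.sum_add_distrib]
    have z : ∑ i, ∑ p, Hs u x p j * dd i (fun x => NT k (Hs u x) i p) x = 0 := by
      rw [Finset.sum_comm]
      apply Finset.sum_eq_zero; intro p _
      rw [← Finset.mul_sum, ih, mul_zero]
    rw [z, add_zero, dd, dv_NS_Hs h]
    simp only [Matrix.trace, Matrix.diag, Matrix.mul_apply]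
    refine Finset.sum_congr rfl (fun i _ => Finset.sum_congr rfl (fun p _ => ?_))
    congr 1
    simp only [Hs]
    have h3 : ∀ a b c : Fin n, dd a (dd b (dd c u)) x = dd b (dd a (dd c u)) x := fun a b c => dv_comm (h.dv _) _ _ x
    have h4 : ∀ a b c : Fin n, dd a (dd b (dd c u)) x = dd a (dd c (dd b u)) x := fun a b c => by
      rw [dd, dd, show dd b (dd c u) = dd c (dd b u) from dv_comm' h _ _]
    show dd p (dd i (dd j u)) x = dd i (dd p (dd j u)) x
    rw [h3]

end calc3

section max3
open Matrix

theorem max1d {w w' g g' r r' : ℝ → ℝ} {w2 g2 r2 : ℝ} {b : ℕ} (hw : ∀ s, HasDerivAt w (w' s) s) (hg : ∀ s, HasDerivAt g (g' s) s)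
    (hr : ∀ s, HasDerivAt r (r' s) s) (hw2 : HasDerivAt w' w2 0) (hg2 : HasDerivAt g' g2 0) (hr2 : HasDerivAt r' r2 0)
    (hw0 : 0 < w 0) (hmax : IsLocalMax (fun s => w s ^ (b+2) * Real.exp (r s) * g s) 0) :
    g' 0 = - g 0 * (((b:ℝ)+2) * w' 0 / w 0 + r' 0) ∧
    g2 + g 0 * (((b:ℝ)+2) * w2 / w 0 - ((b:ℝ)+2) * (w' 0)^2 / (w 0)^2 + r2 - (((b:ℝ)+2) * w' 0 / w 0 + r' 0)^2) ≤ 0 := by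
  set ψ : ℝ → ℝ := fun s => ((b:ℝ)+2) * w' s * g s + w s * r' s * g s + w s * g' s with hψ
  set μ : ℝ → ℝ := fun s => w s ^ (b+1) * Real.exp (r s) with hμ
  have hφ : ∀ s, HasDerivAt (fun s => w s ^ (b+2) * Real.exp (r s) * g s) (μ s * ψ s) s := by
    intro s
    have := ((((hw s).pow (b+2)).mul ((hr s).exp)).mul (hg s))
    refine this.congr_deriv ?_
    simp only [hμ, hψ]
    push_cast
    simp
    ring
  have hμd : ∃ μ1, HasDerivAt μ μ1 0 := ⟨_, (((hw 0).pow (b+1)).mul ((hr 0).exp))⟩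
  obtain ⟨μ1, hμd⟩ := hμd
  have hψd : HasDerivAt ψ (((b:ℝ)+2) * (w2 * g 0 + w' 0 * g' 0) + ((w' 0 * r' 0 + w 0 * r2) * g 0 + w 0 * r' 0 * g' 0) + (w' 0 * g' 0 + w 0 * g2)) 0 := by
    have := (((hw2.const_mul ((b:ℝ)+2)).mul (hg 0)).add (((hw 0).mul hr2).mul (hg 0))).add ((hw 0).mul hg2)
    refine this.congr_deriv ?_
    simp
    ring
  have hμp : 0 < μ 0 := by simp only [hμ]; positivity
  have z : μ 0 * ψ 0 = 0 := hmax.hasDerivAt_eq_zero (hφ 0)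
  have z1 : ψ 0 = 0 := by
    rcases mul_eq_zero.1 z with h | h
    · exact absurd h hμp.ne'
    · exact h
  have c := locmax_second hφ (hμd.mul hψd) hmax
  rw [z1, mul_zero, zero_add] at c
  have c2 := nonpos_of_mul_nonpos_right c hμp
  simp only [hψ] at z1
  have e1 : g' 0 = - g 0 * (((b:ℝ)+2) * w' 0 / w 0 + r' 0) := by
    field_simp; linarith
  refine ⟨e1, ?_⟩
  rw [e1] at c2
  have : w 0 * (g2 + g 0 * (((b:ℝ)+2) * w2 / w 0 - ((b:ℝ)+2) * (w' 0)^2 / (w 0)^2 + r2 - (((b:ℝ)+2) * w' 0 / w 0 + r' 0)^2)) ≤ 0 := by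
    refine le_of_eq_of_le ?_ c2
    field_simp
    ring
  exact nonpos_of_mul_nonpos_right this hw0

variable {n : ℕ}

theorem maxnd {w g r : Es n → ℝ} (hw : Sm w) (hg : Sm g) (hr : Sm r) {b : ℕ} {x : Es n} (hx : 0 < w x)
    (hmax : IsLocalMax (fun y => w y ^ (b+2) * Real.exp (r y) * g y) x) (q : Fin n → ℝ) :
    dv q g x = - g x * (((b:ℝ)+2) * dv q w x / w x + dv q r x) ∧
    q ⬝ᵥ (Hs g x *ᵥ q) + g x * (((b:ℝ)+2) * (q ⬝ᵥ (Hs w x *ᵥ q)) / w x - ((b:ℝ)+2) * (dv q w x)^2 / (w x)^2 + q ⬝ᵥ (Hs r x *ᵥ q) - (((b:ℝ)+2) * dv q w x / w x + dv q r x)^2) ≤ 0 := by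
  have hc : ContinuousAt (fun s : ℝ => x + s • tv q) 0 := by fun_prop
  have hm : IsLocalMax (fun s : ℝ => w (x + s • tv q) ^ (b+2) * Real.exp (r (x + s • tv q)) * g (x + s • tv q)) 0 := by
    have h1 : ∀ᶠ y in nhds (x + (0:ℝ) • tv q), (fun y => w y ^ (b+2) * Real.exp (r y) * g y) y ≤ (fun y => w y ^ (b+2) * Real.exp (r y) * g y) x := by
      rw [zero_smul, add_zero]; exact hmax
    have h2 := hc.eventually h1
    filter_upwards [h2] with s hs
    simpa using hs
  have := max1d (line_deriv hw x q) (line_deriv hg x q) (line_deriv hr x q) (line_deriv (hw.dv q) x q 0) (line_deriv (hg.dv q) x q 0) (line_deriv (hr.dv q) x q 0) (by simpa using hx) hm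
  simpa only [zero_smul, add_zero, dv_dv_Hs hw, dv_dv_Hs hg, dv_dv_Hs hr] using this

theorem trace_nonneg_mul {m : ℕ} {V B : Matrix (Fin n) (Fin n) ℝ} (hV : V.IsHermitian) (h : GM (m+1) V) (hB : ∀ q : Fin n → ℝ, 0 ≤ q ⬝ᵥ (B *ᵥ q)) :
    0 ≤ trace (NT m V * B) := by
  obtain ⟨Q, d⟩ := exists_Dg hV
  rw [d.tr_nt]
  have hG := d.gam h
  refine Finset.sum_nonneg (fun i _ => mul_nonneg ((hG.erase (Finset.mem_univ i)).pos m le_rfl).le ?_)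
  have := hB (Q *ᵥ Pi.single i 1)
  have e : (Qᵀ * B * Q) i i = (Q *ᵥ Pi.single i 1) ⬝ᵥ (B *ᵥ (Q *ᵥ Pi.single i 1)) := by
    rw [dotProduct_mulVec, vecMul_mulVec, ← dotProduct_mulVec]
    simp [Matrix.mul_apply, Matrix.mulVec, dotProduct, Matrix.col_apply, Pi.single_apply]
  rw [e]; exact this

theorem trace_outer (a : Matrix (Fin n) (Fin n) ℝ) (v : Fin n → ℝ) : trace (a * vecMulVec v v) = v ⬝ᵥ (a *ᵥ v) := by
  rw [Matrix.mul_vecMulVec, Matrix.trace_vecMulVec, dotProduct_comm]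

theorem quad_outer (v q : Fin n → ℝ) : q ⬝ᵥ (vecMulVec v v *ᵥ q) = (q ⬝ᵥ v)^2 := by
  rw [Matrix.vecMulVec_mulVec]
  simp [dotProduct_smul, dotProduct_comm v q]; ring

theorem maxtr {m : ℕ} {V : Matrix (Fin n) (Fin n) ℝ} (hV : V.IsHermitian) (h : GM (m+1) V)
    {w g r : Es n → ℝ} (hw : Sm w) (hg : Sm g) (hr : Sm r) {b : ℕ} {x : Es n} (hx : 0 < w x)
    (hmax : IsLocalMax (fun y => w y ^ (b+2) * Real.exp (r y) * g y) x) :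
    ∃ t : Fin n → ℝ, t = (((b:ℝ)+2)/w x) • gr w x + gr r x ∧ gr g x = (- g x) • t ∧
     trace (NT m V * Hs g x) + g x * (((b:ℝ)+2) / w x * trace (NT m V * Hs w x) - ((b:ℝ)+2) / (w x)^2 * (gr w x ⬝ᵥ (NT m V *ᵥ gr w x))
       + trace (NT m V * Hs r x) - t ⬝ᵥ (NT m V *ᵥ t)) ≤ 0 := by
  refine ⟨_, rfl, ?_, ?_⟩
  · funext i
    have := (maxnd hw hg hr hx hmax (Pi.single i 1)).1
    simp only [gr, dd, Pi.smul_apply, Pi.add_apply, smul_eq_mul]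
    rw [this]; ring
  · set t := (((b:ℝ)+2)/w x) • gr w x + gr r x with ht
    have := trace_nonneg_mul (B := - (Hs g x + g x • ((((b:ℝ)+2) / w x) • Hs w x - (((b:ℝ)+2) / (w x)^2) • vecMulVec (gr w x) (gr w x) + Hs r x - vecMulVec t t))) hV h ?_
    · simp only [Matrix.mul_neg, Matrix.mul_add, Matrix.mul_sub, Matrix.mul_smul, trace_neg, trace_add, trace_smul, trace_sub, smul_eq_mul, trace_outer] at this
      linarith
    · intro q
      have := (maxnd hw hg hr hx hmax q).2
      simp only [Matrix.neg_mulVec, Matrix.add_mulVec, Matrix.sub_mulVec, Matrix.smul_mulVec, dotProduct_neg, dotProduct_add, dotProduct_sub, dotProduct_smul, smul_eq_mul, quad_outer]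
      have e : q ⬝ᵥ t = ((b:ℝ)+2) * dv q w x / w x + dv q r x := by
        rw [ht, dv_gr, dv_gr]
        simp only [dotProduct_add, dotProduct_smul, smul_eq_mul]; ring
      rw [e, ← dv_gr]
      refine le_of_le_of_eq (neg_nonneg.2 this) ?_
      ring
end max3

section sol3
open Matrix
variable {n : ℕ}

theorem Hs_ap (f : Es n → ℝ) (x) (i j) : Hs f x i j = dv (Pi.single i 1) (dv (Pi.single j 1) f) x := rfl
theorem gr_ap (f : Es n → ℝ) (x) (i) : gr f x i = dv (Pi.single i 1) f x := rfl
theorem gr_sub {f g : Es n → ℝ} (hf : Sm f) (hg : Sm g) (x) : gr (fun x => f x - g x) x = gr f x - gr g x := by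
  funext i; simp only [gr, dd]; rw [dv_sub hf hg]; rfl
theorem gr_const (c : ℝ) (x : Es n) : gr (fun _ => c) x = 0 := by
  funext i; simp only [gr, dd]; rw [dv_const]; rfl
theorem Hs_const (c : ℝ) (x : Es n) : Hs (fun _ => c) x = 0 := by
  ext i j; simp only [Hs_ap]; rw [dv_const, dv_const]; rfl
theorem Hs_sub {f g : Es n → ℝ} (hf : Sm f) (hg : Sm g) (x) : Hs (fun x => f x - g x) x = Hs f x - Hs g x := by
  ext i j; simp only [Hs_ap]; rw [dv_sub hf hg, dv_sub (hf.dv _) (hg.dv _)]; rfl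
theorem Hs_cmul {f : Es n → ℝ} (c : ℝ) (hf : Sm f) (x) : Hs (fun x => c * f x) x = c • Hs f x := by
  ext i j; simp only [Hs_ap]; rw [dv_cmul _ hf, dv_cmul _ (hf.dv _)]; rfl
theorem gr_cmul {f : Es n → ℝ} (c : ℝ) (hf : Sm f) (x) : gr (fun x => c * f x) x = c • gr f x := by
  ext i; simp only [gr, dd]; rw [dv_cmul _ hf]; rfl
theorem Hs_sum {ι : Type*} (s : Finset ι) {f : ι → Es n → ℝ} (hf : ∀ i ∈ s, Sm (f i)) (x) : Hs (fun x => ∑ i ∈ s, f i x) x = ∑ i ∈ s, Hs (f i) x := by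
  ext i j; simp only [Hs_ap]
  rw [dv_sum _ hf, dv_sum _ (fun i hi => (hf i hi).dv _)]
  simp [Matrix.sum_apply, Hs_ap]
theorem gr_sum {ι : Type*} (s : Finset ι) {f : ι → Es n → ℝ} (hf : ∀ i ∈ s, Sm (f i)) (x) : gr (fun x => ∑ i ∈ s, f i x) x = ∑ i ∈ s, gr (f i) x := by
  ext i; simp only [gr, dd]
  rw [dv_sum _ hf]
  simp [gr]
theorem gr_mul {f g : Es n → ℝ} (hf : Sm f) (hg : Sm g) (x) : gr (fun x => f x * g x) x = f x • gr g x + g x • gr f x := by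
  ext i; simp only [gr, dd]; rw [dv_mul hf hg]; rfl
theorem Hs_sq {f : Es n → ℝ} (hf : Sm f) (x) : Hs (fun x => f x * f x) x = (2:ℝ) • (f x • Hs f x + vecMulVec (gr f x) (gr f x)) := by
  ext i j; simp only [Hs_ap]; rw [dv_mul hf hf, dv_add (hf.mul (hf.dv _)) (hf.mul (hf.dv _)), dv_mul hf (hf.dv _)]
  simp only [Matrix.smul_apply, Matrix.add_apply, Matrix.vecMulVec_apply, gr_ap, Hs_ap, smul_eq_mul, nsmul_eq_mul]; push_cast; ring

theorem Sm.coord (i : Fin n) : Sm (fun x : Es n => x i) := by unfold Sm; fun_prop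
theorem dv_coord (i : Fin n) (q) : dv q (fun x : Es n => x i) = fun _ => q i := by
  funext x
  apply dv_of_line (Sm.coord i)
  have : HasDerivAt (fun s : ℝ => x i + s * q i) (q i) 0 := by
    simpa using ((hasDerivAt_id (0:ℝ)).mul_const (q i)).const_add (x i)
  simpa using this
def rr (x : Es n) : ℝ := (1/2) * ∑ i, x i * x i
theorem Sm.rr : Sm (rr (n := n)) := (Sm.const _).mul (Sm.sum fun i _ => (Sm.coord i).mul (Sm.coord i))
theorem gr_rr (x : Es n) : gr rr x = x := by
  have := gr_cmul (1/2) (Sm.sum (s := Finset.univ) (fun (i : Fin n) _ => (Sm.coord i).mul (Sm.coord i))) x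
  rw [show gr rr x = _ from this, gr_sum _ (fun (i : Fin n) _ => (Sm.coord i).mul (Sm.coord i))]
  ext j
  simp only [gr_mul (Sm.coord _) (Sm.coord _)]
  simp [gr_ap, dv_coord, Pi.single_apply, Finset.sum_add_distrib]
  ring
theorem Hs_rr (x : Es n) : Hs rr x = 1 := by
  have := Hs_cmul (1/2) (Sm.sum (s := Finset.univ) (fun (i : Fin n) _ => (Sm.coord i).mul (Sm.coord i))) x
  rw [show Hs rr x = _ from this, Hs_sum _ (fun (i : Fin n) _ => (Sm.coord i).mul (Sm.coord i))]
  ext j k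
  simp only [Hs_sq (Sm.coord _)]
  have : ∀ c : Fin n, Hs (fun x : Es n => x c) x = 0 := fun c => by
    ext a b; simp only [Hs_ap, dv_coord]; rw [dv_const]; rfl
  simp only [this]
  simp [gr_ap, dv_coord, Pi.single_apply, Matrix.sum_apply, Matrix.vecMulVec_apply, Matrix.one_apply, eq_comm]
theorem rr_norm (x : Es n) : rr x = (1/2) * ‖x‖^2 := by
  rw [EuclideanSpace.norm_sq_eq]; simp [rr, sq]
theorem dot_norm (x : Es n) : (x : Fin n → ℝ) ⬝ᵥ x = ‖x‖^2 := by
  rw [EuclideanSpace.norm_sq_eq]; simp [dotProduct, sq]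

structure Sol (m : ℕ) (C : ℝ) (u : Es n → ℝ) : Prop where
  sm : Sm u
  gm : ∀ x, GM (m+2) (Hs u x)
  eq : ∀ x, NS (m+1) (Hs u x) = 1
  gw : ∀ x, C⁻¹ * ‖x‖^2 - C ≤ u x

namespace Sol
variable {m : ℕ} {C : ℝ} {u : Es n → ℝ} (S : Sol m C u)
include S

theorem hV (x) : (Hs u x).IsHermitian := Hs_symm S.sm x
theorem L1 (x) : trace (NT m (Hs u x) * Hs u x) = (m:ℝ)+1 := by
  have := S.eq x
  rw [NS_succ] at this
  have h : (0:ℝ) < (m:ℝ)+1 := by positivity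
  field_simp at this; linarith
theorem L2 (q) (x) : trace (NT m (Hs u x) * Hs (dv q u) x) = 0 := by
  rw [← dv_NS_Hs S.sm]
  rw [show (fun x => NS (m+1) (Hs u x)) = fun _ => 1 from funext S.eq, dv_const]

theorem L3 (q) (x) : trace (NT m (Hs u x) * Hs (dv q (dv q u)) x) = - trace (dNT m (Hs u x) (Hs (dv q u) x) * Hs (dv q u) x) := by
  have e : (fun x => trace (NT m (Hs u x) * Hs (dv q u) x)) = fun _ => 0 := funext (S.L2 q)
  have d0 : HasDerivAt (fun s : ℝ => trace (NT m (Hs u (x + s • tv q)) * Hs (dv q u) (x + s • tv q))) 0 0 := by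
    simp only [S.L2]; exact hasDerivAt_const _ _
  have s1 : ∀ i j, Sm (fun x => Hs u x i j) := fun i j => S.sm.Hs i j
  have s2 : ∀ i j, Sm (fun x => Hs (dv q u) x i j) := fun i j => (S.sm.dv q).Hs i j
  have d1 := hasDerivAt_trace (hasDerivAt_mul_entry (hasDerivAt_NT (line_deriv_M s1 x q 0) m) (line_deriv_M s2 x q 0))
  have := d0.unique d1
  rw [trace_add] at this
  simp only [zero_smul, add_zero, dM_Hs S.sm, dM_Hs (S.sm.dv q)] at this
  linarith

theorem gr_ee (e) (x) : gr (dv e (dv e u)) x = Hs (dv e u) x *ᵥ e := by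
  funext i
  simp only [gr, dd]
  rw [dv_dv_Hs (S.sm.dv e)]
  simp
theorem L3_nonneg (q) (x) : 0 ≤ trace (NT m (Hs u x) * Hs (dv q (dv q u)) x) := by
  rw [S.L3]
  have := M4 (S.hV x) ((S.gm x).mono (by omega)) (B := Hs (dv q u) x) (Hs_symm (S.sm.dv q) x) (S.L2 q x)
  linarith
end Sol

def gsq (u : Es n → ℝ) (x : Es n) : ℝ := ∑ i, dd i u x * dd i u x
theorem gsq_eq (u : Es n → ℝ) (x) : gsq u x = gr u x ⬝ᵥ gr u x := rfl
theorem Sm.gsq {u : Es n → ℝ} (h : Sm u) : Sm (gsq u) := Sm.sum fun i _ => (h.dv _).mul (h.dv _)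
theorem gr_dd {u : Es n → ℝ} (h : Sm u) (i) (x) : gr (dd i u) x = fun j => Hs u x j i := rfl
theorem gr_gsq {u : Es n → ℝ} (h : Sm u) (x) : gr (gsq u) x = (2:ℝ) • (Hs u x *ᵥ gr u x) := by
  have := gr_sum Finset.univ (fun (i : Fin n) _ => (h.dv (Pi.single i 1)).mul (h.dv (Pi.single i 1))) x
  rw [show gr (gsq u) x = _ from this]
  simp only [gr_mul (h.dv _) (h.dv _)]
  funext j
  simp only [Finset.sum_apply, Pi.add_apply, Pi.smul_apply, smul_eq_mul, mulVec, dotProduct, Finset.mul_sum]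
  refine Finset.sum_congr rfl fun i _ => ?_
  simp only [gr, Hs, dd]; ring
theorem Sol.L_gsq {m : ℕ} {C : ℝ} {u : Es n → ℝ} (S : Sol m C u) (x) : 0 ≤ trace (NT m (Hs u x) * Hs (gsq u) x) := by
  have h := S.sm
  have := Hs_sum Finset.univ (fun (i : Fin n) _ => (h.dv (Pi.single i 1)).mul (h.dv (Pi.single i 1))) x
  rw [show Hs (gsq u) x = _ from this]
  simp only [Hs_sq (h.dv _), Matrix.mul_sum, trace_sum]
  refine Finset.sum_nonneg fun i _ => ?_
  rw [Matrix.mul_smul, trace_smul, Matrix.mul_add, trace_add, Matrix.mul_smul, trace_smul, S.L2, trace_outer]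
  have := NT_nonneg (S.hV x) ((S.gm x).mono (by omega : m+1 ≤ m+2)) (gr (dv (Pi.single i 1) u) x)
  simp; exact this
end sol3

section P4
open Matrix
variable {n : ℕ}

theorem dot_add_sq (x y : Fin n → ℝ) : (x + y) ⬝ᵥ (x + y) ≤ 2 * (x ⬝ᵥ x) + 2 * (y ⬝ᵥ y) := by
  have h : 0 ≤ (x - y) ⬝ᵥ (x - y) := Finset.sum_nonneg fun i _ => mul_self_nonneg _
  simp only [add_dotProduct, sub_dotProduct, dotProduct_add, dotProduct_sub, dotProduct_comm y x] at *
  linarith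

theorem quad_add_sq {m : ℕ} {V : Matrix (Fin n) (Fin n) ℝ} (hV : V.IsHermitian) (h : GM (m+1) V) (x y : Fin n → ℝ) :
    (x + y) ⬝ᵥ (NT m V *ᵥ (x + y)) ≤ 2 * (x ⬝ᵥ (NT m V *ᵥ x)) + 2 * (y ⬝ᵥ (NT m V *ᵥ y)) := by
  have h : 0 ≤ (x - y) ⬝ᵥ (NT m V *ᵥ (x - y)) := NT_nonneg hV h _
  simp only [add_dotProduct, sub_dotProduct, dotProduct_add, dotProduct_sub, Matrix.mulVec_add, Matrix.mulVec_sub] at *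
  linarith

theorem quad_smul' (a : Matrix (Fin n) (Fin n) ℝ) (c : ℝ) (x : Fin n → ℝ) : (c • x) ⬝ᵥ (a *ᵥ (c • x)) = c^2 * (x ⬝ᵥ (a *ᵥ x)) := by
  simp only [Matrix.mulVec_smul, smul_dotProduct, dotProduct_smul, smul_eq_mul]; ring

theorem dot_self_nonneg (x : Fin n → ℝ) : 0 ≤ x ⬝ᵥ x := Finset.sum_nonneg fun i _ => mul_self_nonneg _

/-- absorb the gradient term -/
theorem absorb {m : ℕ} {V : Matrix (Fin n) (Fin n) ℝ} (hV : V.IsHermitian) (h : GM (m+1) V) {x y T : Fin n → ℝ} {w β ρ : ℝ}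
    (hw : 0 < w) (hβ : 0 < β) (hx : x ⬝ᵥ x ≤ ρ) (hT : T = (β/w) • y - x) :
    β / w^2 * (y ⬝ᵥ (NT m V *ᵥ y)) ≤ 2/β * (T ⬝ᵥ (NT m V *ᵥ T)) + 2*ρ/β * trace (NT m V) := by
  have e : (β/w) • y = T + x := by rw [hT]; simp
  have h1 := quad_add_sq hV h T x
  rw [← e, quad_smul'] at h1
  have h2 := NT_le_trace hV h x
  have ht : 0 ≤ trace (NT m V) := by
    have := trace_nonneg_mul (B := 1) hV h (fun q => by simpa using dot_self_nonneg q)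
    simpa using this
  have h3 : trace (NT m V) * (x ⬝ᵥ x) ≤ trace (NT m V) * ρ := mul_le_mul_of_nonneg_left hx ht
  have h4 : (β/w)^2 * (y ⬝ᵥ (NT m V *ᵥ y)) ≤ 2 * (T ⬝ᵥ (NT m V *ᵥ T)) + 2 * (trace (NT m V) * ρ) := by linarith
  have h5 := mul_le_mul_of_nonneg_left h4 (by positivity : 0 ≤ 1/β)
  calc _ = 1/β * ((β/w)^2 * (y ⬝ᵥ (NT m V *ᵥ y))) := by field_simp
    _ ≤ _ := h5
    _ = _ := by field_simp

theorem scal13 {w W β ρ g t xx : ℝ} (hw : 0 < w) (hwW : w ≤ W) (hβ : 4 ≤ β) (hρ : 1 ≤ ρ) (hx : xx ≤ ρ)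
    (h0 : 0 ≤ β/w * (β/w * g - t) - (β/w * t - xx)) : t ≤ β/w * g / 2 + W * ρ := by
  have hbw : 0 < β/w := div_pos (by linarith) hw
  have h3 : 1 ≤ β/w * W := by
    rw [div_mul_eq_mul_div, one_le_div hw]; nlinarith
  generalize β/w = c at *
  have h4 : ρ ≤ c * W * ρ := by nlinarith
  have : 2 * c * t ≤ 2 * c * (c * g / 2 + W * ρ) := by nlinarith
  exact le_of_mul_le_mul_left this (by positivity)

set_option maxHeartbeats 1000000 in
theorem grad_alg {m : ℕ} {V : Matrix (Fin n) (Fin n) ℝ} (hV : V.IsHermitian) (h : GM (m+2) V) (h1 : NS (m+1) V = 1) {x y T : Fin n → ℝ} {w W β ρ : ℝ}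
    (hw : 0 < w) (hwW : w ≤ W) (hβ2 : 4 ≤ β) (hβρ : 4 * ρ ≤ β) (hρ : 1 ≤ ρ) (hx : x ⬝ᵥ x ≤ ρ)
    (hT : T = (β/w) • y - x) (hTV : (y ⬝ᵥ y) • T = (2:ℝ) • (V *ᵥ y)) (hg : 1 ≤ y ⬝ᵥ y)
    (htr : trace (NT m V) ≤ β * ((m:ℝ)+1) / w + β / w^2 * (y ⬝ᵥ (NT m V *ᵥ y)) + T ⬝ᵥ (NT m V *ᵥ T)) :
    y ⬝ᵥ y ≤ w * (2 * ((2*β*((m:ℝ)+1) + 12 * n * (β + ρ * W)) / w)^m + W * ρ) := by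
  have hm1 : GM (m+1) V := h.mono (by omega)
  set tr := trace (NT m V) with htrd
  set s := T ⬝ᵥ (NT m V *ᵥ T) with hs
  set g := y ⬝ᵥ y with hgd
  have hs0 : 0 ≤ s := NT_nonneg hV hm1 T
  have htr1 : 1 ≤ tr := B_tr hV h h1
  have ha := absorb hV hm1 hw (by linarith) hx hT
  have hn : (0:ℝ) ≤ n := Nat.cast_nonneg n
  have hW : 0 < W := by linarith
  have ha2 : 2/β * s ≤ s := by
    have : 2/β ≤ 1 := by rw [div_le_one (by linarith)]; linarith
    nlinarith
  have ha3 : 2*ρ/β * tr ≤ tr / 2 := by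
    have : 2*ρ/β ≤ 1/2 := by rw [div_le_div_iff₀ (by linarith) (by norm_num)]; linarith
    nlinarith
  have k1 : tr ≤ 2 * (β * ((m:ℝ)+1) / w) + 4 * s := by
    have h2 : β / w^2 * (y ⬝ᵥ (NT m V *ᵥ y)) ≤ s + tr/2 := ha.trans (add_le_add ha2 ha3)
    linarith
  have k2 : g * s = 2 * (T ⬝ᵥ ((NT m V * V) *ᵥ y)) := by
    have : g * s = T ⬝ᵥ (NT m V *ᵥ (g • T)) := by rw [Matrix.mulVec_smul, dotProduct_smul, smul_eq_mul]
    rw [this, hTV, Matrix.mulVec_smul, dotProduct_smul, smul_eq_mul, Matrix.mulVec_mulVec]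
  have k3 : (g*s)^2 ≤ 4 * n^2 * ((T ⬝ᵥ T) * g) := by
    have := B_TV hV h h1 T y
    rw [k2, mul_pow]
    simp only [Fintype.card_fin] at this
    linarith
  have k4 : T ⬝ᵥ T ≤ 2 * ((β/w)^2 * g) + 2 * ρ := by
    have := dot_add_sq ((β/w) • y) (-x)
    rw [← sub_eq_add_neg, ← hT] at this
    simp only [smul_dotProduct, dotProduct_smul, smul_eq_mul, neg_dotProduct, dotProduct_neg, neg_neg] at this
    calc _ ≤ _ := this
      _ ≤ 2 * (β/w * (β/w * g)) + 2 * ρ := by linarith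
      _ = _ := by ring
  have k5 : T ⬝ᵥ T ≤ 2 * g * ((β/w)^2 + ρ) := by nlinarith
  have hbw : 0 < β/w := div_pos (by linarith) hw
  have k6 : s^2 ≤ 8 * n^2 * ((β/w)^2 + ρ) := by
    have : (g*s)^2 ≤ g^2 * (8 * n^2 * ((β/w)^2 + ρ)) := by
      have : 4 * (n:ℝ)^2 * ((T ⬝ᵥ T) * g) ≤ 4 * n^2 * ((2 * g * ((β/w)^2 + ρ)) * g) := by gcongr
      nlinarith
    rw [mul_pow] at this
    exact le_of_mul_le_mul_left this (by positivity)
  have k7 : s ≤ 3 * n * (β/w + ρ) := by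
    refine abs_le_of_sq_le_sq' ?_ (by positivity) |>.2
    have : 8 * (n:ℝ)^2 * ((β/w)^2 + ρ) ≤ 8 * n^2 * (β/w + ρ)^2 := by
      gcongr; nlinarith
    nlinarith [mul_nonneg (sq_nonneg (n:ℝ)) (sq_nonneg (β/w+ρ))]
  set C1 := 2*β*((m:ℝ)+1) + 12 * n * (β + ρ * W) with hC1
  have k8 : tr ≤ C1 / w := by
    have : ρ ≤ ρ * W / w := by rw [le_div_iff₀ hw]; nlinarith
    calc tr ≤ 2 * (β * ((m:ℝ)+1) / w) + 4 * (3 * n * (β/w + ρ * W / w)) := by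
            have : 3 * (n:ℝ) * (β/w + ρ) ≤ 3 * n * (β/w + ρ * W / w) := by gcongr
            linarith
      _ = _ := by rw [hC1]; field_simp; ring
  have k9 : NS m V ≤ C1 / w := (B_E_tr hV h h1).trans k8
  have hE : 1 ≤ NS m V := B_E hV h h1
  have k10 : y ⬝ᵥ (V *ᵥ y) ≤ (C1/w)^m * g := by
    refine (B_V_up hV h h1 y).trans ?_
    gcongr
  have k11 : g * (β/w * g - y ⬝ᵥ x) = 2 * (y ⬝ᵥ (V *ᵥ y)) := by
    have := congrArg (fun v => y ⬝ᵥ v) hTV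
    simp only [dotProduct_smul, smul_eq_mul] at this
    rw [← this, hT, dotProduct_sub, dotProduct_smul, smul_eq_mul]
  have k12 : β/w * g - y ⬝ᵥ x ≤ 2 * (C1/w)^m := by
    have : g * (β/w * g - y ⬝ᵥ x) ≤ g * (2 * (C1/w)^m) := by rw [k11]; linarith
    exact le_of_mul_le_mul_left this (by linarith)
  have k13 : y ⬝ᵥ x ≤ β/w * g / 2 + W * ρ := by
    have h0 : 0 ≤ ((β/w) • y - x) ⬝ᵥ ((β/w) • y - x) := dot_self_nonneg _
    simp only [sub_dotProduct, dotProduct_sub, smul_dotProduct, dotProduct_smul, smul_eq_mul, dotProduct_comm x y] at h0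
    exact scal13 hw hwW hβ2 hρ hx h0
  have k14 : β/w * g / 2 ≤ 2 * (C1/w)^m + W * ρ := by linarith
  have k15 : g ≤ w * (β/w * g / 2) := by
    have : w * (β/w * g / 2) = β * g / 2 := by field_simp
    rw [this]; nlinarith
  exact k15.trans (mul_le_mul_of_nonneg_left k14 hw.le)

theorem pog_alg {m : ℕ} {V B : Matrix (Fin n) (Fin n) ℝ} (hV : V.IsHermitian) (h : GM (m+2) V) (h1 : NS (m+1) V = 1) {x y T e : Fin n → ℝ} {w W β ρ K Lg D : ℝ}
    (hw : 0 < w) (hwW : w ≤ W) (hβ2 : 4 ≤ β) (hβρ : 4 * ρ ≤ β) (hx : x ⬝ᵥ x ≤ ρ) (hK : 0 < K)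
    (hT : T = (β/w) • y - x) (hBe : B *ᵥ e = K • T)
    (hM : (3/2)*((B *ᵥ e) ⬝ᵥ (NT m V *ᵥ (B *ᵥ e))) - 3/(2*K)*((B *ᵥ e) ⬝ᵥ (B *ᵥ e)) ≤ K * Lg)
    (htr : Lg + K * (trace (NT m V) - β * ((m:ℝ)+1) / w - β / w^2 * (y ⬝ᵥ (NT m V *ᵥ y)) - T ⬝ᵥ (NT m V *ᵥ T)) ≤ 0)
    (hD : 0 ≤ D) (hD1 : 3/K * (T ⬝ᵥ T) ≤ D) (hKm : ∃ q : Fin n → ℝ, q ⬝ᵥ q = 1 ∧ K = q ⬝ᵥ (V *ᵥ q)) :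
    K ≤ ((2*β*((m:ℝ)+1) + D * W) / w)^m := by
  have hm1 : GM (m+1) V := h.mono (by omega)
  set tr := trace (NT m V) with htrd
  set s := T ⬝ᵥ (NT m V *ᵥ T) with hs
  have hs0 : 0 ≤ s := NT_nonneg hV hm1 T
  have htr1 : 1 ≤ tr := B_tr hV h h1
  have ha := absorb hV hm1 hw (by linarith) hx hT
  have ha2 : 2/β * s ≤ s/2 := by
    have : 2/β ≤ 1/2 := by rw [div_le_div_iff₀ (by linarith) (by norm_num)]; linarith
    nlinarith
  have ha3 : 2*ρ/β * tr ≤ tr / 2 := by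
    have : 2*ρ/β ≤ 1/2 := by rw [div_le_div_iff₀ (by linarith) (by norm_num)]; linarith
    nlinarith
  rw [hBe, quad_smul'] at hM
  simp only [smul_dotProduct, dotProduct_smul, smul_eq_mul] at hM
  have hM' : K * (K * ((3/2) * s) - K * (1/2 * (3/K * (T ⬝ᵥ T)))) ≤ K * Lg := by
    refine le_of_eq_of_le ?_ hM
    rw [← hs]
    field_simp
  have hM2 := le_of_mul_le_mul_left hM' hK
  have hfin : K * ((3/2) * s - 1/2 * (3/K * (T ⬝ᵥ T)) + (tr - β * ((m:ℝ)+1) / w - β / w^2 * (y ⬝ᵥ (NT m V *ᵥ y)) - s)) ≤ 0 := by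
    linarith
  have hf2 := nonpos_of_mul_nonpos_right hfin hK
  have hW : 0 < W := by linarith
  have k8 : tr ≤ (2*β*((m:ℝ)+1) + D * W) / w := by
    have : D ≤ D * W / w := by rw [le_div_iff₀ hw]; nlinarith
    have e : (2*β*((m:ℝ)+1) + D * W) / w = 2 * (β * ((m:ℝ)+1) / w) + D * W / w := by field_simp
    rw [e]
    linarith
  have k9 := (B_E_tr hV h h1).trans k8
  have hE : 1 ≤ NS m V := B_E hV h h1
  obtain ⟨q, hq, rfl⟩ := hKm
  have := B_V_up hV h h1 q
  rw [hq, mul_one] at this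
  refine this.trans ?_
  gcongr
end P4

section P4b
open Matrix
variable {n m : ℕ} {C : ℝ} {u : Es n → ℝ}

theorem Sol.sub_bd (hC : 1 ≤ C) (S : Sol m C u) {x} (hx : u x ≤ 2) : ‖x‖^2 ≤ C * (2 + C) := by
  have := S.gw x
  have h : C⁻¹ * ‖x‖^2 ≤ 2 + C := by linarith
  rw [inv_mul_le_iff₀ (by linarith)] at h; exact h
theorem Sol.w_bd (hC : 1 ≤ C) (S : Sol m C u) (x) : 2 - u x ≤ 2 + C := by
  have := S.gw x
  have h : 0 ≤ C⁻¹ * ‖x‖^2 := by positivity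
  linarith
theorem Sol.cpt (hC : 1 ≤ C) (S : Sol m C u) : IsCompact {x | u x ≤ 2} := by
  apply Metric.isCompact_of_isClosed_isBounded
  · exact isClosed_le S.sm.cont continuous_const
  · rw [isBounded_iff_forall_norm_le]
    refine ⟨C * (2+C), fun x hx => ?_⟩
    have := S.sub_bd hC hx
    have h1 : 1 ≤ C * (2+C) := by nlinarith
    have := norm_nonneg x
    nlinarith

theorem Sol.gr_w (S : Sol m C u) (x) : gr (fun x => 2 - u x) x = - gr u x := by
  rw [gr_sub (Sm.const 2) S.sm, gr_const]; simp
theorem Sol.Hs_w (S : Sol m C u) (x) : Hs (fun x => 2 - u x) x = - Hs u x := by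
  rw [Hs_sub (Sm.const 2) S.sm, Hs_const]; simp

/-- max principle packaged -/
theorem Sol.mx (S : Sol m C u) {g : Es n → ℝ} (hg : Sm g) {b : ℕ} {x : Es n} (hx : u x < 2)
    (hmax : ∀ y, u y ≤ 2 → (2 - u y)^(b+2) * Real.exp (rr y) * g y ≤ (2 - u x)^(b+2) * Real.exp (rr x) * g x) :
    ∃ T : Fin n → ℝ, T = (((b:ℝ)+2) / (2 - u x)) • gr u x - x ∧ gr g x = g x • T ∧
    trace (NT m (Hs u x) * Hs g x) + g x * (trace (NT m (Hs u x)) - ((b:ℝ)+2) * ((m:ℝ)+1) / (2 - u x) - ((b:ℝ)+2) / (2 - u x)^2 * (gr u x ⬝ᵥ (NT m (Hs u x) *ᵥ gr u x)) - T ⬝ᵥ (NT m (Hs u x) *ᵥ T)) ≤ 0 := by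
  have hloc : IsLocalMax (fun y => (2 - u y)^(b+2) * Real.exp (rr y) * g y) x := by
    have : {y | u y < 2} ∈ nhds x := (isOpen_lt S.sm.cont continuous_const).mem_nhds hx
    filter_upwards [this] with y hy
    exact hmax y (le_of_lt hy)
  obtain ⟨t, ht, h1, h2⟩ := maxtr (S.hV x) ((S.gm x).mono (by omega : m+1 ≤ m+2)) ((Sm.const 2).sub S.sm) hg Sm.rr (by simpa using hx) hloc
  rw [S.gr_w, gr_rr] at ht
  rw [S.Hs_w, S.gr_w, Hs_rr] at h2
  refine ⟨-t, by rw [ht]; simp; abel, by rw [h1]; simp, ?_⟩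
  simp only [Matrix.mul_neg, trace_neg, S.L1, Matrix.mulVec_neg, neg_dotProduct, dotProduct_neg, neg_neg, Matrix.mul_one] at h2 ⊢
  refine le_of_eq_of_le ?_ h2
  ring

theorem exp_rr_le (hC : 1 ≤ C) (S : Sol m C u) {x} (hx : u x ≤ 2) : Real.exp (rr x) ≤ Real.exp (C * (2 + C)) := by
  rw [Real.exp_le_exp, rr_norm]
  have := S.sub_bd hC hx
  nlinarith [sq_nonneg ‖x‖]
theorem exp_rr_ge (x : Es n) : 1 ≤ Real.exp (rr x) := by
  rw [Real.one_le_exp_iff, rr_norm]; positivity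

theorem mx_transfer {a e g a0 e0 g0 E M : ℝ} (h : a * e * g ≤ a0 * e0 * g0) (ha : 0 ≤ a * g) (he : 1 ≤ e) (he0 : e0 ≤ E) (hag : a0 * g0 ≤ M) (hM : 0 ≤ M) (he00 : 0 ≤ e0) :
    a * g ≤ E * M := by
  have h1 : a * g ≤ a * e * g := by nlinarith
  have h2 : a0 * e0 * g0 ≤ E * M := by
    calc a0 * e0 * g0 = e0 * (a0 * g0) := by ring
      _ ≤ e0 * M := mul_le_mul_of_nonneg_left hag he00
      _ ≤ E * M := mul_le_mul_of_nonneg_right he0 hM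
  linarith

theorem pow_div_bd {w W D : ℝ} {b m : ℕ} (hw : 0 < w) (hwW : w ≤ W) (hW : 1 ≤ W) (hD : 0 ≤ D) (hmb : m ≤ b) : w^b * (D / w)^m ≤ D^m * W^b := by
  obtain ⟨c, rfl⟩ := Nat.exists_eq_add_of_le hmb
  have : w^(m+c) * (D/w)^m = D^m * w^c := by
    rw [div_pow, pow_add]; field_simp
  rw [this]
  have h1 : w^c ≤ W^c := by gcongr
  have h2 : W^c ≤ W^(m+c) := pow_le_pow_right₀ hW (by omega)
  have : 0 ≤ D^m := by positivity
  nlinarith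

theorem grad_est (n m : ℕ) (C : ℝ) (hC : 1 ≤ C) : ∃ (b : ℕ) (G : ℝ), 0 ≤ G ∧ ∀ u : Es n → ℝ, Sol m C u → ∀ x, u x ≤ 2 → (2 - u x)^(b+2) * gsq u x ≤ G := by
  set ρ := C * (2+C) with hρd
  have hρ : 1 ≤ ρ := by nlinarith
  set W := 2 + C with hWd
  obtain ⟨N, hN⟩ := exists_nat_ge (4 * ρ)
  set b := N + m + 2 with hb
  set β := (b:ℝ) + 2 with hβ
  have hm0 : (0:ℝ) ≤ m := Nat.cast_nonneg m
  have hN0 : (0:ℝ) ≤ N := Nat.cast_nonneg N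
  have hbβ : β = N + m + 4 := by rw [hβ, hb]; push_cast; ring
  set C1 := 2*β*((m:ℝ)+1) + 12 * n * (β + ρ * W) with hC1
  have hW1 : 1 ≤ W := by linarith
  have hβ4 : 4 ≤ β := by linarith
  have hC10 : 0 ≤ C1 := by positivity
  set M := W^(b+2) + W * (2 * (C1^m * W^(b+2)) + W^(b+2) * (W * ρ)) with hM
  have hM0 : 0 ≤ M := by positivity
  refine ⟨b, Real.exp ρ * M, by positivity, fun u S x hx => ?_⟩
  obtain ⟨x0, hx0, hmax⟩ := (S.cpt hC).exists_isMaxOn ⟨x, hx⟩ (f := fun y => (2 - u y)^(b+2) * Real.exp (rr y) * gsq u y)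
    (by
      have h1 := S.sm.cont
      have h2 := S.sm.gsq.cont
      have h3 := (Sm.rr (n := n)).cont
      fun_prop)
  have hmax' : ∀ y, u y ≤ 2 → (2 - u y)^(b+2) * Real.exp (rr y) * gsq u y ≤ (2 - u x0)^(b+2) * Real.exp (rr x0) * gsq u x0 := fun y hy => hmax hy
  have hg0 : ∀ y, 0 ≤ gsq u y := fun y => dot_self_nonneg _
  have hw0 : 0 ≤ 2 - u x := by linarith
  refine mx_transfer (hmax' x hx) (mul_nonneg (pow_nonneg hw0 _) (hg0 x)) (exp_rr_ge x) (exp_rr_le hC S hx0) ?_ hM0 (Real.exp_pos _).le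
  have hwW : 2 - u x0 ≤ W := S.w_bd hC x0
  have hx0' : u x0 ≤ 2 := hx0
  rcases hx0'.eq_or_lt with heq | hlt
  · rw [heq]; simp; exact hM0
  have hw : 0 < 2 - u x0 := by linarith
  have hwb : (2 - u x0)^(b+2) ≤ W^(b+2) := by gcongr
  have hrest : 0 ≤ W * (2 * (C1^m * W^(b+2)) + W^(b+2) * (W * ρ)) := by positivity
  by_cases hg : gsq u x0 < 1
  · have : (2 - u x0)^(b+2) * gsq u x0 ≤ W^(b+2) * 1 := by
      apply mul_le_mul hwb hg.le (hg0 _) (by positivity)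
    linarith
  push_neg at hg
  obtain ⟨T, hT, hgr, htr⟩ := S.mx S.sm.gsq hlt hmax'
  rw [gr_gsq S.sm] at hgr
  have hL := S.L_gsq x0
  have key := grad_alg (S.hV x0) (S.gm x0) (S.eq x0) hw hwW hβ4 (by linarith : 4 * ρ ≤ β) hρ (x := x0) (y := gr u x0) (T := T)
    (by rw [dot_norm]; exact S.sub_bd hC hx0) hT hgr.symm hg ?_
  · have h2 : (2 - u x0)^(b+2) * (gr u x0 ⬝ᵥ gr u x0) ≤ (2 - u x0)^(b+2) * ((2 - u x0) * (2 * (C1 / (2 - u x0))^m + W * ρ)) :=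
      mul_le_mul_of_nonneg_left key (by positivity)
    have h3 := pow_div_bd (b := b+2) (m := m) hw hwW hW1 hC10 (by omega)
    have h4 : (2 - u x0)^(b+2) * (W * ρ) ≤ W^(b+2) * (W * ρ) := by gcongr
    have h5 : (2 - u x0)^(b+2) * ((2 - u x0) * (2 * (C1 / (2 - u x0))^m + W * ρ)) = (2 - u x0) * (2 * ((2 - u x0)^(b+2) * (C1 / (2 - u x0))^m) + (2 - u x0)^(b+2) * (W * ρ)) := by ring
    have h6 : (2 - u x0) * (2 * ((2 - u x0)^(b+2) * (C1 / (2 - u x0))^m) + (2 - u x0)^(b+2) * (W * ρ)) ≤ W * (2 * (C1^m * W^(b+2)) + W^(b+2) * (W * ρ)) := by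
      apply mul_le_mul hwW _ (by positivity) (by positivity)
      linarith
    have h7 : 0 ≤ W^(b+2) := by positivity
    rw [gsq_eq]; linarith
  · have hgp : 0 < gsq u x0 := by linarith
    have := nonpos_of_mul_nonpos_right (by linarith : gsq u x0 * (trace (NT m (Hs u x0)) - ((b:ℝ)+2) * ((m:ℝ)+1) / (2 - u x0) - ((b:ℝ)+2) / (2 - u x0)^2 * (gr u x0 ⬝ᵥ (NT m (Hs u x0) *ᵥ gr u x0)) - T ⬝ᵥ (NT m (Hs u x0) *ᵥ T)) ≤ 0) hgp
    linarith
end P4b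

section P4c
open Matrix
variable {n m : ℕ} {C : ℝ} {u : Es n → ℝ}

theorem unit_mem {q : Fin n → ℝ} (hq : q ⬝ᵥ q = 1) : tv q ∈ Metric.sphere (0 : Es n) 1 := by
  have : ‖tv q‖^2 = 1 := by rw [← dot_norm]; exact hq
  simp only [mem_sphere_zero_iff_norm]
  nlinarith [norm_nonneg (tv q)]

theorem scal_s2 {w β g ρ : ℝ} {b p N : ℕ} (hw : w ≠ 0) (hb : b + 2 = (p + 2) + N + 2) :
    3 * w^(b+2) * (2 * ((β/w)^2 * g) + 2 * ρ) = 6 * β^2 * ((w^(p+2) * g) * w^N) + 6 * ρ * w^(b+2) := by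
  have h1 : w^(b+2) = w^(p+2) * w^N * w^2 := by rw [hb, pow_add, pow_add]
  have h2 : w^2 * (β/w)^2 = β^2 := by field_simp
  calc _ = 6 * (w^(b+2) * (β/w)^2) * g + 6 * ρ * w^(b+2) := by ring
    _ = 6 * (w^(p+2) * w^N * (w^2 * (β/w)^2)) * g + 6 * ρ * w^(b+2) := by rw [h1]; ring
    _ = _ := by rw [h2]; ring

set_option maxHeartbeats 1000000 in
theorem pog_est (n m : ℕ) (C : ℝ) (hC : 1 ≤ C) : ∃ (b : ℕ) (G : ℝ), 0 ≤ G ∧ ∀ u : Es n → ℝ, Sol (m+1) C u → ∀ x, u x ≤ 2 →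
    ∀ q : Fin n → ℝ, q ⬝ᵥ q = 1 → (2 - u x)^(b+2) * (q ⬝ᵥ (Hs u x *ᵥ q)) ≤ G := by
  obtain ⟨p, G, hG, hgrad⟩ := grad_est n (m+1) C hC
  set ρ := C * (2+C) with hρd
  have hρ : 1 ≤ ρ := by nlinarith
  set W := 2 + C with hWd
  obtain ⟨N, hN⟩ := exists_nat_ge (4 * ρ)
  set b := p + 2 + (N + m + 2) with hb
  set β := (b:ℝ) + 2 with hβ
  have hm0 : (0:ℝ) ≤ m := Nat.cast_nonneg m
  have hN0 : (0:ℝ) ≤ N := Nat.cast_nonneg N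
  have hp0 : (0:ℝ) ≤ p := Nat.cast_nonneg p
  have hn0 : (0:ℝ) ≤ n := Nat.cast_nonneg n
  have hbβ : β = p + 2 + N + m + 4 := by rw [hβ, hb]; push_cast; ring
  have hW1 : 1 ≤ W := by linarith
  have hβ4 : 4 ≤ β := by linarith
  set D := 6 * β^2 * (G * W^(N+m+2)) + 6 * ρ * W^(b+2) with hD
  have hD0 : 0 ≤ D := by positivity
  set C1 := 2*β*(((m+1:ℕ):ℝ)+1) + D * W with hC1
  have hC10 : 0 ≤ C1 := by positivity
  set M := 1 + W^(b+2) * (3 * n) + C1^(m+1) * W^(b+2) with hM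
  have hM0 : 0 ≤ M := by positivity
  refine ⟨b, Real.exp ρ * M, by positivity, fun u S x hx q hq => ?_⟩
  by_cases hneg : q ⬝ᵥ (Hs u x *ᵥ q) ≤ 0
  · have : 0 ≤ (2 - u x)^(b+2) := pow_nonneg (by linarith) _
    have h2 : 0 ≤ Real.exp ρ * M := by positivity
    nlinarith
  push Not at hneg
  have hcpt : IsCompact ({x | u x ≤ 2} ×ˢ Metric.sphere (0 : Es n) 1) := (S.cpt hC).prod (isCompact_sphere _ _)
  have hqn : tv q ∈ Metric.sphere (0 : Es n) 1 := unit_mem hq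
  obtain ⟨⟨x0, e0⟩, ⟨hx0, he0⟩, hmax⟩ := hcpt.exists_isMaxOn ⟨(x, tv q), hx, hqn⟩ (f := fun y : Es n × Es n => (2 - u y.1)^(b+2) * Real.exp (rr y.1) * ((y.2 : Fin n → ℝ) ⬝ᵥ (Hs u y.1 *ᵥ (y.2 : Fin n → ℝ))))
    (by
      have h1 := S.sm.cont
      have h3 := (Sm.rr (n := n)).cont
      have h2 : ∀ i j, Continuous (fun y : Es n × Es n => Hs u y.1 i j) := fun i j => (S.sm.Hs i j).cont.comp continuous_fst
      have h4 : Continuous (fun y : Es n × Es n => ((y.2 : Fin n → ℝ) ⬝ᵥ (Hs u y.1 *ᵥ (y.2 : Fin n → ℝ)))) := by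
        simp only [dotProduct, mulVec]
        fun_prop
      fun_prop)
  have hx0' : u x0 ≤ 2 := hx0
  obtain ⟨e, K, hee, hVe, hKm, hM5⟩ := M5 (S.hV x0) (S.gm x0) (S.eq x0)
  have hKe : e ⬝ᵥ (Hs u x0 *ᵥ e) = K := by rw [hVe, dotProduct_smul, hee]; simp
  have he0n : (e0 : Fin n → ℝ) ⬝ᵥ e0 = 1 := by
    rw [dot_norm]; have : ‖e0‖ = 1 := by simpa using he0
    rw [this]; norm_num
  have hpos : ∀ y : Es n, 0 ≤ Real.exp (rr y) := fun y => (Real.exp_pos _).le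
  have hmax' : ∀ y, u y ≤ 2 → ∀ v : Fin n → ℝ, v ⬝ᵥ v = 1 → (2 - u y)^(b+2) * Real.exp (rr y) * (v ⬝ᵥ (Hs u y *ᵥ v)) ≤ (2 - u x0)^(b+2) * Real.exp (rr x0) * K := by
    intro y hy v hv
    have hvn : tv v ∈ Metric.sphere (0 : Es n) 1 := unit_mem hv
    have h1 : (2 - u y)^(b+2) * Real.exp (rr y) * (v ⬝ᵥ (Hs u y *ᵥ v)) ≤ (2 - u x0)^(b+2) * Real.exp (rr x0) * ((e0 : Fin n → ℝ) ⬝ᵥ (Hs u x0 *ᵥ (e0 : Fin n → ℝ))) :=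
      hmax (show (y, tv v) ∈ {x | u x ≤ 2} ×ˢ Metric.sphere (0 : Es n) 1 from ⟨hy, hvn⟩)
    refine h1.trans ?_
    have h2 := hKm e0
    rw [he0n, mul_one] at h2
    exact mul_le_mul_of_nonneg_left h2 (mul_nonneg (pow_nonneg (by linarith) _) (hpos _))
  have hw0 : 0 ≤ 2 - u x := by linarith
  refine mx_transfer (hmax' x hx q hq) (mul_nonneg (pow_nonneg hw0 _) hneg.le) (exp_rr_ge x) (exp_rr_le hC S hx0) ?_ hM0 (Real.exp_pos _).le
  have hwW : 2 - u x0 ≤ W := S.w_bd hC x0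
  rcases hx0'.eq_or_lt with heq | hlt
  · rw [heq]; simp; exact hM0
  have hw : 0 < 2 - u x0 := by linarith
  have hwb : (2 - u x0)^(b+2) ≤ W^(b+2) := by gcongr
  have hr1 : 0 ≤ W^(b+2) * (3 * n) := by positivity
  have hr2 : 0 ≤ C1^(m+1) * W^(b+2) := by positivity
  by_cases hc1 : K < 3 * n
  · have : (2 - u x0)^(b+2) * K ≤ (2 - u x0)^(b+2) * (3 * n) := by gcongr
    have : (2 - u x0)^(b+2) * (3 * n) ≤ W^(b+2) * (3 * n) := by gcongr
    linarith
  by_cases hc2 : (2 - u x0)^(b+2) * K ≤ 1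
  · linarith
  push Not at hc1 hc2
  have hK : 0 < K := by
    by_contra hk
    have : (2 - u x0)^(b+2) * K ≤ 0 := mul_nonpos_of_nonneg_of_nonpos (by positivity) (not_lt.1 hk)
    linarith
  have hge : ∀ y, dv e (dv e u) y = e ⬝ᵥ (Hs u y *ᵥ e) := fun y => dv_dv_Hs S.sm e e y
  obtain ⟨T, hT, hgr, htr⟩ := S.mx (g := dv e (dv e u)) (b := b) ((S.sm.dv e).dv e) hlt (by
    intro y hy
    rw [hge, hge, hKe]
    exact hmax' y hy e hee)
  rw [S.gr_ee, hge, hKe] at hgr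
  rw [hge, hKe] at htr
  have hM6 := hM5 (by simpa using hc1) (Hs (dv e u) x0) (Hs_symm (S.sm.dv e) x0) (S.L2 e x0)
  have hL := S.L3 e x0
  have hgs := hgrad u S x0 hx0'
  have key := pog_alg (B := Hs (dv e u) x0) (S.hV x0) (S.gm x0) (S.eq x0) hw hwW hβ4 (by linarith : 4 * ρ ≤ β) (x := x0) (y := gr u x0) (T := T) (D := D)
    (by rw [dot_norm]; exact S.sub_bd hC hx0) hK hT hgr (Lg := trace (NT (m+1) (Hs u x0) * Hs (dv e (dv e u)) x0)) (by rw [hL, mul_neg, ← neg_mul]; exact hM6) htr hD0 ?_ ⟨e, hee, hKe.symm⟩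
  · have h3 := pow_div_bd (b := b+2) (m := m+1) hw hwW hW1 hC10 (by omega)
    have : (2 - u x0)^(b+2) * K ≤ (2 - u x0)^(b+2) * (C1 / (2 - u x0))^(m+1) := mul_le_mul_of_nonneg_left key (by positivity)
    linarith
  · have hT2 : T ⬝ᵥ T ≤ 2 * ((β/(2 - u x0))^2 * gsq u x0) + 2 * ρ := by
      have := dot_add_sq ((β/(2 - u x0)) • gr u x0) (-(x0 : Fin n → ℝ))
      rw [← sub_eq_add_neg, ← hT] at this
      simp only [smul_dotProduct, dotProduct_smul, smul_eq_mul, neg_dotProduct, dotProduct_neg, neg_neg] at this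
      have h2 : ‖x0‖^2 ≤ ρ := S.sub_bd hC hx0
      rw [dot_norm x0, ← gsq_eq] at this
      calc _ ≤ _ := this
        _ ≤ 2 * (β/(2 - u x0) * (β/(2 - u x0) * gsq u x0)) + 2 * ρ := by linarith
        _ = _ := by ring
    have hg0 : 0 ≤ gsq u x0 := dot_self_nonneg _
    have hKi : 1 / K ≤ (2 - u x0)^(b+2) := by rw [div_le_iff₀ hK]; exact hc2.le
    have hTT : 0 ≤ T ⬝ᵥ T := dot_self_nonneg _
    have s1 : 3 / K * (T ⬝ᵥ T) ≤ 3 * (2 - u x0)^(b+2) * (2 * ((β/(2 - u x0))^2 * gsq u x0) + 2 * ρ) := by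
      have : 3 / K = 3 * (1/K) := by ring
      rw [this]
      gcongr
    refine s1.trans ?_
    have s2 : 3 * (2 - u x0)^(b+2) * (2 * ((β/(2 - u x0))^2 * gsq u x0) + 2 * ρ) = 6 * β^2 * (((2 - u x0)^(p+2) * gsq u x0) * (2 - u x0)^(N+m+2)) + 6 * ρ * (2 - u x0)^(b+2) := by
      exact scal_s2 hw.ne' (by omega)
    rw [s2, hD]
    have hgp : 0 ≤ (2 - u x0)^(p+2) * gsq u x0 := by positivity
    gcongr

theorem Hess_bound_sub (n m : ℕ) (C : ℝ) (hC : 1 ≤ C) : ∃ K : ℝ, 0 ≤ K ∧ ∀ u : Es n → ℝ, Sol m C u → ∀ x, u x ≤ 1 →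
    ∀ q : Fin n → ℝ, q ⬝ᵥ (Hs u x *ᵥ q) ≤ K * (q ⬝ᵥ q) := by
  cases m with
  | zero =>
    refine ⟨1, by norm_num, fun u S x _ q => ?_⟩
    have := B_V_up (S.hV x) (S.gm x) (S.eq x) q
    simpa using this
  | succ m =>
    obtain ⟨b, G, hG, h⟩ := pog_est n m C hC
    refine ⟨G, hG, fun u S x hx q => ?_⟩
    by_cases hq : q ⬝ᵥ q = 0
    · have : q = 0 := dotProduct_self_eq_zero.1 hq
      simp [this]
    have hq0 : 0 < q ⬝ᵥ q := lt_of_le_of_ne (dot_self_nonneg q) (Ne.symm hq)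
    set c := (Real.sqrt (q ⬝ᵥ q))⁻¹ with hc
    have hc2 : c^2 * (q ⬝ᵥ q) = 1 := by
      rw [hc, inv_pow, Real.sq_sqrt hq0.le]; field_simp
    have h1 := h u S x (by linarith) (c • q) (by
      simp only [smul_dotProduct, dotProduct_smul, smul_eq_mul]; rw [← hc2]; ring)
    rw [quad_smul'] at h1
    have hw : 1 ≤ (2 - u x)^(b+2) := one_le_pow₀ (by linarith)
    have h2 : c^2 * (q ⬝ᵥ (Hs u x *ᵥ q)) ≤ G := by
      by_cases h0 : c^2 * (q ⬝ᵥ (Hs u x *ᵥ q)) ≤ 0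
      · linarith
      · push Not at h0
        nlinarith
    have h3 := mul_le_mul_of_nonneg_right h2 hq0.le
    calc _ = (c^2 * (q ⬝ᵥ q)) * (q ⬝ᵥ (Hs u x *ᵥ q)) := by rw [hc2, one_mul]
      _ = c^2 * (q ⬝ᵥ (Hs u x *ᵥ q)) * (q ⬝ᵥ q) := by ring
      _ ≤ _ := h3

theorem dv_scale {f : Es n → ℝ} (hf : Sm f) (R c : ℝ) (q) : dv q (fun y => c * f (R • y)) = fun y => (c * R) * dv q f (R • y) := by
  funext y
  have hs : Sm (fun y => c * f (R • y)) := (Sm.const c).mul (by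
    have h1 : ContDiff ℝ (⊤ : ℕ∞) (fun y : Es n => R • y) := by fun_prop
    exact ContDiff.comp hf h1)
  apply dv_of_line hs
  have h1 : HasDerivAt (fun s : ℝ => R • (y + s • tv q)) (R • tv q) 0 := by
    have : HasDerivAt (fun s : ℝ => y + s • tv q) (tv q) 0 := by
      simpa using ((hasDerivAt_id (0:ℝ)).smul_const (tv q)).const_add y
    exact this.const_smul R
  have h2 : HasFDerivAt f (fderiv ℝ f (R • y)) (R • (y + (0:ℝ) • tv q)) := by simpa using (hf.diffAt (R • y)).hasFDerivAt
  have h3 := (h2.comp_hasDerivAt (0:ℝ) h1).const_mul c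
  refine h3.congr_deriv ?_
  rw [map_smul, smul_eq_mul, dv]; ring

theorem Sm.scale {f : Es n → ℝ} (hf : Sm f) (R c : ℝ) : Sm (fun y => c * f (R • y)) := (Sm.const c).mul (by
    have h1 : ContDiff ℝ (⊤ : ℕ∞) (fun y : Es n => R • y) := by fun_prop
    exact ContDiff.comp hf h1)

theorem Hs_scale {f : Es n → ℝ} (hf : Sm f) {R : ℝ} (hR : R ≠ 0) (y) : Hs (fun y => (R^2)⁻¹ * f (R • y)) y = Hs f (R • y) := by
  ext i j
  rw [Hs_ap, dv_scale hf, dv_scale (hf.dv _), Hs_ap]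
  simp only []
  field_simp

theorem Sol.scale (hC : 1 ≤ C) (S : Sol m C u) {R : ℝ} (hR : 1 ≤ R) : Sol m C (fun y => (R^2)⁻¹ * u (R • y)) where
  sm := S.sm.scale _ _
  gm x := by rw [Hs_scale S.sm (by linarith)]; exact S.gm _
  eq x := by rw [Hs_scale S.sm (by linarith)]; exact S.eq _
  gw x := by
    have h := S.gw (R • x)
    rw [norm_smul, Real.norm_of_nonneg (by linarith), mul_pow] at h
    have hR2 : 1 ≤ R^2 := one_le_pow₀ hR
    rw [le_inv_mul_iff₀ (by linarith)]
    have : R^2 * C ≥ C := by nlinarith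
    nlinarith

theorem Hess_bound (hC : 1 ≤ C) (S : Sol m C u) : ∃ K : ℝ, 0 ≤ K ∧ ∀ x, ∀ q : Fin n → ℝ, q ⬝ᵥ (Hs u x *ᵥ q) ≤ K * (q ⬝ᵥ q) := by
  obtain ⟨K, hK, h⟩ := Hess_bound_sub n m C hC
  refine ⟨K, hK, fun x q => ?_⟩
  set R := 1 + |u x| with hR
  have hR1 : 1 ≤ R := by rw [hR]; linarith [abs_nonneg (u x)]
  have h1 := h _ (S.scale hC hR1) (R⁻¹ • x) (by
    rw [smul_smul, mul_inv_cancel₀ (by linarith), one_smul]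
    rw [inv_mul_le_iff₀ (by positivity)]
    nlinarith [le_abs_self (u x)]) q
  rw [Hs_scale S.sm (by linarith), smul_smul, mul_inv_cancel₀ (by linarith), one_smul] at h1
  exact h1
end P4c

section P5
open Matrix MeasureTheory
variable {n : ℕ}

theorem gr_comp {f : Es n → ℝ} (hf : Sm f) {φ φ' : ℝ → ℝ} {x : Es n} (hφ : HasDerivAt φ (φ' (f x)) (f x)) :
    gr (fun x => φ (f x)) x = φ' (f x) • gr f x := by
  ext i; rw [gr_ap, dv_comp hf _ hφ]; rfl

theorem Hs_comp {f : Es n → ℝ} (hf : Sm f) {φ φ' φ'' : ℝ → ℝ} (hφ : ∀ x, HasDerivAt φ (φ' (f x)) (f x))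
    (hφ' : ∀ x, HasDerivAt φ' (φ'' (f x)) (f x)) (hs : Sm (fun x => φ' (f x))) (x) :
    Hs (fun x => φ (f x)) x = φ' (f x) • Hs f x + φ'' (f x) • vecMulVec (gr f x) (gr f x) := by
  ext i j
  rw [Hs_ap]
  have h1 : dv (Pi.single j 1) (fun x => φ (f x)) = fun x => φ' (f x) * dv (Pi.single j 1) f x := by
    funext y; exact dv_comp hf _ (hφ y)
  rw [h1, dv_mul hs (hf.dv _)]
  simp only []
  rw [dv_comp hf _ (hφ' x)]
  simp [vecMulVec_apply, Hs_ap, gr_ap]; ring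

structure Ell (lam Lam : ℝ) (a : Es n → Matrix (Fin n) (Fin n) ℝ) : Prop where
  sm : ∀ i j, Sm (fun x => a x i j)
  sy : ∀ x, (a x)ᵀ = a x
  dz : ∀ j x, ∑ i, dd i (fun x => a x i j) x = 0
  lo : ∀ x v, lam * (v ⬝ᵥ v) ≤ v ⬝ᵥ (a x *ᵥ v)
  up : ∀ x v, v ⬝ᵥ (a x *ᵥ v) ≤ Lam * (v ⬝ᵥ v)

/-- subsolution of logarithmic type -/
structure LogSub (a : Es n → Matrix (Fin n) (Fin n) ℝ) (g : Es n → ℝ) : Prop where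
  sm : Sm g
  one : ∀ x, 1 ≤ g x
  ineq : ∀ x, gr g x ⬝ᵥ (a x *ᵥ gr g x) ≤ trace (a x * Hs g x)

theorem trace_comp {a : Matrix (Fin n) (Fin n) ℝ} {H : Matrix (Fin n) (Fin n) ℝ} {p : Fin n → ℝ} (s t : ℝ) :
    trace (a * (s • H + t • vecMulVec p p)) = s * trace (a * H) + t * (p ⬝ᵥ (a *ᵥ p)) := by
  rw [Matrix.mul_add, trace_add, Matrix.mul_smul, Matrix.mul_smul, trace_smul, trace_smul, trace_outer]; rfl

theorem Sm.rpow {g : Es n → ℝ} (hg : Sm g) (h0 : ∀ x, 0 < g x) (q : ℝ) : Sm (fun x => g x ^ q) :=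
  ContDiff.rpow_const_of_ne hg (fun x => (h0 x).ne')

theorem Sm.log {g : Es n → ℝ} (hg : Sm g) (h0 : ∀ x, 0 < g x) : Sm (fun x => Real.log (g x)) :=
  ContDiff.log hg (fun x => (h0 x).ne')

theorem rpow_sub {lam Lam : ℝ} (hl : 0 ≤ lam) {a : Es n → Matrix (Fin n) (Fin n) ℝ} (A : Ell lam Lam a) {g : Es n → ℝ} (G : LogSub a g)
    {q : ℝ} (hq : 0 < q) (x) : 0 ≤ trace (a x * Hs (fun x => g x ^ q) x) := by
  have h0 : ∀ x, 0 < g x := fun x => by linarith [G.one x]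
  have hq0 : 0 ≤ gr g x ⬝ᵥ (a x *ᵥ gr g x) := le_trans (mul_nonneg hl (dot_self_nonneg _)) (A.lo x _)
  rw [Hs_comp G.sm (φ := fun t => t ^ q) (φ' := fun t => q * t ^ (q-1)) (φ'' := fun t => q * ((q-1) * t ^ (q-1-1)))
    (fun x => Real.hasDerivAt_rpow_const (Or.inl (h0 x).ne'))
    (fun x => (Real.hasDerivAt_rpow_const (Or.inl (h0 x).ne')).const_mul q)
    ((Sm.const q).mul (G.sm.rpow h0 _)), trace_comp]
  have h1 : g x ^ (q-1) = g x ^ (q-1-1) * g x := by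
    conv_rhs => rw [← Real.rpow_one (g x), ← Real.rpow_mul (h0 x).le, one_mul, ← Real.rpow_add (h0 x)]
    congr 1; ring
  rw [h1]
  have h2 : 0 < g x ^ (q-1-1) := Real.rpow_pos_of_pos (h0 x) _
  have h3 := G.ineq x
  have h4 : 0 ≤ q * (g x ^ (q-1-1) * g x) := by have := h0 x; positivity
  have h5 := mul_le_mul_of_nonneg_left h3 h4
  have h6 : 0 ≤ (q * g x ^ (q-1-1)) * ((g x + q - 1) * (gr g x ⬝ᵥ (a x *ᵥ gr g x))) := by
    apply mul_nonneg (by positivity) (mul_nonneg (by linarith [G.one x]) hq0)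
  nlinarith

theorem log_sub {lam Lam : ℝ} (hl : 0 ≤ lam) {a : Es n → Matrix (Fin n) (Fin n) ℝ} (A : Ell lam Lam a) {z : Es n → ℝ} (hz : Sm z)
    {M0 δ : ℝ} (hδ : 0 < δ) (hδ1 : δ ≤ 1) (h0 : ∀ x, 0 ≤ z x) (h1 : ∀ x, z x ≤ M0)
    (hL : ∀ x, trace (a x * Hs z x) ≤ 0) : LogSub a (fun x => 1 + Real.log (M0 + 1) - Real.log (z x + δ)) := by
  have hp : ∀ x, 0 < z x + δ := fun x => by linarith [h0 x]
  have hzs : Sm (fun x => z x + δ) := hz.add (Sm.const _)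
  have e : (fun x => 1 + Real.log (M0 + 1) - Real.log (z x + δ)) = fun x => (fun t => 1 + Real.log (M0 + 1) - Real.log (t + δ)) (z x) := rfl
  have d1 : ∀ x, HasDerivAt (fun t => 1 + Real.log (M0 + 1) - Real.log (t + δ)) ((fun t => -(t+δ)⁻¹) (z x)) (z x) := fun x => by
    have := ((hasDerivAt_id (z x)).add_const δ).log (hp x).ne'
    have := this.const_sub (1 + Real.log (M0 + 1))
    simpa using this
  have d2 : ∀ x, HasDerivAt (fun t => -(t+δ)⁻¹) ((fun t => ((t+δ)^2)⁻¹) (z x)) (z x) := fun x => by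
    have := (((hasDerivAt_id (z x)).add_const δ).inv (hp x).ne').neg
    refine this.congr_deriv ?_
    simp [neg_div]
  have s2 : Sm (fun x => -(z x + δ)⁻¹) := ContDiff.neg (ContDiff.inv hzs (fun x => (hp x).ne'))
  refine ⟨(Sm.const _).sub (hzs.log hp), fun x => ?_, fun x => ?_⟩
  · have := Real.log_le_log (hp x) (by linarith [h1 x] : z x + δ ≤ M0 + 1)
    linarith
  · have E1 := Hs_comp (φ := fun t => 1 + Real.log (M0 + 1) - Real.log (t + δ)) (φ' := fun t => -(t+δ)⁻¹) (φ'' := fun t => ((t+δ)^2)⁻¹) hz d1 d2 s2 x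
    have E2 := gr_comp (φ := fun t => 1 + Real.log (M0 + 1) - Real.log (t + δ)) (φ' := fun t => -(t+δ)⁻¹) hz (d1 x)
    rw [E1, E2, trace_comp]
    simp only [mulVec_smul, dotProduct_smul, smul_dotProduct, smul_eq_mul]
    have := mul_nonneg (inv_pos.2 (hp x)).le (sub_nonneg.2 (hL x))
    rw [← inv_pow]
    nlinarith
end P5

section P5b
open Matrix MeasureTheory
variable {n : ℕ}

def Zr (ρ : ℝ) (f : Es n → ℝ) : Prop := ∀ x, ρ < ‖x‖ → f x = 0

theorem Zr.mul {ρ : ℝ} {f : Es n → ℝ} (h : Zr ρ f) (g : Es n → ℝ) : Zr ρ (fun x => f x * g x) := fun x hx => by simp only [h x hx, zero_mul]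
theorem Zr.dv {ρ : ℝ} {f : Es n → ℝ} (h : Zr ρ f) (v) : Zr ρ (dv v f) := fun x hx => by
  have : f =ᶠ[nhds x] fun _ => 0 := by
    filter_upwards [(isOpen_lt continuous_const continuous_norm).mem_nhds hx] with y hy
    exact h y hy
  rw [_root_.dv, this.fderiv_eq]; simp
theorem Zr.gr {ρ : ℝ} {f : Es n → ℝ} (h : Zr ρ f) {x} (hx : ρ < ‖x‖) : gr f x = 0 := by
  ext i; exact h.dv _ x hx
theorem Zr.cs {ρ : ℝ} {f : Es n → ℝ} (h : Zr ρ f) : HasCompactSupport f := by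
  apply HasCompactSupport.intro (isCompact_closedBall (0 : Es n) ρ)
  intro x hx
  apply h; simpa using hx
theorem Zr.int {ρ : ℝ} {f : Es n → ℝ} (h : Zr ρ f) (hc : Continuous f) : Integrable f :=
  hc.integrable_of_hasCompactSupport h.cs

theorem ibp0 {ρ : ℝ} {F : Es n → ℝ} (h : Zr ρ F) (hF : Sm F) (v) : ∫ x, dv v F x = 0 := by
  have := integral_mul_fderiv_eq_neg_fderiv_mul_of_integrable (μ := (volume : Measure (Es n))) (𝕜 := ℝ) (f := fun _ => (1:ℝ)) (g := F) (v := tv v)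
    (by simp) (by simpa using show Integrable (fun x => fderiv ℝ F x (tv v)) (volume : Measure (Es n)) from (h.dv v).int (hF.dv v).cont) (by simpa using h.int hF.cont) (fun x _ => by simp) (fun x _ => hF.diffAt x)
  simpa [dv] using this

theorem Sm.bil {a : Es n → Matrix (Fin n) (Fin n) ℝ} (ha : ∀ i j, Sm (fun x => a x i j)) {f h : Es n → ℝ} (hf : Sm f) (hh : Sm h) :
    Sm (fun x => gr f x ⬝ᵥ (a x *ᵥ gr h x)) := by
  have : Sm (fun x => ∑ i, _root_.dv (Pi.single i 1) f x * ∑ j, a x i j * _root_.dv (Pi.single j 1) h x) :=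
    Sm.sum fun i _ => (hf.dv _).mul (Sm.sum fun j _ => (ha i j).mul (hh.dv _))
  exact this

theorem Sm.Lop {a : Es n → Matrix (Fin n) (Fin n) ℝ} (ha : ∀ i j, Sm (fun x => a x i j)) {h : Es n → ℝ} (hh : Sm h) :
    Sm (fun x => trace (a x * _root_.Hs h x)) := by
  have : Sm (fun x => ∑ i, ∑ j, a x i j * _root_.Hs h x j i) :=
    Sm.sum fun i _ => (Sm.sum fun j _ => (ha i j).mul (hh.Hs j i))
  exact this

theorem Sm.gg {f : Es n → ℝ} (hf : Sm f) : Sm (fun x => gr f x ⬝ᵥ gr f x) := by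
  have : Sm (fun x => ∑ i, _root_.dv (Pi.single i 1) f x * _root_.dv (Pi.single i 1) f x) :=
    Sm.sum fun i _ => (hf.dv _).mul (hf.dv _)
  exact this

variable {lam Lam : ℝ} {a : Es n → Matrix (Fin n) (Fin n) ℝ} (A : Ell lam Lam a)
include A

theorem ibp {ρ : ℝ} {ψ h : Es n → ℝ} (hz : Zr ρ ψ) (hψ : Sm ψ) (hh : Sm h) :
    ∫ x, (gr ψ x ⬝ᵥ (a x *ᵥ gr h x) + ψ x * trace (a x * Hs h x)) = 0 := by
  have hX : ∀ i, Sm (fun x => ∑ j, a x i j * dv (Pi.single j 1) h x) := fun i => Sm.sum fun j _ => (A.sm i j).mul (hh.dv _)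
  have hP : ∀ i, Sm (fun x => ψ x * ∑ j, a x i j * dv (Pi.single j 1) h x) := fun i => hψ.mul (hX i)
  have e : (fun x => gr ψ x ⬝ᵥ (a x *ᵥ gr h x) + ψ x * trace (a x * Hs h x)) =
      fun x => ∑ i, dv (Pi.single i 1) (fun x => ψ x * ∑ j, a x i j * dv (Pi.single j 1) h x) x := by
    funext x
    have e1 : ∀ i, dv (Pi.single i 1) (fun x => ψ x * ∑ j, a x i j * dv (Pi.single j 1) h x) x =
        ψ x * (∑ j, (a x i j * Hs h x i j + dv (Pi.single j 1) h x * dv (Pi.single i 1) (fun x => a x i j) x)) +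
        gr ψ x i * (a x *ᵥ gr h x) i := by
      intro i
      rw [dv_mul hψ (hX i)]
      simp only []
      rw [dv_sum _ (fun j _ => (A.sm i j).mul (hh.dv _))]
      simp only [dv_mul (A.sm i _) (hh.dv _)]
      rw [mul_comm _ (dv (Pi.single i 1) ψ x)]; rfl
    simp only [e1]
    rw [Finset.sum_add_distrib, ← Finset.mul_sum]
    simp only [Finset.sum_add_distrib]
    have e2 : ∑ i, ∑ j, dv (Pi.single j 1) h x * dv (Pi.single i 1) (fun x => a x i j) x = 0 := by
      rw [Finset.sum_comm]
      apply Finset.sum_eq_zero; intro j _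
      rw [← Finset.mul_sum]
      have := A.dz j x
      rw [show (∑ i, dv (Pi.single i 1) (fun x => a x i j) x) = 0 from this, mul_zero]
    rw [e2, add_zero, add_comm]
    congr 1
    congr 1
    rw [trace]
    apply Finset.sum_congr rfl; intro i _
    rw [diag_apply, mul_apply]
    apply Finset.sum_congr rfl; intro j _
    rw [show Hs h x j i = Hs h x i j from (Hs_symm hh x).apply i j]
  rw [e, integral_finset_sum _ (fun i _ => ((hz.mul _).dv _).int ((hP i).dv _).cont)]
  apply Finset.sum_eq_zero; intro i _
  exact ibp0 (hz.mul _) (hP i) _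

theorem Ell.bil_symm (x) (p q : Fin n → ℝ) : p ⬝ᵥ (a x *ᵥ q) = q ⬝ᵥ (a x *ᵥ p) := by
  conv_lhs => rw [← A.sy x, mulVec_transpose, dotProduct_comm, ← dotProduct_mulVec]

theorem Ell.cs (hl : 0 ≤ lam) (x) (s t : ℝ) (p q : Fin n → ℝ) : 0 ≤ s^2 * (p ⬝ᵥ (a x *ᵥ p)) + 2 * s * t * (p ⬝ᵥ (a x *ᵥ q)) + t^2 * (q ⬝ᵥ (a x *ᵥ q)) := by
  have h1 := le_trans (mul_nonneg hl (dot_self_nonneg _)) (A.lo x (s • p + t • q))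
  simp only [mulVec_add, mulVec_smul, dotProduct_add, add_dotProduct, dotProduct_smul, smul_dotProduct, smul_eq_mul] at h1
  rw [A.bil_symm x q p] at h1
  nlinarith

theorem cacc (hl : 0 < lam) {ρ : ℝ} {φ h : Es n → ℝ} (hz : Zr ρ φ) (hφ : Sm φ) (hh : Sm h) (h0 : ∀ x, 0 ≤ h x)
    (hL : ∀ x, 0 ≤ trace (a x * Hs h x)) :
    lam * ∫ x, φ x^2 * (gr h x ⬝ᵥ gr h x) ≤ 4 * Lam * ∫ x, h x^2 * (gr φ x ⬝ᵥ gr φ x) := by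
  have hψ : Sm (fun x => φ x * (φ x * h x)) := hφ.mul (hφ.mul hh)
  have e := ibp A (hz.mul (fun x => φ x * h x)) hψ hh
  have i1 : Integrable (fun x => gr (fun x => φ x * (φ x * h x)) x ⬝ᵥ (a x *ᵥ gr h x) + φ x * (φ x * h x) * trace (a x * Hs h x)) := by
    refine Zr.int (ρ := ρ) (fun x hx => ?_) ((Sm.bil A.sm hψ hh).add (hψ.mul (Sm.Lop A.sm hh))).cont
    rw [(hz.mul (fun x => φ x * h x)).gr hx, hz x hx]; simp
  have i2 : Integrable (fun x => φ x^2 * (gr h x ⬝ᵥ gr h x)) := by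
    refine Zr.int (ρ := ρ) (fun x hx => ?_) ((hφ.pow 2).mul hh.gg).cont
    rw [hz x hx]; simp
  have i3 : Integrable (fun x => h x^2 * (gr φ x ⬝ᵥ gr φ x)) := by
    refine Zr.int (ρ := ρ) (fun x hx => ?_) ((hh.pow 2).mul hφ.gg).cont
    rw [hz.gr hx]; simp
  have key : ∀ x, lam * (φ x^2 * (gr h x ⬝ᵥ gr h x)) - 4 * Lam * (h x^2 * (gr φ x ⬝ᵥ gr φ x)) ≤
      2 * (gr (fun x => φ x * (φ x * h x)) x ⬝ᵥ (a x *ᵥ gr h x) + φ x * (φ x * h x) * trace (a x * Hs h x)) := by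
    intro x
    rw [gr_mul hφ (hφ.mul hh), gr_mul hφ hh]
    simp only [smul_add, add_dotProduct, smul_dotProduct, smul_eq_mul]
    have c1 := A.cs hl.le x (φ x) (2 * h x) (gr h x) (gr φ x)
    rw [A.bil_symm x (gr h x) (gr φ x)] at c1
    have c2 := mul_nonneg (mul_nonneg (mul_self_nonneg (φ x)) (h0 x)) (hL x)
    have c3 := mul_le_mul_of_nonneg_left (A.lo x (gr h x)) (sq_nonneg (φ x))
    have c4 := mul_le_mul_of_nonneg_left (A.up x (gr φ x)) (sq_nonneg (h x))
    nlinarith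
  have := integral_mono ((i2.const_mul lam).sub (i3.const_mul (4*Lam))) (i1.const_mul 2) key
  simp only [Pi.sub_apply] at this
  rw [integral_const_mul, e, integral_sub (i2.const_mul lam) (i3.const_mul (4*Lam)), integral_const_mul, integral_const_mul] at this
  linarith

theorem cacc_log (hl : 0 < lam) {ρ : ℝ} {φ g : Es n → ℝ} (hz : Zr ρ φ) (hφ : Sm φ) (G : LogSub a g) :
    lam * ∫ x, φ x^2 * (gr g x ⬝ᵥ gr g x) ≤ 4 * Lam * ∫ x, (gr φ x ⬝ᵥ gr φ x) := by
  have hg := G.sm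
  have hψ : Sm (fun x => φ x * φ x) := hφ.mul hφ
  have e := ibp A (hz.mul (fun x => φ x)) hψ hg
  have i1 : Integrable (fun x => gr (fun x => φ x * φ x) x ⬝ᵥ (a x *ᵥ gr g x) + φ x * φ x * trace (a x * Hs g x)) := by
    refine Zr.int (ρ := ρ) (fun x hx => ?_) ((Sm.bil A.sm hψ hg).add (hψ.mul (Sm.Lop A.sm hg))).cont
    rw [(hz.mul (fun x => φ x)).gr hx, hz x hx]; simp
  have i2 : Integrable (fun x => φ x^2 * (gr g x ⬝ᵥ gr g x)) := by
    refine Zr.int (ρ := ρ) (fun x hx => ?_) ((hφ.pow 2).mul hg.gg).cont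
    rw [hz x hx]; simp
  have i3 : Integrable (fun x => (gr φ x ⬝ᵥ gr φ x)) := by
    refine Zr.int (ρ := ρ) (fun x hx => ?_) hφ.gg.cont
    rw [hz.gr hx]; simp
  have key : ∀ x, lam * (φ x^2 * (gr g x ⬝ᵥ gr g x)) - 4 * Lam * ((gr φ x ⬝ᵥ gr φ x)) ≤
      2 * (gr (fun x => φ x * φ x) x ⬝ᵥ (a x *ᵥ gr g x) + φ x * φ x * trace (a x * Hs g x)) := by
    intro x
    rw [gr_mul hφ hφ]
    simp only [smul_add, add_dotProduct, smul_dotProduct, smul_eq_mul]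
    have c1 := A.cs hl.le x (φ x) 2 (gr g x) (gr φ x)
    rw [A.bil_symm x (gr g x) (gr φ x)] at c1
    have c2 := mul_nonneg (mul_self_nonneg (φ x)) (sub_nonneg.2 (G.ineq x))
    have c3 := mul_le_mul_of_nonneg_left (A.lo x (gr g x)) (sq_nonneg (φ x))
    have c4 := A.up x (gr φ x)
    nlinarith
  have := integral_mono ((i2.const_mul lam).sub (i3.const_mul (4*Lam))) (i1.const_mul 2) key
  simp only [Pi.sub_apply] at this
  rw [integral_const_mul, e, integral_sub (i2.const_mul lam) (i3.const_mul (4*Lam)), integral_const_mul, integral_const_mul] at this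
  linarith
end P5b

section P5c
open Matrix MeasureTheory
variable {n : ℕ}

theorem smtr_bound : ∃ T : ℝ, 0 < T ∧ ∀ t, |deriv Real.smoothTransition t| ≤ T := by
  have hc : Continuous (deriv Real.smoothTransition) := (Real.smoothTransition.contDiff (n := 1)).continuous_deriv (le_refl _)
  obtain ⟨T, hT⟩ := (isCompact_Icc (a := (0:ℝ)) (b := 1)).exists_bound_of_continuousOn hc.continuousOn
  refine ⟨max T 1, by positivity, fun t => ?_⟩
  by_cases h : t ∈ Set.Icc (0:ℝ) 1
  · exact le_trans (hT t h) (le_max_left _ _)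
  · have : deriv Real.smoothTransition t = 0 := by
      rw [Set.mem_Icc, not_and_or, not_le, not_le] at h
      rcases h with h | h
      · have : Real.smoothTransition =ᶠ[nhds t] fun _ => 0 := by
          filter_upwards [Iio_mem_nhds h] with y hy using Real.smoothTransition.zero_of_nonpos (le_of_lt hy)
        rw [this.deriv_eq]; simp
      · have : Real.smoothTransition =ᶠ[nhds t] fun _ => 1 := by
          filter_upwards [Ioi_mem_nhds h] with y hy using Real.smoothTransition.one_of_one_le (le_of_lt hy)
        rw [this.deriv_eq]; simp
    rw [this]; simp

structure Cut (r ρ s : ℝ) (φ : Es n → ℝ) : Prop where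
  sm : Sm φ
  zr : Zr ρ φ
  nn : ∀ x, 0 ≤ φ x
  le : ∀ x, φ x ≤ 1
  one : ∀ x, ‖x‖ ≤ r → φ x = 1
  gb : ∀ x, gr φ x ⬝ᵥ gr φ x ≤ s^2

theorem cut_exists (n : ℕ) : ∃ T : ℝ, 0 < T ∧ ∀ r ρ : ℝ, 0 < r → r < ρ → ∃ φ : Es n → ℝ, Cut r ρ (T / (ρ - r)) φ := by
  obtain ⟨T, hT, hb⟩ := smtr_bound
  refine ⟨2 * T, by positivity, fun r ρ hr hrρ => ?_⟩
  have hd : 0 < ρ^2 - r^2 := by nlinarith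
  set f : Es n → ℝ := fun x => (ρ^2 - r^2)⁻¹ * (ρ^2 - 2 * rr x) with hf
  have hs : Sm f := (Sm.const _).mul ((Sm.const _).sub ((Sm.const _).mul Sm.rr))
  have fe : ∀ x, f x = (ρ^2 - r^2)⁻¹ * (ρ^2 - ‖x‖^2) := fun x => by rw [hf]; simp only [rr_norm]; ring
  have hz : Zr ρ (fun x => Real.smoothTransition (f x)) := fun x hx => by
    apply Real.smoothTransition.zero_of_nonpos
    rw [fe]
    apply mul_nonpos_of_nonneg_of_nonpos (by positivity)
    nlinarith
  refine ⟨fun x => Real.smoothTransition (f x), ?_, hz, fun x => Real.smoothTransition.nonneg _, fun x => Real.smoothTransition.le_one _, fun x hx => ?_, fun x => ?_⟩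
  · exact ContDiff.comp (Real.smoothTransition.contDiff (n := ⊤)) hs
  · apply Real.smoothTransition.one_of_one_le
    rw [fe, le_inv_mul_iff₀ hd]
    nlinarith [norm_nonneg x]
  · by_cases hx : ρ < ‖x‖
    · rw [hz.gr hx]; simp; positivity
    · push Not at hx
      rw [gr_comp hs (φ := Real.smoothTransition) (φ' := deriv Real.smoothTransition)
        (((Real.smoothTransition.contDiff (n := 1)).differentiable (by simp)) _).hasDerivAt]
      have e : gr f x = (-(2 * (ρ^2 - r^2)⁻¹)) • (x : Fin n → ℝ) := by
        rw [hf, gr_cmul _ ((Sm.const _).sub ((Sm.const _).mul Sm.rr)), gr_sub (Sm.const _) ((Sm.const _).mul Sm.rr), gr_cmul _ Sm.rr, gr_const, gr_rr]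
        ext i; simp; ring
      rw [e]
      simp only [smul_dotProduct, dotProduct_smul, smul_eq_mul, dot_norm x]
      have h1 := hb (f x)
      have h2 : (deriv Real.smoothTransition (f x))^2 ≤ T^2 := sq_le_sq' (by linarith [abs_le.1 h1]) (abs_le.1 h1).2
      have h3 : ‖x‖^2 ≤ ρ^2 := by gcongr
      have h4 : (2 * (ρ^2 - r^2)⁻¹ * ρ) ≤ 2 / (ρ - r) := by
        rw [mul_assoc, div_eq_mul_inv]
        gcongr
        rw [inv_mul_le_iff₀ hd, ← div_eq_mul_inv, le_div_iff₀ (by linarith)]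
        nlinarith
      have h5 : 0 ≤ 2 * (ρ^2 - r^2)⁻¹ * ρ := by have : 0 < ρ := by linarith
                                                positivity
      calc _ = (deriv Real.smoothTransition (f x))^2 * ((2 * (ρ^2 - r^2)⁻¹)^2 * ‖x‖^2) := by ring
        _ ≤ T^2 * ((2 * (ρ^2 - r^2)⁻¹)^2 * ρ^2) := by gcongr
        _ = T^2 * (2 * (ρ^2 - r^2)⁻¹ * ρ)^2 := by ring
        _ ≤ T^2 * (2 / (ρ - r))^2 := by gcongr
        _ = _ := by ring

theorem fd_norm (f : Es n → ℝ) (x) {c : ℝ} (hc : 0 ≤ c) (h : gr f x ⬝ᵥ gr f x ≤ c^2) : ‖fderiv ℝ f x‖ ≤ c := by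
  apply ContinuousLinearMap.opNorm_le_bound _ hc
  intro v
  have e : fderiv ℝ f x v = (v : Fin n → ℝ) ⬝ᵥ gr f x := by rw [← dv_gr]; rfl
  rw [e, Real.norm_eq_abs]
  apply abs_le_of_sq_le_sq _ (by positivity)
  have h1 : ((v : Fin n → ℝ) ⬝ᵥ gr f x)^2 ≤ ((v : Fin n → ℝ) ⬝ᵥ v) * (gr f x ⬝ᵥ gr f x) := by
    have := Finset.sum_mul_sq_le_sq_mul_sq Finset.univ (v : Fin n → ℝ) (gr f x)
    simpa [dotProduct, sq] using this
  rw [dot_norm v] at h1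
  calc _ ≤ _ := h1
    _ ≤ ‖v‖^2 * c^2 := by gcongr
    _ = _ := by ring
end P5c

section P5d
open Matrix MeasureTheory
variable {n : ℕ}

theorem sob_real (hn : 2 ≤ n) {χ : ℝ} (hχ : Real.HolderConjugate n χ) : ∃ C0 : ℝ, 0 < C0 ∧ ∀ (F Q : Es n → ℝ) (ρ r : ℝ), Sm F → Zr ρ F → (∀ x, 0 ≤ F x) →
    Integrable Q → (∀ x, ‖fderiv ℝ F x‖ ≤ Q x) →
    ∫ x in Metric.closedBall (0 : Es n) r, F x ^ χ ≤ C0 * (∫ x, Q x)^χ := by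
  refine ⟨(lintegralPowLePowLIntegralFDerivConst (volume : Measure (Es n)) χ : ℝ) + 1, by positivity, fun F Q ρ r hF hz h0 hQ hb => ?_⟩
  have hχ0 : 0 < χ := hχ.symm.pos
  have hfr : Module.finrank ℝ (Es n) = n := by simp
  have h1 := lintegral_pow_le_pow_lintegral_fderiv (volume : Measure (Es n)) (ContDiff.of_le hF (by simp)) hz.cs (p := χ) (by rw [hfr]; exact hχ)
  have hQ0 : ∀ x, 0 ≤ Q x := fun x => le_trans (norm_nonneg _) (hb x)
  have h2 : ∫⁻ x, ‖fderiv ℝ F x‖ₑ ≤ ENNReal.ofReal (∫ x, Q x) := by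
    rw [ofReal_integral_eq_lintegral_ofReal hQ (Filter.Eventually.of_forall hQ0)]
    apply lintegral_mono; intro x
    show ‖fderiv ℝ F x‖ₑ ≤ ENNReal.ofReal (Q x)
    rw [← ofReal_norm]
    exact ENNReal.ofReal_le_ofReal (hb x)
  have hc : Continuous (fun x => F x ^ χ) := hF.cont.rpow_const (fun x => Or.inr hχ0.le)
  have h3 : ENNReal.ofReal (∫ x in Metric.closedBall (0 : Es n) r, F x ^ χ) ≤ ∫⁻ x, ‖F x‖ₑ ^ χ := by
    rw [ofReal_integral_eq_lintegral_ofReal (hc.continuousOn.integrableOn_compact (isCompact_closedBall _ _)) (Filter.Eventually.of_forall fun x => Real.rpow_nonneg (h0 x) _)]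
    refine le_trans (setLIntegral_le_lintegral _ _) ?_
    apply lintegral_mono; intro x
    simp only []
    rw [← ofReal_norm, Real.norm_of_nonneg (h0 x), ENNReal.ofReal_rpow_of_nonneg (h0 x) hχ0.le]
  have hI : 0 ≤ ∫ x, Q x := integral_nonneg hQ0
  have h4 : ENNReal.ofReal (∫ x in Metric.closedBall (0 : Es n) r, F x ^ χ) ≤
      ENNReal.ofReal ((lintegralPowLePowLIntegralFDerivConst (volume : Measure (Es n)) χ : ℝ) * (∫ x, Q x)^χ) := by
    refine le_trans h3 (le_trans h1 ?_)
    rw [ENNReal.ofReal_mul (by positivity), ENNReal.ofReal_coe_nnreal, ← ENNReal.ofReal_rpow_of_nonneg hI hχ0.le]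
    gcongr
  have h5 := (ENNReal.ofReal_le_ofReal_iff (by positivity)).1 h4
  refine le_trans h5 ?_
  have : 0 ≤ (∫ x, Q x)^χ := by positivity
  nlinarith

theorem mstep (hn : 2 ≤ n) {χ : ℝ} (hχ : Real.HolderConjugate n χ) {lam Lam : ℝ} (hl : 0 < lam) (hL : 0 ≤ Lam) :
    ∃ C0 : ℝ, 0 < C0 ∧ ∃ C1 : ℝ, 0 < C1 ∧ ∀ a : Es n → Matrix (Fin n) (Fin n) ℝ, Ell lam Lam a → ∀ h : Es n → ℝ, Sm h → (∀ x, 0 ≤ h x) →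
     (∀ x, 0 ≤ trace (a x * Hs h x)) → ∀ (r ρ s : ℝ) (φ : Es n → ℝ), 0 < s → Cut r ρ s φ →
     ∫ x in Metric.closedBall (0 : Es n) r, (h x ^ 2) ^ χ ≤ C0 * (C1 * s * ∫ x in Metric.closedBall (0 : Es n) ρ, h x ^ 2) ^ χ := by
  obtain ⟨C0, hC0, H⟩ := sob_real hn hχ
  have hχ0 : 0 < χ := hχ.symm.pos
  refine ⟨C0, hC0, 1 + 2 * (4 * Lam / lam + 1), by positivity, fun a A h hh h0 hsub r ρ s φ hs cu => ?_⟩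
  set I := ∫ x in Metric.closedBall (0 : Es n) ρ, h x ^ 2 with hI
  have hφ := cu.sm
  have hz := cu.zr
  have ii : IntegrableOn (fun x => h x^2) (Metric.closedBall (0 : Es n) ρ) := (hh.pow 2).cont.continuousOn.integrableOn_compact (isCompact_closedBall _ _)
  have i1 : Integrable (fun x => φ x^2 * h x^2) := by
    refine Zr.int (ρ := ρ) (fun x hx => ?_) ((hφ.pow 2).mul (hh.pow 2)).cont
    rw [hz x hx]; simp
  have i2 : Integrable (fun x => φ x^2 * (gr h x ⬝ᵥ gr h x)) := by
    refine Zr.int (ρ := ρ) (fun x hx => ?_) ((hφ.pow 2).mul hh.gg).cont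
    rw [hz x hx]; simp
  have i3 : Integrable (fun x => h x^2 * (gr φ x ⬝ᵥ gr φ x)) := by
    refine Zr.int (ρ := ρ) (fun x hx => ?_) ((hh.pow 2).mul hφ.gg).cont
    rw [hz.gr hx]; simp
  have cutI : ∀ (f : Es n → ℝ) (c : ℝ), Integrable f → (∀ x, ρ < ‖x‖ → f x = 0) → (∀ x, f x ≤ c * h x^2) → ∫ x, f x ≤ c * I := by
    intro f c hf hf0 hle
    have e : ∫ x, f x = ∫ x in Metric.closedBall (0 : Es n) ρ, f x := by
      symm; apply setIntegral_eq_integral_of_forall_compl_eq_zero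
      intro x hx; apply hf0; simpa using hx
    rw [e, hI, ← integral_const_mul]
    exact integral_mono hf.integrableOn (ii.const_mul c) hle
  have b1 : ∫ x, φ x^2 * h x^2 ≤ 1 * I := cutI _ 1 i1 (fun x hx => by rw [hz x hx]; simp) (fun x => by
    have := cu.nn x; have := cu.le x
    have : φ x^2 ≤ 1 := by nlinarith
    gcongr)
  have b3 : ∫ x, h x^2 * (gr φ x ⬝ᵥ gr φ x) ≤ s^2 * I := cutI _ _ i3 (fun x hx => by rw [hz.gr hx]; simp) (fun x => by
    have := cu.gb x
    rw [mul_comm]; gcongr)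
  have b2 := cacc A hl hz hφ hh h0 hsub
  have b2' : ∫ x, φ x^2 * (gr h x ⬝ᵥ gr h x) ≤ 4 * Lam / lam * (s^2 * I) := by
    rw [div_mul_eq_mul_div, le_div_iff₀ hl, mul_comm]
    refine le_trans b2 ?_
    gcongr
  set Q : Es n → ℝ := fun x => s * (φ x^2 * h x^2) + (2/s) * (φ x^2 * (gr h x ⬝ᵥ gr h x) + h x^2 * (gr φ x ⬝ᵥ gr φ x)) with hQ
  have iQ : Integrable Q := (i1.const_mul s).add ((i2.add i3).const_mul (2/s))
  have bQ : ∫ x, Q x ≤ (1 + 2 * (4 * Lam / lam + 1)) * s * I := by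
    have eQ : ∫ x, Q x = s * (∫ x, φ x^2 * h x^2) + (2/s) * ((∫ x, φ x^2 * (gr h x ⬝ᵥ gr h x)) + ∫ x, h x^2 * (gr φ x ⬝ᵥ gr φ x)) := by
      rw [← integral_add i2 i3, ← integral_const_mul, ← integral_const_mul]
      exact integral_add (i1.const_mul s) ((i2.add i3).const_mul (2/s))
    rw [eQ]
    calc _ ≤ s * (1 * I) + (2/s) * (4 * Lam / lam * (s^2 * I) + s^2 * I) := by gcongr
      _ = _ := by field_simp
  set F : Es n → ℝ := fun x => (φ x * h x) * (φ x * h x) with hF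
  have sF : Sm F := (hφ.mul hh).mul (hφ.mul hh)
  have zF : Zr ρ F := (hz.mul h).mul _
  have Q0 : ∀ x, 0 ≤ Q x := fun x => by
    have := dot_self_nonneg (gr h x); have := dot_self_nonneg (gr φ x)
    simp only [hQ]; positivity
  have main := H F Q ρ r sF zF (fun x => mul_self_nonneg _) iQ (fun x => by
    apply fd_norm _ _ (Q0 x)
    rw [hF, gr_mul (hφ.mul hh) (hφ.mul hh), gr_mul hφ hh]
    set w : Fin n → ℝ := φ x • gr h x + h x • gr φ x with hw
    have w1 : w ⬝ᵥ w ≤ 2 * (φ x^2 * (gr h x ⬝ᵥ gr h x) + h x^2 * (gr φ x ⬝ᵥ gr φ x)) := by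
      have := dot_self_nonneg (φ x • gr h x - h x • gr φ x)
      rw [hw]
      simp only [dotProduct_add, add_dotProduct, dotProduct_sub, sub_dotProduct, dotProduct_smul, smul_dotProduct, smul_eq_mul] at this ⊢
      rw [dotProduct_comm (gr φ x) (gr h x)] at *
      nlinarith
    have w2 : s * (φ x^2 * h x^2) + (w ⬝ᵥ w) / s ≤ Q x := by
      simp only [hQ]
      have : (w ⬝ᵥ w) / s ≤ (2 * (φ x^2 * (gr h x ⬝ᵥ gr h x) + h x^2 * (gr φ x ⬝ᵥ gr φ x))) / s := by gcongr
      calc _ ≤ s * (φ x^2 * h x^2) + (2 * (φ x^2 * (gr h x ⬝ᵥ gr h x) + h x^2 * (gr φ x ⬝ᵥ gr φ x))) / s := by gcongr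
        _ = _ := by ring
    have w3 := dot_self_nonneg w
    simp only [dotProduct_add, add_dotProduct, dotProduct_smul, smul_dotProduct, smul_eq_mul]
    calc _ = 4 * (s * (φ x^2 * h x^2)) * ((w ⬝ᵥ w) / s) := by field_simp; ring
      _ ≤ (s * (φ x^2 * h x^2) + (w ⬝ᵥ w) / s)^2 := by nlinarith [sq_nonneg (s * (φ x^2 * h x^2) - (w ⬝ᵥ w) / s)]
      _ ≤ Q x ^2 := by gcongr)
  have e1 : ∫ x in Metric.closedBall (0 : Es n) r, (h x ^ 2) ^ χ = ∫ x in Metric.closedBall (0 : Es n) r, F x ^ χ := by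
    apply setIntegral_congr_fun measurableSet_closedBall
    intro x hx
    simp only [hF]
    rw [cu.one x (by simpa using hx)]; ring_nf
  rw [e1]
  refine le_trans main ?_
  have : 0 ≤ ∫ x, Q x := integral_nonneg Q0
  gcongr
end P5d

section P5e
open Matrix MeasureTheory
variable {n : ℕ}

theorem iter_bound {χ C0 D : ℝ} (hχ : 1 < χ) (hC0 : 0 < C0) (hD : 0 < D) (I0 : ℝ) : ∃ S : ℝ, ∀ K : ℕ → ℝ, (∀ j, 0 ≤ K j) → K 0 ≤ I0 →
    (∀ j, K (j+1) ≤ C0 * (D * 2^j * K j)^χ) → ∀ j, K j ≤ Real.exp (χ^j * S) := by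
  set c := max (Real.log C0 + χ * Real.log D) 0 with hc
  have hχ1 : 0 < χ - 1 := by linarith
  have l2 : 0 < Real.log 2 := Real.log_pos (by norm_num)
  set α := χ * Real.log 2 / (χ - 1) with hα
  have eα : α * (χ - 1) = χ * Real.log 2 := by rw [hα]; field_simp
  have hα0 : 0 ≤ α := by have : 0 < χ := by linarith
                         positivity
  set β := (c + α) / (χ - 1) with hβ
  have eβ : β * (χ - 1) = c + α := by rw [hβ]; field_simp
  have hc0 : 0 ≤ c := le_max_right _ _
  have hc1 : Real.log C0 + χ * Real.log D ≤ c := le_max_left _ _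
  have hβ0 : 0 ≤ β := by positivity
  set S := Real.log (max I0 1) + β with hS
  refine ⟨S, fun K hK h0 hst => ?_⟩
  have key : ∀ j : ℕ, K j ≤ Real.exp (χ^j * S - α * j - β) := by
    intro j
    induction j with
    | zero =>
      have : χ^0 * S - α * ((0:ℕ):ℝ) - β = Real.log (max I0 1) := by rw [hS]; push_cast; ring
      rw [this, Real.exp_log (by positivity)]
      exact le_trans h0 (le_max_left _ _)
    | succ j ih =>
      refine le_trans (hst j) ?_
      have h2 : D * 2^j * K j ≤ Real.exp (Real.log D + j * Real.log 2 + (χ^j * S - α * j - β)) := by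
        rw [Real.exp_add, Real.exp_add, Real.exp_log hD, Real.exp_nat_mul, Real.exp_log (by norm_num)]
        gcongr
      have h3 : (D * 2^j * K j)^χ ≤ Real.exp ((Real.log D + j * Real.log 2 + (χ^j * S - α * j - β)) * χ) := by
        rw [Real.exp_mul]
        have := hK j
        exact Real.rpow_le_rpow (by positivity) h2 (by linarith)
      calc _ ≤ Real.exp (Real.log C0) * Real.exp ((Real.log D + j * Real.log 2 + (χ^j * S - α * j - β)) * χ) := by
            rw [Real.exp_log hC0]; gcongr
        _ = Real.exp (Real.log C0 + (Real.log D + j * Real.log 2 + (χ^j * S - α * j - β)) * χ) := by rw [Real.exp_add]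
        _ ≤ _ := by
          apply Real.exp_le_exp.2
          push_cast
          rw [pow_succ]
          have e1 : (j:ℝ) * (α * (χ - 1)) = j * (χ * Real.log 2) := by rw [eα]
          nlinarith
  intro j
  refine le_trans (key j) (Real.exp_le_exp.2 ?_)
  have : 0 ≤ α * j := by positivity
  linarith

theorem moser (hn : 2 ≤ n) {lam Lam : ℝ} (hl : 0 < lam) (hL : 0 ≤ Lam) (I0 : ℝ) :
    ∃ N : ℝ, ∀ a : Es n → Matrix (Fin n) (Fin n) ℝ, Ell lam Lam a → ∀ g : Es n → ℝ, LogSub a g →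
      ∫ x in Metric.closedBall (0 : Es n) 2, g x ≤ I0 → ∀ x : Es n, ‖x‖ < 1 → g x ≤ N := by
  have hn' : (2:ℝ) ≤ n := by exact_mod_cast hn
  have hχc : Real.HolderConjugate (n:ℝ) (Real.conjExponent n) := Real.HolderConjugate.conjExponent (by linarith)
  set χ := Real.conjExponent (n:ℝ) with hχd
  have hχ : 1 < χ := hχc.symm.lt
  obtain ⟨C0, hC0, C1, hC1, H⟩ := mstep hn hχc hl hL
  obtain ⟨T, hT, HT⟩ := cut_exists n
  obtain ⟨S, HS⟩ := iter_bound hχ hC0 (by positivity : 0 < C1 * T * 2) I0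
  refine ⟨Real.exp (S + 1), fun a A g G hI x hx => ?_⟩
  have g0 : ∀ x, 0 < g x := fun x => by linarith [G.one x]
  set K : ℕ → ℝ := fun j => ∫ x in Metric.closedBall (0 : Es n) (1 + (1/2)^j), g x ^ (χ^j) with hK
  have hcont : ∀ q : ℝ, Continuous (fun x => g x ^ q) := fun q => (G.sm.rpow g0 q).cont
  have hKb := HS K (fun j => setIntegral_nonneg measurableSet_closedBall (fun x _ => Real.rpow_nonneg (g0 x).le _))
    (by simp only [hK, pow_zero, Real.rpow_one]; norm_num; exact hI)
    (fun j => by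
      have hp : (0:ℝ) < (1/2)^j := by positivity
      obtain ⟨φ, hφ⟩ := HT (1 + (1/2)^(j+1)) (1 + (1/2)^j) (by positivity) (by rw [pow_succ]; linarith)
      have es : T / (1 + (1/2)^j - (1 + (1/2)^(j+1))) = T * 2 * 2^j := by
        rw [pow_succ, div_eq_iff (by nlinarith)]
        have : (2:ℝ)^j * (1/2)^j = 1 := by rw [← mul_pow]; norm_num
        linear_combination (-T) * this
      rw [es] at hφ
      have hq : 0 < χ^j / 2 := by positivity
      have := H a A (fun x => g x ^ (χ^j/2)) (G.sm.rpow g0 _) (fun x => Real.rpow_nonneg (g0 x).le _)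
        (rpow_sub hl.le A G hq) _ _ _ φ (by positivity) hφ
      have e2 : ∀ x, (g x ^ (χ^j/2))^2 = g x ^ (χ^j) := fun x => by
        rw [← Real.rpow_natCast, ← Real.rpow_mul (g0 x).le]; congr 1; push_cast; ring
      simp only [e2] at this
      have e3 : ∀ x, (g x ^ (χ^j))^χ = g x ^ (χ^(j+1)) := fun x => by
        rw [← Real.rpow_mul (g0 x).le, pow_succ]
      simp only [e3] at this
      refine le_trans this (le_of_eq ?_)
      simp only [hK]
      congr 2; ring)
  by_contra hgx
  push Not at hgx
  set U : Set (Es n) := {y | Real.exp (S+1) < g y} ∩ Metric.ball 0 1 with hU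
  have hUo : IsOpen U := (isOpen_lt continuous_const G.sm.cont).inter Metric.isOpen_ball
  have hxU : x ∈ U := ⟨hgx, by simpa using hx⟩
  have hUp : 0 < volume U := hUo.measure_pos _ ⟨x, hxU⟩
  have hUf : volume U ≠ ⊤ := (lt_of_le_of_lt (measure_mono Set.inter_subset_right) measure_ball_lt_top).ne
  have hμ : 0 < (volume U).toReal := ENNReal.toReal_pos hUp.ne' hUf
  have hle : ∀ j : ℕ, (volume U).toReal ≤ Real.exp (-(χ^j)) := by
    intro j
    have i1 : IntegrableOn (fun x => g x ^ (χ^j)) (Metric.closedBall (0 : Es n) (1 + (1/2)^j)) :=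
      (hcont _).continuousOn.integrableOn_compact (isCompact_closedBall _ _)
    have hsub : U ⊆ Metric.closedBall (0 : Es n) (1 + (1/2)^j) := fun y hy => by
      have h1 := hy.2
      simp only [Metric.mem_ball, Metric.mem_closedBall] at h1 ⊢
      have : (0:ℝ) < (1/2)^j := by positivity
      linarith
    have h1 : ∫ x in U, g x ^ (χ^j) ≤ K j :=
      setIntegral_mono_set i1 (Filter.Eventually.of_forall fun x => Real.rpow_nonneg (g0 x).le _) (Filter.Eventually.of_forall hsub)
    have h2 : Real.exp (S+1)^(χ^j) * (volume U).toReal ≤ ∫ x in U, g x ^ (χ^j) := by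
      have := setIntegral_ge_of_const_le_real (μ := volume) (f := fun x => g x ^ (χ^j)) (c := Real.exp (S+1)^(χ^j)) hUo.measurableSet hUf
        (fun y hy => Real.rpow_le_rpow (Real.exp_pos _).le (le_of_lt hy.1) (by positivity)) (i1.mono_set hsub)
      simpa [Measure.real] using this
    have h3 := le_trans h2 (le_trans h1 (hKb j))
    rw [← Real.exp_mul, show (S+1) * χ^j = χ^j * S + χ^j by ring, Real.exp_add, mul_assoc] at h3
    have h4 : Real.exp (χ^j) * (volume U).toReal ≤ 1 := le_of_mul_le_mul_left (by rw [mul_one]; exact h3) (Real.exp_pos (χ^j * S))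
    rw [Real.exp_neg, ← one_div, le_div_iff₀ (Real.exp_pos _)]
    linarith
  have hlim : Filter.Tendsto (fun j : ℕ => Real.exp (-(χ^j))) Filter.atTop (nhds 0) :=
    Real.tendsto_exp_neg_atTop_nhds_zero.comp (tendsto_pow_atTop_atTop_of_one_lt hχ)
  have := ge_of_tendsto' hlim hle
  linarith
end P5e

section P5f
open Matrix MeasureTheory
open scoped ENNReal
variable {n : ℕ}

theorem lint_affine {f : Es n → ℝ≥0∞} (hf : Measurable f) {t : ℝ} (ht : 1/2 ≤ t) (c : Es n) :
    ∫⁻ x, f (c + t • x) ≤ 2^n * ∫⁻ x, f x := by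
  have ht0 : t ≠ 0 := by linarith
  have e1 : ∫⁻ x, f (c + t • x) = ∫⁻ x, f (t • x) := by
    rw [← lintegral_add_right_eq_self (fun x => f (t • x)) (t⁻¹ • c)]
    apply lintegral_congr; intro x
    rw [smul_add, smul_smul, mul_inv_cancel₀ ht0, one_smul, add_comm]
  have e2 : ∫⁻ x, f (t • x) = ENNReal.ofReal |(t ^ n)⁻¹| * ∫⁻ x, f x := by
    have h1 := Measure.map_addHaar_smul (volume : Measure (Es n)) ht0
    have h2 := lintegral_map (μ := (volume : Measure (Es n))) hf (measurable_const_smul t)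
    rw [h1, lintegral_smul_measure] at h2
    rw [← h2]; simp
  rw [e1, e2]
  gcongr
  rw [abs_of_nonneg (by positivity), show (2:ℝ≥0∞)^n = ENNReal.ofReal (2^n) by simp [ENNReal.ofReal_pow]]
  apply ENNReal.ofReal_le_ofReal
  rw [← inv_pow]
  gcongr
  rw [inv_le_comm₀ (by linarith) (by norm_num)]; linarith

theorem lint_seg {W : Es n → ℝ≥0∞} (hW : Measurable W) {t : ℝ} (ht : 1/2 ≤ t) (ht1 : t ≤ 1) {y : Es n} {R : ℝ} (hy : y ∈ Metric.closedBall (0 : Es n) R) :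
    ∫⁻ x in Metric.closedBall (0 : Es n) R, W ((1-t) • y + t • x) ≤ 2^n * ∫⁻ x in Metric.closedBall (0 : Es n) R, W x := by
  have mB : MeasurableSet (Metric.closedBall (0 : Es n) R) := measurableSet_closedBall
  rw [← lintegral_indicator mB, ← lintegral_indicator mB]
  refine le_trans ?_ (lint_affine (hW.indicator mB) ht ((1-t) • y))
  apply lintegral_mono; intro x
  by_cases hx : x ∈ Metric.closedBall (0 : Es n) R
  · have : (1-t) • y + t • x ∈ Metric.closedBall (0 : Es n) R :=
      (convex_closedBall (0 : Es n) R) hy hx (by linarith) (by linarith) (by ring)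
    simp only [Set.indicator_of_mem hx, Set.indicator_of_mem this]; exact le_refl _
  · simp only [Set.indicator_of_notMem hx]; exact zero_le

theorem lint_dbl {W : Es n → ℝ≥0∞} (hW : Measurable W) {t : ℝ} (ht0 : 0 ≤ t) (ht1 : t ≤ 1) (R : ℝ) :
    ∫⁻ x in Metric.closedBall (0 : Es n) R, ∫⁻ y in Metric.closedBall (0 : Es n) R, W ((1-t) • y + t • x) ≤
      2^n * (∫⁻ x in Metric.closedBall (0 : Es n) R, W x) * volume (Metric.closedBall (0 : Es n) R) := by
  have mB : MeasurableSet (Metric.closedBall (0 : Es n) R) := measurableSet_closedBall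
  have bd : ∀ (F : Es n → ℝ≥0∞), (∀ x ∈ Metric.closedBall (0 : Es n) R, F x ≤ 2^n * ∫⁻ x in Metric.closedBall (0 : Es n) R, W x) →
      ∫⁻ x in Metric.closedBall (0 : Es n) R, F x ≤ 2^n * (∫⁻ x in Metric.closedBall (0 : Es n) R, W x) * volume (Metric.closedBall (0 : Es n) R) := by
    intro F hF
    refine le_trans (setLIntegral_mono measurable_const hF) ?_
    rw [setLIntegral_const]
  by_cases h : 1/2 ≤ t
  · rw [lintegral_lintegral_swap]
    · exact bd _ (fun y hy => lint_seg hW h ht1 hy)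
    · apply Measurable.aemeasurable
      apply hW.comp
      fun_prop
  · push Not at h
    apply bd
    intro x hx
    have := lint_seg hW (t := 1 - t) (by linarith) (by linarith) hx
    refine le_trans (le_of_eq ?_) this
    apply lintegral_congr; intro y
    congr 1; rw [sub_sub_cancel, add_comm]

theorem seg_ineq {g : Es n → ℝ} (hg : Sm g) {R : ℝ} {x y : Es n} (hx : ‖x‖ ≤ R) (hy : ‖y‖ ≤ R) (hR : 1 ≤ R) :
    g x - g y ≤ ∫ t in Set.Icc (0:ℝ) 1, 2 * R * (1 + gr g ((1-t) • y + t • x) ⬝ᵥ gr g ((1-t) • y + t • x)) := by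
  set q : Fin n → ℝ := ((x - y : Es n) : Es n).ofLp with hq
  have htv : tv q = x - y := rfl
  have hpt : ∀ t : ℝ, y + t • tv q = (1-t) • y + t • x := fun t => by rw [htv, smul_sub, sub_smul, one_smul]; abel
  have hd := fun t => line_deriv hg y q t
  have hc : Continuous (fun t : ℝ => dv q g (y + t • tv q)) := (hg.dv q).cont.comp (by fun_prop)
  have h1 := intervalIntegral.integral_eq_sub_of_hasDerivAt (a := 0) (b := 1) (fun t _ => hd t) (hc.intervalIntegrable _ _)
  simp only [hpt] at h1
  simp only [sub_self, zero_smul, one_smul, zero_add, sub_zero, add_zero] at h1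
  rw [← h1, intervalIntegral.integral_of_le zero_le_one, ← integral_Icc_eq_integral_Ioc]
  simp only [hpt] at hc
  have hc2 : Continuous (fun t : ℝ => 2 * R * (1 + gr g ((1-t) • y + t • x) ⬝ᵥ gr g ((1-t) • y + t • x))) :=
    continuous_const.mul (continuous_const.add (hg.gg.cont.comp (by fun_prop : Continuous (fun t : ℝ => (1-t) • y + t • x))))
  refine setIntegral_mono (hc.continuousOn.integrableOn_compact isCompact_Icc) (hc2.continuousOn.integrableOn_compact isCompact_Icc) (fun t => ?_)
  simp only []
  set p := (1-t) • y + t • x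
  have h2 : (q ⬝ᵥ gr g p)^2 ≤ (q ⬝ᵥ q) * (gr g p ⬝ᵥ gr g p) := by
    have := Finset.sum_mul_sq_le_sq_mul_sq Finset.univ q (gr g p)
    simpa [dotProduct, sq] using this
  have h3 : q ⬝ᵥ q ≤ (2*R)^2 := by
    rw [hq, dot_norm (x - y)]
    have : ‖x - y‖ ≤ 2 * R := le_trans (norm_sub_le _ _) (by linarith)
    gcongr
  have h4 := dot_self_nonneg (gr g p)
  rw [dv_gr]
  refine le_trans (le_abs_self _) (abs_le_of_sq_le_sq ?_ (by positivity))
  calc _ ≤ _ := h2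
    _ ≤ (2*R)^2 * (gr g p ⬝ᵥ gr g p) := by gcongr
    _ ≤ (2*R)^2 * (1 + gr g p ⬝ᵥ gr g p)^2 := by gcongr; nlinarith
    _ = _ := by ring

theorem poinc {g : Es n → ℝ} (hg : Sm g) (h0 : ∀ x, 0 ≤ g x) {R : ℝ} (hR : 1 ≤ R) {E : Set (Es n)} (hE : MeasurableSet E) (hEB : E ⊆ Metric.closedBall (0 : Es n) R)
    {G0 e : ℝ} (hG0 : 0 ≤ G0) (hGE : ∀ x ∈ E, g x ≤ G0) (he0 : 0 ≤ e) (he : ENNReal.ofReal e ≤ volume E) :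
    e * ∫ x in Metric.closedBall (0 : Es n) R, g x ≤
      (volume (Metric.closedBall (0 : Es n) R)).toReal * (G0 * (volume (Metric.closedBall (0 : Es n) R)).toReal + 2^n * ∫ x in Metric.closedBall (0 : Es n) R, 2 * R * (1 + gr g x ⬝ᵥ gr g x)) := by
  set B := Metric.closedBall (0 : Es n) R with hB
  have mB : MeasurableSet B := measurableSet_closedBall
  set w : Es n → ℝ := fun x => 2 * R * (1 + gr g x ⬝ᵥ gr g x) with hw
  have w0 : ∀ x, 0 ≤ w x := fun x => by have := dot_self_nonneg (gr g x); simp only [hw]; positivity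
  have wc : Continuous w := continuous_const.mul (continuous_const.add hg.gg.cont)
  set W : Es n → ℝ≥0∞ := fun x => ENNReal.ofReal (w x) with hW
  have hWm : Measurable W := (ENNReal.continuous_ofReal.comp wc).measurable
  have ig : IntegrableOn g B := hg.cont.continuousOn.integrableOn_compact (isCompact_closedBall _ _)
  have iw : IntegrableOn w B := wc.continuousOn.integrableOn_compact (isCompact_closedBall _ _)
  have eW : ∫⁻ x in B, W x = ENNReal.ofReal (∫ x in B, w x) := (ofReal_integral_eq_lintegral_ofReal iw (Filter.Eventually.of_forall w0)).symm
  have eg : ENNReal.ofReal (∫ x in B, g x) = ∫⁻ x in B, ENNReal.ofReal (g x) := (ofReal_integral_eq_lintegral_ofReal ig (Filter.Eventually.of_forall h0))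
  have pw : ∀ x ∈ B, ∀ y ∈ E, ENNReal.ofReal (g x) ≤ ENNReal.ofReal G0 + ∫⁻ t in Set.Icc (0:ℝ) 1, W ((1-t) • y + t • x) := by
    intro x hx y hy
    have h1 := seg_ineq hg (R := R) (x := x) (y := y) (by simpa [hB] using hx) (by simpa [hB] using hEB hy) hR
    have hc2 : Continuous (fun t : ℝ => w ((1-t) • y + t • x)) := wc.comp (by fun_prop)
    rw [← ofReal_integral_eq_lintegral_ofReal (hc2.continuousOn.integrableOn_compact isCompact_Icc) (Filter.Eventually.of_forall fun t => w0 _)]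
    refine le_trans (ENNReal.ofReal_le_ofReal ?_) ENNReal.ofReal_add_le
    have := hGE y hy
    simp only [hw]; linarith
  have vB : volume B ≠ ⊤ := measure_closedBall_lt_top.ne
  have m3 : Measurable (fun p : Es n × Es n × ℝ => W ((1-p.2.2) • p.2.1 + p.2.2 • p.1)) := hWm.comp (by fun_prop)
  have m3' : Measurable (fun p : (Es n × Es n) × ℝ => W ((1-p.2) • p.1.2 + p.2 • p.1.1)) := hWm.comp (by fun_prop)
  have m3'' : Measurable (fun p : (Es n × ℝ) × Es n => W ((1-p.1.2) • p.2 + p.1.2 • p.1.1)) := hWm.comp (by fun_prop)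
  have st1 : ∀ x ∈ B, volume E * ENNReal.ofReal (g x) ≤ ENNReal.ofReal G0 * volume B + ∫⁻ y in B, ∫⁻ t in Set.Icc (0:ℝ) 1, W ((1-t) • y + t • x) := by
    intro x hx
    have m2 : Measurable (fun y : Es n => ∫⁻ t in Set.Icc (0:ℝ) 1, W ((1-t) • y + t • x)) :=
      Measurable.lintegral_prod_right' (f := fun p : Es n × ℝ => W ((1-p.2) • p.1 + p.2 • x)) (hWm.comp (by fun_prop))
    calc volume E * ENNReal.ofReal (g x) = ∫⁻ y in E, ENNReal.ofReal (g x) := by rw [setLIntegral_const, mul_comm]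
      _ ≤ ∫⁻ y in E, (ENNReal.ofReal G0 + ∫⁻ t in Set.Icc (0:ℝ) 1, W ((1-t) • y + t • x)) :=
          setLIntegral_mono (measurable_const.add m2) (fun y hy => pw x hx y hy)
      _ ≤ ∫⁻ y in B, (ENNReal.ofReal G0 + ∫⁻ t in Set.Icc (0:ℝ) 1, W ((1-t) • y + t • x)) := lintegral_mono_set hEB
      _ = _ := by rw [lintegral_add_left measurable_const, setLIntegral_const]
  have m2 : Measurable (fun x : Es n => ∫⁻ y in B, ∫⁻ t in Set.Icc (0:ℝ) 1, W ((1-t) • y + t • x)) := by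
    apply Measurable.lintegral_prod_right' (f := fun p : Es n × Es n => ∫⁻ t in Set.Icc (0:ℝ) 1, W ((1-t) • p.2 + t • p.1))
    exact Measurable.lintegral_prod_right' m3'
  have st2 : volume E * ENNReal.ofReal (∫ x in B, g x) ≤ ENNReal.ofReal G0 * volume B * volume B + 2^n * (∫⁻ x in B, W x) * volume B := by
    calc volume E * ENNReal.ofReal (∫ x in B, g x) = ∫⁻ x in B, volume E * ENNReal.ofReal (g x) := by
          rw [eg]; exact (lintegral_const_mul _ (ENNReal.continuous_ofReal.comp hg.cont).measurable).symm
      _ ≤ ∫⁻ x in B, (ENNReal.ofReal G0 * volume B + ∫⁻ y in B, ∫⁻ t in Set.Icc (0:ℝ) 1, W ((1-t) • y + t • x)) :=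
          setLIntegral_mono (measurable_const.add m2) st1
      _ = ENNReal.ofReal G0 * volume B * volume B + ∫⁻ x in B, ∫⁻ y in B, ∫⁻ t in Set.Icc (0:ℝ) 1, W ((1-t) • y + t • x) := by
          rw [lintegral_add_left measurable_const, setLIntegral_const]
      _ ≤ _ := by
          gcongr
          have s1 : ∀ x : Es n, ∫⁻ y in B, ∫⁻ t in Set.Icc (0:ℝ) 1, W ((1-t) • y + t • x) = ∫⁻ t in Set.Icc (0:ℝ) 1, ∫⁻ y in B, W ((1-t) • y + t • x) := by
            intro x
            apply lintegral_lintegral_swap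
            apply Measurable.aemeasurable
            exact hWm.comp (by fun_prop)
          simp only [s1]
          rw [lintegral_lintegral_swap]
          · calc _ ≤ ∫⁻ t in Set.Icc (0:ℝ) 1, 2^n * (∫⁻ x in B, W x) * volume B :=
                  setLIntegral_mono measurable_const (fun t ht => lint_dbl hWm ht.1 ht.2 R)
              _ = _ := by rw [setLIntegral_const]; simp
          · apply Measurable.aemeasurable
            exact Measurable.lintegral_prod_right' m3''
  rw [eW] at st2
  set b := (volume B).toReal with hb
  have evB : volume B = ENNReal.ofReal b := (ENNReal.ofReal_toReal vB).symm
  have hb0 : 0 ≤ b := ENNReal.toReal_nonneg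
  have hI0 : 0 ≤ ∫ x in B, w x := setIntegral_nonneg mB (fun x _ => w0 x)
  have st3 : ENNReal.ofReal (e * ∫ x in B, g x) ≤ ENNReal.ofReal (G0 * b * b + 2^n * (∫ x in B, w x) * b) := by
    rw [ENNReal.ofReal_mul he0, ENNReal.ofReal_add (by positivity) (by positivity), ENNReal.ofReal_mul (by positivity), ENNReal.ofReal_mul (by positivity),
      ENNReal.ofReal_mul (by positivity), ENNReal.ofReal_mul (by positivity), ← evB, ENNReal.ofReal_pow (by norm_num)]
    refine le_trans ?_ (le_trans st2 (le_of_eq ?_))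
    · gcongr
    · simp
  have st4 := (ENNReal.ofReal_le_ofReal_iff (by positivity)).1 st3
  refine le_trans st4 (le_of_eq ?_)
  ring
end P5f

section P5g
open Matrix MeasureTheory
open scoped ENNReal
variable {n : ℕ}

theorem log_energy (n : ℕ) {lam Lam : ℝ} (hl : 0 < lam) (hL : 0 ≤ Lam) :
    ∃ D : ℝ, ∀ a : Es n → Matrix (Fin n) (Fin n) ℝ, Ell lam Lam a → ∀ g : Es n → ℝ, LogSub a g →
      ∫ x in Metric.closedBall (0 : Es n) 2, gr g x ⬝ᵥ gr g x ≤ D := by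
  obtain ⟨T, hT, HT⟩ := cut_exists n
  obtain ⟨φ, hφ⟩ := HT 2 3 (by norm_num) (by norm_num)
  refine ⟨4 * Lam / lam * ∫ x, (gr φ x ⬝ᵥ gr φ x), fun a A g G => ?_⟩
  have h1 := cacc_log A hl hφ.zr hφ.sm G
  have i2 : Integrable (fun x => φ x^2 * (gr g x ⬝ᵥ gr g x)) := by
    refine Zr.int (ρ := 3) (fun x hx => ?_) ((hφ.sm.pow 2).mul G.sm.gg).cont
    rw [hφ.zr x hx]; simp
  have h2 : ∫ x in Metric.closedBall (0 : Es n) 2, gr g x ⬝ᵥ gr g x = ∫ x in Metric.closedBall (0 : Es n) 2, φ x^2 * (gr g x ⬝ᵥ gr g x) := by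
    apply setIntegral_congr_fun measurableSet_closedBall
    intro x hx
    simp only []
    rw [hφ.one x (by simpa using hx)]; ring
  have h3 : ∫ x in Metric.closedBall (0 : Es n) 2, φ x^2 * (gr g x ⬝ᵥ gr g x) ≤ ∫ x, φ x^2 * (gr g x ⬝ᵥ gr g x) :=
    setIntegral_le_integral i2 (Filter.Eventually.of_forall fun x => mul_nonneg (sq_nonneg _) (dot_self_nonneg _))
  rw [h2]
  refine le_trans h3 ?_
  rw [div_mul_eq_mul_div, le_div_iff₀ hl]
  linarith

theorem WH (hn : 2 ≤ n) {lam Lam : ℝ} (hl : 0 < lam) (hL : 0 ≤ Lam) {M0 ε : ℝ} (hM : 0 ≤ M0) (hε : 0 < ε) :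
    ∃ c : ℝ, 0 < c ∧ ∀ a : Es n → Matrix (Fin n) (Fin n) ℝ, Ell lam Lam a → ∀ z : Es n → ℝ, Sm z → (∀ x, 0 ≤ z x) → (∀ x, z x ≤ M0) →
      (∀ x, trace (a x * Hs z x) ≤ 0) → ENNReal.ofReal ε ≤ volume ({x | ε ≤ z x} ∩ Metric.closedBall (0 : Es n) 2) → ∀ x : Es n, ‖x‖ < 1 → c ≤ z x := by
  obtain ⟨D, HD⟩ := log_energy n hl hL
  set b := (volume (Metric.closedBall (0 : Es n) 2)).toReal with hb
  have hb0 : 0 ≤ b := ENNReal.toReal_nonneg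
  set G0 := 1 + Real.log (M0+1) + |Real.log ε| with hG0
  have hlM : 0 ≤ Real.log (M0+1) := Real.log_nonneg (by linarith)
  have hG00 : 0 ≤ G0 := by rw [hG0]; have := abs_nonneg (Real.log ε); linarith
  obtain ⟨N, HN⟩ := moser hn hl hL ((b * (G0 * b + 2^n * (2 * 2 * (b + D)))) / ε)
  refine ⟨Real.exp (1 + Real.log (M0+1) - N), Real.exp_pos _, fun a A z hz h0 h1 hLz hv x hx => ?_⟩
  have key : ∀ δ : ℝ, 0 < δ → δ ≤ 1 → Real.exp (1 + Real.log (M0+1) - N) ≤ z x + δ := by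
    intro δ hδ hδ1
    have G := log_sub hl.le A hz hδ hδ1 h0 h1 hLz
    set g : Es n → ℝ := fun x => 1 + Real.log (M0 + 1) - Real.log (z x + δ) with hg
    have ig : IntegrableOn (fun x => gr g x ⬝ᵥ gr g x) (Metric.closedBall (0 : Es n) 2) := G.sm.gg.cont.continuousOn.integrableOn_compact (isCompact_closedBall _ _)
    have ic : IntegrableOn (fun x : Es n => (1:ℝ)) (Metric.closedBall (0 : Es n) 2) := continuous_const.continuousOn.integrableOn_compact (isCompact_closedBall _ _)
    have hP := poinc G.sm (fun x => by linarith [G.one x]) (R := 2) (by norm_num)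
      (E := {x | ε ≤ z x} ∩ Metric.closedBall (0 : Es n) 2) ((isClosed_le continuous_const hz.cont).measurableSet.inter measurableSet_closedBall) Set.inter_subset_right
      (G0 := G0) (e := ε) hG00 (fun y hy => by
        have h2 : ε ≤ z y := hy.1
        have h3 := Real.log_le_log hε (by linarith : ε ≤ z y + δ)
        have h4 := neg_abs_le (Real.log ε)
        simp only [hg, hG0]; linarith) hε.le hv
    have e1 : ∫ x in Metric.closedBall (0 : Es n) 2, 2 * 2 * (1 + gr g x ⬝ᵥ gr g x) = 2 * 2 * (b + ∫ x in Metric.closedBall (0 : Es n) 2, gr g x ⬝ᵥ gr g x) := by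
      rw [integral_const_mul, integral_add ic ig]
      congr 2
      simp [hb, Measure.real]
    rw [e1] at hP
    have hI : ∫ x in Metric.closedBall (0 : Es n) 2, g x ≤ (b * (G0 * b + 2^n * (2 * 2 * (b + D)))) / ε := by
      rw [le_div_iff₀ hε, mul_comm]
      refine le_trans hP ?_
      have := HD a A g G
      gcongr
    have h5 := HN a A g G hI x hx
    have hp : 0 < z x + δ := by linarith [h0 x]
    rw [← Real.exp_log hp]
    apply Real.exp_le_exp.2
    simp only [hg] at h5
    linarith
  by_contra hc
  push Not at hc
  have h6 := key (min 1 ((Real.exp (1 + Real.log (M0+1) - N) - z x)/2)) (lt_min one_pos (by linarith)) (min_le_left _ _)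
  have := min_le_right 1 ((Real.exp (1 + Real.log (M0+1) - N) - z x)/2)
  linarith
end P5g

section P6
open Matrix MeasureTheory Filter Topology
variable {n m : ℕ} {C : ℝ} {u : Es n → ℝ}

theorem Sol.ell (S : Sol m C u) {K : ℝ} (hK0 : 0 < K) (hK : ∀ x, ∀ q : Fin n → ℝ, q ⬝ᵥ (Hs u x *ᵥ q) ≤ K * (q ⬝ᵥ q)) :
    Ell ((K * (1 + n))⁻¹) ((n * K)^m) (fun x => NT m (Hs u x)) where
  sm := Sm.NT (fun i j => S.sm.Hs i j) m
  sy x := NT_symm (S.hV x) m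
  dz j x := div_free S.sm m j x
  lo x v := by
    have := B_ell_low (S.hV x) (S.gm x) (S.eq x) hK0.le (hK x) v
    rw [Fintype.card_fin] at this
    rwa [inv_mul_le_iff₀ (by positivity)]
  up x v := by
    have := B_ell_up (S.hV x) (S.gm x) (S.eq x) hK0.le (hK x) v
    rwa [Fintype.card_fin] at this

def Mx (u : Es n → ℝ) (e : Fin n → ℝ) : ℝ := sSup (Set.range fun x => e ⬝ᵥ (Hs u x *ᵥ e))

theorem density (hn : 2 ≤ n) (hC : 1 ≤ C) (S : Sol m C u) {K : ℝ} (hK0 : 0 < K)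
    (hK : ∀ x, ∀ q : Fin n → ℝ, q ⬝ᵥ (Hs u x *ᵥ q) ≤ K * (q ⬝ᵥ q)) (e : Fin n → ℝ) {η : ℝ} (hη : 0 < η) :
    ∀ᶠ R : ℝ in atTop, volume ({y : Es n | η ≤ Mx u e - e ⬝ᵥ (Hs u (R • y) *ᵥ e)} ∩ Metric.closedBall (0 : Es n) 2) < ENNReal.ofReal η := by
  have hee := dot_self_nonneg e
  have hM0 : 0 ≤ (K + n) * (e ⬝ᵥ e) := by positivity
  obtain ⟨c, hc, H⟩ := WH (n := n) (lam := (K * (1 + n))⁻¹) (Lam := (n * K)^m) (M0 := (K + n) * (e ⬝ᵥ e)) hn (by positivity) (by positivity) hM0 hη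
  have hbd : BddAbove (Set.range fun x => e ⬝ᵥ (Hs u x *ᵥ e)) := ⟨K * (e ⬝ᵥ e), by rintro _ ⟨x, rfl⟩; exact hK x e⟩
  have hne : (Set.range fun x => e ⬝ᵥ (Hs u x *ᵥ e)).Nonempty := Set.range_nonempty _
  obtain ⟨_, ⟨x0, rfl⟩, hx0⟩ := exists_lt_of_lt_csSup hne (show Mx u e - c < _ from sub_lt_self _ hc)
  filter_upwards [eventually_ge_atTop (‖x0‖ + 1), eventually_gt_atTop ‖x0‖] with R hR hR'
  have hR1 : 1 ≤ R := by linarith [norm_nonneg x0]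
  have hR0 : R ≠ 0 := by linarith
  by_contra hcon
  rw [not_lt] at hcon
  have S' := S.scale hC hR1
  set v : Es n → ℝ := fun y => (R^2)⁻¹ * u (R • y) with hv
  have hHs : ∀ y, Hs v y = Hs u (R • y) := fun y => Hs_scale S.sm hR0 y
  have E := S'.ell hK0 (fun x q => by rw [hHs]; exact hK _ q)
  have hz : ∀ y, dv e (dv e v) y = e ⬝ᵥ (Hs u (R • y) *ᵥ e) := fun y => by rw [dv_dv_Hs S'.sm, hHs]
  have key := H _ E (fun y => Mx u e - dv e (dv e v) y) ((Sm.const _).sub ((S'.sm.dv e).dv e))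
    (fun y => by
      rw [hz, sub_nonneg]
      exact le_csSup hbd ⟨_, rfl⟩)
    (fun y => by
      rw [hz]
      have h1 := B_V_low (S.hV (R • y)) (S.gm _) (S.eq _) e
      have h2 : Mx u e ≤ K * (e ⬝ᵥ e) := csSup_le hne (by rintro _ ⟨x, rfl⟩; exact hK x e)
      rw [Fintype.card_fin] at h1
      linarith)
    (fun y => by
      rw [Hs_sub (Sm.const _) ((S'.sm.dv e).dv e), Hs_const, zero_sub, Matrix.mul_neg, Matrix.trace_neg]
      linarith [S'.L3_nonneg e y])
    (by simpa only [hz] using hcon) (R⁻¹ • x0) (by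
      rw [norm_smul, norm_inv, Real.norm_of_nonneg (by linarith), inv_mul_lt_iff₀ (by linarith)]
      linarith)
  simp only [hz] at key
  rw [smul_smul, mul_inv_cancel₀ hR0, one_smul] at key
  linarith

theorem joint (hn : 2 ≤ n) (hC : 1 ≤ C) (S : Sol m C u) (s : Finset (Fin n → ℝ)) {η : ℝ} (hη : 0 < η) :
    ∃ x, ∀ e ∈ s, Mx u e - η ≤ e ⬝ᵥ (Hs u x *ᵥ e) := by
  obtain ⟨K', hK'0, hK'⟩ := Hess_bound hC S
  have hK : ∀ x, ∀ q : Fin n → ℝ, q ⬝ᵥ (Hs u x *ᵥ q) ≤ (K'+1) * (q ⬝ᵥ q) := fun x q => by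
    have := hK' x q; have := dot_self_nonneg q; linarith
  set B := Metric.closedBall (0 : Es n) 2
  have hBf : volume B ≠ ⊤ := measure_closedBall_lt_top.ne
  have hBp : 0 < (volume B).toReal := ENNReal.toReal_pos (Metric.measure_closedBall_pos _ _ (by norm_num)).ne' hBf
  set V := (volume B).toReal
  set η' := min η (V / (s.card + 1)) with hη'
  have hp : 0 < η' := lt_min hη (by positivity)
  have ev : ∀ᶠ R : ℝ in atTop, ∀ e ∈ s, volume ({y : Es n | η' ≤ Mx u e - e ⬝ᵥ (Hs u (R • y) *ᵥ e)} ∩ B) < ENNReal.ofReal η' :=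
    (eventually_all_finset s).2 fun e _ => density hn hC S (by linarith) hK e hp
  obtain ⟨R, hR⟩ := ev.exists
  by_contra! hcon
  have hsub : B ⊆ ⋃ e ∈ s, ({y : Es n | η' ≤ Mx u e - e ⬝ᵥ (Hs u (R • y) *ᵥ e)} ∩ B) := by
    intro y hy
    obtain ⟨e, he, h⟩ := hcon (R • y)
    simp only [Set.mem_iUnion]
    refine ⟨e, he, ?_, hy⟩
    have : η' ≤ η := min_le_left _ _
    simp only [Set.mem_setOf_eq]; linarith
  have h1 : volume B ≤ ∑ e ∈ s, ENNReal.ofReal η' :=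
    (measure_mono hsub).trans ((measure_biUnion_finset_le s _).trans (Finset.sum_le_sum fun e he => (hR e he).le))
  rw [Finset.sum_const, nsmul_eq_mul, ← ENNReal.ofReal_natCast, ← ENNReal.ofReal_mul (by positivity), ← ENNReal.ofReal_toReal hBf,
    ENNReal.ofReal_le_ofReal_iff (by positivity)] at h1
  have h2 : η' ≤ V / (s.card + 1) := min_le_right _ _
  rw [le_div_iff₀ (by positivity)] at h2
  have : V ≤ s.card * η' := h1
  nlinarith

theorem cont_NT (k : ℕ) : Continuous (fun V : Matrix (Fin n) (Fin n) ℝ => NT k V) := by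
  induction k with
  | zero => exact continuous_const
  | succ k ih =>
    simp only [NT]
    exact (((ih.matrix_mul continuous_id).matrix_trace.div_const _).smul continuous_const).sub (ih.matrix_mul continuous_id)

theorem cont_NS (k : ℕ) : Continuous (fun V : Matrix (Fin n) (Fin n) ℝ => NS k V) := by
  cases k with
  | zero => exact continuous_const
  | succ k =>
    simp only [NS]
    exact ((cont_NT k).matrix_mul continuous_id).matrix_trace.div_const _

theorem polar {V : Matrix (Fin n) (Fin n) ℝ} (hV : V.IsHermitian) (i j : Fin n) :
    V i j = (((Pi.single i 1 + Pi.single j 1 : Fin n → ℝ) ⬝ᵥ (V *ᵥ (Pi.single i 1 + Pi.single j 1))) -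
      (Pi.single i 1 : Fin n → ℝ) ⬝ᵥ (V *ᵥ (Pi.single i 1)) - (Pi.single j 1 : Fin n → ℝ) ⬝ᵥ (V *ᵥ (Pi.single j 1)))/2 := by
  have h : V j i = V i j := by simpa using hV.apply i j
  simp [Matrix.mulVec_add, add_dotProduct, dotProduct_add]
  linarith

def Amat (u : Es n → ℝ) : Matrix (Fin n) (Fin n) ℝ := fun i j =>
  (Mx u (Pi.single i 1 + Pi.single j 1) - Mx u (Pi.single i 1) - Mx u (Pi.single j 1))/2

theorem Amat_lim (hn : 2 ≤ n) (hC : 1 ≤ C) (S : Sol m C u) (q : Fin n → ℝ) :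
    ∃ x : ℕ → Es n, Tendsto (fun k => Hs u (x k)) atTop (𝓝 (Amat u)) ∧ Tendsto (fun k => q ⬝ᵥ (Hs u (x k) *ᵥ q)) atTop (𝓝 (Mx u q)) := by
  classical
  set s : Finset (Fin n → ℝ) := insert q (Finset.univ.image (fun i : Fin n => (Pi.single i 1 : Fin n → ℝ)) ∪
    Finset.univ.image (fun p : Fin n × Fin n => (Pi.single p.1 1 + Pi.single p.2 1 : Fin n → ℝ))) with hs
  obtain ⟨K, hK0, hK⟩ := Hess_bound hC S
  have hj : ∀ k : ℕ, ∃ x, ∀ e ∈ s, Mx u e - 1/((k:ℝ)+1) ≤ e ⬝ᵥ (Hs u x *ᵥ e) := fun k => joint hn hC S s (by positivity)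
  choose x hx using hj
  have hl : ∀ e ∈ s, Tendsto (fun k => e ⬝ᵥ (Hs u (x k) *ᵥ e)) atTop (𝓝 (Mx u e)) := by
    intro e he
    refine tendsto_of_tendsto_of_tendsto_of_le_of_le (g := fun k : ℕ => Mx u e - 1/((k:ℝ)+1)) (h := fun _ => Mx u e) ?_ tendsto_const_nhds
      (fun k => hx k e he) (fun k => le_csSup ⟨K * (e ⬝ᵥ e), by rintro _ ⟨x, rfl⟩; exact hK x e⟩ ⟨_, rfl⟩)
    simpa using (tendsto_const_nhds (x := Mx u e)).sub (tendsto_one_div_add_atTop_nhds_zero_nat (𝕜 := ℝ))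
  refine ⟨x, ?_, hl q (Finset.mem_insert_self _ _)⟩
  refine tendsto_pi_nhds.2 fun i => tendsto_pi_nhds.2 fun j => ?_
  have e1 : (fun k => Hs u (x k) i j) = _ := funext fun k => polar (S.hV (x k)) i j
  rw [e1]
  have m1 : ∀ i : Fin n, (Pi.single i 1 : Fin n → ℝ) ∈ s := fun i => by
    refine Finset.mem_insert_of_mem (Finset.mem_union_left _ (Finset.mem_image.2 ⟨i, Finset.mem_univ _, rfl⟩))
  have m2 : (Pi.single i 1 + Pi.single j 1 : Fin n → ℝ) ∈ s :=
    Finset.mem_insert_of_mem (Finset.mem_union_right _ (Finset.mem_image.2 ⟨(i,j), Finset.mem_univ _, rfl⟩))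
  exact (((hl _ m2).sub (hl _ (m1 i))).sub (hl _ (m1 j))).div_const _

theorem Hs_eq_A (hn : 2 ≤ n) (hC : 1 ≤ C) (S : Sol m C u) (y : Es n) : Amat u = Hs u y := by
  have hA : (Amat u).IsHermitian := by
    ext i j
    simp only [Amat, Matrix.conjTranspose_apply, star_trivial]
    rw [add_comm (Pi.single j 1 : Fin n → ℝ)]; ring
  have hq : ∀ q, q ⬝ᵥ (Amat u *ᵥ q) = Mx u q := by
    intro q
    obtain ⟨x, h1, h2⟩ := Amat_lim hn hC S q
    refine tendsto_nhds_unique ?_ h2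
    have : Continuous fun V : Matrix (Fin n) (Fin n) ℝ => q ⬝ᵥ (V *ᵥ q) := by fun_prop
    exact (this.tendsto _).comp h1
  obtain ⟨K, hK0, hK⟩ := Hess_bound hC S
  refine NS_mono (k := m) (S.hV y) hA ((S.gm y).mono (by omega)) (fun q => ?_) ?_
  · rw [Matrix.sub_mulVec, dotProduct_sub, hq, sub_nonneg]
    exact le_csSup ⟨K * (q ⬝ᵥ q), by rintro _ ⟨x, rfl⟩; exact hK x q⟩ ⟨y, rfl⟩
  · rw [S.eq]
    obtain ⟨x, h1, _⟩ := Amat_lim hn hC S 0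
    refine tendsto_nhds_unique ((((cont_NS (m+1)).tendsto _).comp h1)) ?_
    have : (fun V : Matrix (Fin n) (Fin n) ℝ => NS (m+1) V) ∘ (fun k => Hs u (x k)) = fun _ => 1 := funext fun k => S.eq _
    rw [this]; exact tendsto_const_nhds

theorem const_of_dd {f : Es n → ℝ} (hf : Sm f) (h : ∀ i x, dv (Pi.single i 1) f x = 0) (x : Es n) : f x = f 0 := by
  refine is_const_of_fderiv_eq_zero (𝕜 := ℝ) hf.diff (fun y => ?_) x 0
  ext v
  have h1 : dv (v : Fin n → ℝ) f y = 0 := by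
    rw [dv_lin]; exact Finset.sum_eq_zero fun i _ => by rw [show dd i f y = 0 from h i y, mul_zero]
  exact h1

theorem quad_of_Hs (hu : Sm u) (A : Matrix (Fin n) (Fin n) ℝ) (hA : ∀ x, A = Hs u x) : IsQuadraticPolynomial u := by
  have hs : ∀ i j, A i j = A j i := fun i j => by
    have := (Hs_symm hu 0).apply i j
    rw [← hA 0] at this; simpa using this.symm
  have sl : ∀ j, Sm (fun x : Es n => ∑ i, A i j * x i) := fun j => Sm.sum fun i _ => (Sm.const _).mul (Sm.coord i)
  have dl : ∀ j q, dv q (fun x : Es n => ∑ i, A i j * x i) = fun _ => ∑ i, A i j * q i := fun j q => by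
    rw [dv_sum _ (fun i _ => (Sm.const _).mul (Sm.coord i))]
    funext x
    refine Finset.sum_congr rfl fun i _ => ?_
    rw [dv_cmul _ (Sm.coord i), dv_coord]
  have h1 : ∀ j x, dv (Pi.single j 1) u x - ∑ i, A i j * x i = dv (Pi.single j 1) u 0 := by
    intro j x
    have := const_of_dd ((hu.dv (Pi.single j 1)).sub (sl j)) (fun i y => by
      rw [dv_sub (hu.dv _) (sl j), dl]
      have : A i j = dv (Pi.single i 1) (dv (Pi.single j 1) u) y := by rw [hA y]; rfl
      simp [← this, Pi.single_apply]) x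
    simpa using this
  set b : Fin n → ℝ := fun j => dv (Pi.single j 1) u 0
  have sq : Sm (fun x : Es n => ∑ j, x j * ∑ i, A i j * x i) := Sm.sum fun j _ => (Sm.coord j).mul (sl j)
  have sb : Sm (fun x : Es n => ∑ j, b j * x j) := Sm.sum fun j _ => (Sm.const _).mul (Sm.coord j)
  have h2 : ∀ x, u x - (1/2) * (∑ j, x j * ∑ i, A i j * x i) - ∑ j, b j * x j = u 0 := by
    intro x
    have := const_of_dd ((hu.sub ((Sm.const (1/2)).mul sq)).sub sb) (fun k y => by
      rw [dv_sub (hu.sub ((Sm.const (1/2)).mul sq)) sb, dv_sub hu ((Sm.const (1/2)).mul sq), dv_cmul _ sq,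
        dv_sum _ (fun j _ => (Sm.coord j).mul (sl j)), dv_sum _ (fun i _ => (Sm.const _).mul (Sm.coord i))]
      have e1 : ∀ j, dv (Pi.single k 1) (fun x : Es n => x j * ∑ i, A i j * x i) y = y j * A k j + (Pi.single k 1 : Fin n → ℝ) j * ∑ i, A i j * y i := fun j => by
        rw [dv_mul (Sm.coord j) (sl j), dl, dv_coord]
        simp [Pi.single_apply, mul_comm]
      have e2 : ∀ j, dv (Pi.single k 1) (fun x : Es n => b j * x j) y = b j * (Pi.single k 1 : Fin n → ℝ) j := fun j => by
        rw [dv_cmul _ (Sm.coord j), dv_coord]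
      simp only [e1, e2]
      have := h1 k y
      rw [Finset.sum_add_distrib]
      have e3 : ∑ j, y j * A k j = ∑ i, A i k * y i := Finset.sum_congr rfl fun j _ => by rw [hs k j, mul_comm]
      rw [e3]
      simp [Pi.single_apply]
      simp only [b] at *
      linarith) x
    simpa using this
  refine ⟨A, b, u 0, ?_, fun x => ?_⟩
  · ext i j; exact hs j i
  · have e : ∑ i, ∑ j, A i j * x i * x j = ∑ j, x j * ∑ i, A i j * x i := by
      rw [Finset.sum_comm]
      refine Finset.sum_congr rfl fun j _ => ?_
      rw [Finset.mul_sum]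
      exact Finset.sum_congr rfl fun i _ => by ring
    rw [e]; linarith [h2 x]

theorem hessEigen_NS (hu : Sm u) (x : Es n) (j : ℕ) : esymmF n j (hessEigen u x) = NS j (Hs u x) := by
  have hH : (hessianMatrix u x).IsHermitian := by rw [Hs_eq hu]; exact Hs_symm hu x
  obtain ⟨Q, d⟩ := exists_Dg hH
  have h1 : hessEigen u x = hH.eigenvalues := by unfold hessEigen; rw [dif_pos hH]
  rw [h1, ← Hs_eq hu x, d.ns]; rfl
end P6

/-- **Liouville theorem for the `k`-Hessian equation.** A smooth entire `k`-convex solution of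
`σ_k(D²u) = 1` with quadratic growth that is moreover `(k+1)`-convex is a quadratic
polynomial. -/
theorem liouville_k_hessian (n k : ℕ) (hn : 2 ≤ n) (hk1 : 1 ≤ k) (hk2 : k ≤ n - 1)
    (u : EuclideanSpace ℝ (Fin n) → ℝ) (hu : ContDiff ℝ (⊤ : ℕ∞) u)
    (hadm : ∀ x, hessEigen u x ∈ GammaK n k)
    (heq : ∀ x, esymmF n k (hessEigen u x) = 1)
    (hquad : QuadraticGrowth u)
    (hconv : ∀ x, hessEigen u x ∈ GammaK n (k + 1)) :
    IsQuadraticPolynomial u := by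
  obtain ⟨m, rfl⟩ : ∃ m, k = m + 1 := ⟨k - 1, by omega⟩
  obtain ⟨C, hC, hg⟩ := hquad
  have hsm : Sm u := hu
  have S : Sol m (max C 1) u :=
    { sm := hu
      gm := fun x j h1 h2 => by rw [← hessEigen_NS hsm]; exact hconv x j h1 h2
      eq := fun x => by rw [← hessEigen_NS hsm]; exact heq x
      gw := fun x => by
        refine le_trans ?_ (hg x)
        have h1 : (max C 1)⁻¹ ≤ C⁻¹ := inv_anti₀ hC (le_max_left _ _)
        have h2 := mul_le_mul_of_nonneg_right h1 (sq_nonneg ‖x‖)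
        linarith [le_max_left C 1] }
  exact quad_of_Hs hsm _ (Hs_eq_A hn (le_max_right _ _) S)
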